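/- For every f : P → ℂ, every λ ∈ P and every ν ∈ P_ϑ⋆: τ_{w_λ}⁻¹ (I_{w_λ} f)(w_λ(λ−ν)) = a_{λ,ν} (𝒥 f)(λ−ν) + b_{λ,ν} (1 − τ₀⁻²) (𝒥 f)(λ). Consequently, for every ω ∈ P⁺ that is minuscule or quasi-minuscule, the discrete Laplacian L_ω defined by (L_ω g)(λ) := ∑_{ν∈W₀ω} ( a_{λ,ν} g(λ−ν) + b_{λ,ν}(1−τ₀⁻²) g(λ) ) satisfies the intertwining relation L_ω ∘ 𝒥 = 𝒥 ∘ (∑_{ν∈W₀ω} t_ν) on functions P → ℂ. -/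

import Mathlib

open scoped RealInnerProductSpace BigOperators Classical

noncomputable section

/-- Alternating composition `A ∘ B ∘ A ∘ ⋯` with `m` factors (starting with `A`). -/
def altComp {α : Type*} (A B : α → α) : ℕ → (α → α)
  | 0 => id
  | m + 1 => A ∘ altComp B A m

/-- The sign of a real number, as an integer (with `sgnZ 0 = 0`). -/
def sgnZ (x : ℝ) : ℤ := if 0 < x then 1 else if x < 0 then -1 else 0

/-- The function `v(x) = (1-t²)∫₀ˣ dy/(1-2t cos y+t²)`. -/
def mvfun (t x : ℝ) : ℝ :=
  (1 - t ^ 2) * ∫ y in (0:ℝ)..x, 1 / (1 - 2 * t * Real.cos y + t ^ 2)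

section AffineOps

variable {V : Type*} [NormedAddCommGroup V] [InnerProductSpace ℝ V]

/-- The coroot `α∨ = 2α/⟨α,α⟩`. -/
def coroot (α : V) : V := (2 / ⟪α, α⟫) • α

/-- The affine root `a = α∨ + r c` (encoded as the pair `(α, r)`), as an affine
function on `V`. -/
def aval (c : ℝ) (a : V × ℤ) (x : V) : ℝ := ⟪x, coroot a.1⟫ + a.2 * c

/-- The affine reflection `s_a(x) = x - a(x) α` attached to `a = α∨ + r c`. -/
def sAff (c : ℝ) (a : V × ℤ) (x : V) : V := x - aval c a x • a.1

/-- `w` maps the affine root `a` to the affine root `b`, i.e. `(wa)(x) = a(w⁻¹x) = b(x)`. -/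
def mapsRoot (c : ℝ) (w : Equiv.Perm V) (a b : V × ℤ) : Prop :=
  ∀ x : V, aval c a (w⁻¹ x) = aval c b x

/-- The linear part `w′` of an affine transformation `w`. -/
def linPart (w : Equiv.Perm V) (x : V) : V := w x - w 0

variable {R : Type*} [Field R]

/-- The difference-reflection operator `T̂_a`. -/
def hatT (c : ℝ) (τ : V × ℤ → R) (a : V × ℤ) (f : V → R) (x : V) : R :=
  if 0 < aval c a x then τ a * f (sAff c a x)
  else if aval c a x = 0 then τ a * f x
  else (τ a)⁻¹ * f (sAff c a x) + (τ a - (τ a)⁻¹) * f x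

/-- The discrete integral operator `J_a`. -/
def Jop (c : ℝ) (a : V × ℤ) (f : V → R) (x : V) : R :=
  if 0 < aval c a x then
    - ∑ k ∈ Finset.Icc (1 : ℤ) ⌊aval c a x⌋, f (x - k • a.1)
  else if aval c a x = 0 then 0
  else ∑ k ∈ Finset.Ico (0 : ℤ) (-⌊aval c a x⌋), f (x + k • a.1)

/-- The integral-reflection operator `I_a = τ_a s_a + (τ_a - τ_a⁻¹) J_a`. -/
def Iop (c : ℝ) (τ : V × ℤ → R) (a : V × ℤ) (f : V → R) (x : V) : R :=
  τ a * f (sAff c a x) + (τ a - (τ a)⁻¹) * Jop c a f x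

end AffineOps

/-- An irreducible reduced crystallographic root system spanning `V`, together with a
choice of positive roots, simple roots, and the highest short root. -/
structure RootSystemData (V : Type*) [NormedAddCommGroup V] [InnerProductSpace ℝ V] :
    Type _ where
  n : ℕ
  n_pos : 1 ≤ n
  rank_eq : Module.finrank ℝ V = n
  R0 : Finset V
  ne_zero : ∀ α ∈ R0, α ≠ (0 : V)
  span_top : Submodule.span ℝ (R0 : Set V) = ⊤
  reduced : ∀ α ∈ R0, ∀ t : ℝ, t • α ∈ R0 → t = 1 ∨ t = -1
  crystallographic : ∀ α ∈ R0, ∀ β ∈ R0, ∃ k : ℤ, ⟪β, coroot α⟫ = (k : ℝ)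
  reflect_mem : ∀ α ∈ R0, ∀ β ∈ R0, β - ⟪β, coroot α⟫ • α ∈ R0
  irreducible : ∀ S : Finset V, S ⊆ R0 →
      (∀ a ∈ S, ∀ b ∈ R0, b ∉ S → ⟪a, b⟫ = 0) → S = ∅ ∨ S = R0
  pos : Finset V
  pos_subset : pos ⊆ R0
  pos_or_neg : ∀ α ∈ R0, α ∈ pos ∨ -α ∈ pos
  pos_not_both : ∀ α ∈ pos, -α ∉ pos
  pos_add : ∀ α ∈ pos, ∀ β ∈ pos, α + β ∈ R0 → α + β ∈ pos
  simpleRoot : Fin n → V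
  simpleRoot_mem : ∀ j, simpleRoot j ∈ pos
  pos_natCombo : ∀ α ∈ pos, ∃ k : Fin n → ℕ, α = ∑ j, (k j : ℝ) • simpleRoot j
  hshort : V
  hshort_mem : hshort ∈ pos
  hshort_short : ∀ α ∈ R0, ‖hshort‖ ≤ ‖α‖
  hshort_highest : ∀ α ∈ R0, ‖α‖ = ‖hshort‖ →
      ∃ k : Fin n → ℕ, hshort - α = ∑ j, (k j : ℝ) • simpleRoot j

namespace RootSystemData

variable {V : Type*} [NormedAddCommGroup V] [InnerProductSpace ℝ V]
variable (D : RootSystemData V)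

/-- The weight lattice `P`. -/
def weightLattice : Set V :=
  {x : V | ∀ α ∈ D.R0, ∃ k : ℤ, ⟪x, coroot α⟫ = (k : ℝ)}

/-- The root lattice `Q`. -/
def rootLattice : Set V := (Submodule.span ℤ (D.R0 : Set V) : Set V)

/-- The coweight lattice `P∨`. -/
def coweightLattice : Set V :=
  {x : V | ∀ α ∈ D.R0, ∃ k : ℤ, ⟪x, α⟫ = (k : ℝ)}

/-- The dominant cone. -/
def dominant : Set V := {x : V | ∀ α ∈ D.pos, 0 ≤ ⟪x, coroot α⟫}

/-- `ω` is a minuscule (dominant) weight. -/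
def IsMinuscule (ω : V) : Prop :=
  ω ∈ D.weightLattice ∧ ω ∈ D.dominant ∧ ω ≠ 0 ∧
    ∀ α ∈ D.pos, ⟪ω, coroot α⟫ ≤ 1

/-- `ω` is the quasi-minuscule weight, i.e. the highest short root. -/
def IsQuasiMinuscule (ω : V) : Prop := ω = D.hshort

/-- The saturated set `P_ϑ` containing the (quasi-)minuscule weights. -/
def Ptheta : Set V :=
  {ν : V | ν ∈ D.weightLattice ∧ ∀ α ∈ D.R0, α ≠ ν → |⟪ν, coroot α⟫| ≤ 1}

/-- Half sum of the positive roots. -/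
def rhoHalf : V := (2⁻¹ : ℝ) • ∑ α ∈ D.pos, α

/-- Half sum of the positive coroots. -/
def rhoVee : V := (2⁻¹ : ℝ) • ∑ α ∈ D.pos, coroot α

/-- `(α, r)` encodes an affine root. -/
def IsAffRoot (a : V × ℤ) : Prop := a.1 ∈ D.R0

/-- `(α, r)` encodes a positive affine root. -/
def IsAffPos (a : V × ℤ) : Prop :=
  a.1 ∈ D.R0 ∧ (1 ≤ a.2 ∨ (a.2 = 0 ∧ a.1 ∈ D.pos))

/-- `(α, r)` encodes a negative affine root. -/
def IsAffNeg (a : V × ℤ) : Prop := D.IsAffPos (-a.1, -a.2)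

/-- The simple affine roots `a₀ = -ϑ∨ + c`, `a_j = α_j∨`. -/
def aSimple (j : Fin (D.n + 1)) : V × ℤ :=
  Fin.cons (α := fun _ => V × ℤ) (-D.hshort, (1 : ℤ))
    (fun i => (D.simpleRoot i, (0 : ℤ))) j

/-- The reflections generating the finite Weyl group `W₀`. -/
def W0Gens : Set (Equiv.Perm V) :=
  {e | ∃ α ∈ D.R0, ∀ x, e x = x - ⟪x, coroot α⟫ • α}

/-- The finite Weyl group `W₀`. -/
def W0 : Subgroup (Equiv.Perm V) := Subgroup.closure D.W0Gens

variable (c : ℝ)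

/-- The affine reflections generating the affine Weyl group `W_R`. -/
def AffGens : Set (Equiv.Perm V) :=
  {e | ∃ a : V × ℤ, D.IsAffRoot a ∧ ∀ x, e x = sAff c a x}

/-- The affine Weyl group `W_R`. -/
def WR : Subgroup (Equiv.Perm V) := Subgroup.closure (D.AffGens c)

/-- The translations `t_{cλ}`, `λ ∈ P`. -/
def TransGens : Set (Equiv.Perm V) :=
  {e | ∃ lam ∈ D.weightLattice, ∀ x : V, e x = x + c • lam}

/-- The extended affine Weyl group `W = W₀ ⋉ t(cP)`. -/
def Wext : Subgroup (Equiv.Perm V) :=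
  Subgroup.closure (D.AffGens c ∪ D.TransGens c)

/-- The set `R(w) = R⁺ ∩ w⁻¹(R⁻)`. -/
def RW (w : Equiv.Perm V) : Set (V × ℤ) :=
  {a | D.IsAffPos a ∧ ∃ b : V × ℤ, D.IsAffNeg b ∧ mapsRoot c w a b}

/-- The length `ℓ(w) = #R(w)`. -/
def len (w : Equiv.Perm V) : ℕ := (D.RW c w).ncard

/-- The closed fundamental alcove `A_c`. -/
def alcove : Set V := {x | ∀ a : V × ℤ, D.IsAffPos a → 0 ≤ aval c a x}

/-- `wmin x` is the unique shortest element of the affine Weyl group mapping `x` into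
the fundamental alcove. -/
def IsWmin (wmin : V → Equiv.Perm V) : Prop :=
  ∀ x : V, wmin x ∈ D.WR c ∧ (wmin x) x ∈ D.alcove c ∧
    ∀ w ∈ D.WR c, w x ∈ D.alcove c → D.len c (wmin x) < D.len c w ∨ w = wmin x

/-- One step in the Bruhat order: `w < w s_a` whenever `ℓ(w) < ℓ(w s_a)`. -/
def bruhatStep (w w' : Equiv.Perm V) : Prop :=
  ∃ a : V × ℤ, D.IsAffPos a ∧ ∃ e : Equiv.Perm V,
    (∀ x, e x = sAff c a x) ∧ w' = w * e ∧ D.len c w < D.len c w'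

/-- The Bruhat order on the affine Weyl group. -/
def bruhatLE (w w' : Equiv.Perm V) : Prop :=
  Relation.ReflTransGen (D.bruhatStep c) w w'

/-- The partial order on `V`: `x ≤ y` iff `x₊ = y₊` and `w_x ≤ w_y` (Bruhat). -/
def vle (wmin : V → Equiv.Perm V) (x y : V) : Prop :=
  (wmin x) x = (wmin y) y ∧ D.bruhatLE c (wmin x) (wmin y)

/-- The interval `[x, y]` for the order `vle`. -/
def vInterval (wmin : V → Equiv.Perm V) (x y : V) : Set V :=
  {z : V | D.vle c wmin x z ∧ D.vle c wmin z y}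

/-- The partial order `⪯` on the weight lattice:
`μ ⪯ λ` iff `λ - μ ∈ Q` and `Conv [μ₊, μ] ⊆ Conv [λ₊, λ]`. -/
def pleq (wmin : V → Equiv.Perm V) (μ lam : V) : Prop :=
  lam - μ ∈ D.rootLattice ∧
    convexHull ℝ (D.vInterval c wmin ((wmin μ) μ) μ)
      ⊆ convexHull ℝ (D.vInterval c wmin ((wmin lam) lam) lam)

section Ops

variable {R : Type*} [Field R]

/-- `τ` is a multiplicity function: nonvanishing on affine roots, and invariant
under the (extended affine) Weyl group action on the affine roots. -/
def IsMultiplicity (τ : V × ℤ → R) : Prop :=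
  (∀ a : V × ℤ, D.IsAffRoot a → τ a ≠ 0) ∧
    ∀ w ∈ D.Wext c, ∀ a b : V × ℤ, D.IsAffRoot a → D.IsAffRoot b →
      mapsRoot c w a b → τ a = τ b

/-- `τ_w = ∏_{a ∈ R(w)} τ_a`. -/
def tauw (τ : V × ℤ → R) (w : Equiv.Perm V) : R := ∏ᶠ a ∈ D.RW c w, τ a

/-- `τ₀`, the multiplicity of the affine simple root `a₀`. -/
def tauZero (τ : V × ℤ → R) : R := τ (-D.hshort, (1 : ℤ))

/-- The operator `I_{j₁} ∘ ⋯ ∘ I_{jℓ}` attached to a word in the simple reflections. -/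
def wordOp (τ : V × ℤ → R) (l : List (Fin (D.n + 1))) : (V → R) → V → R :=
  (l.map fun j => Iop c τ (D.aSimple j)).foldr (· ∘ ·) id

/-- `l` is a reduced word for `w`, i.e. `w = s_{j₁} ∘ ⋯ ∘ s_{jℓ}` with `ℓ = ℓ(w)`. -/
def IsReducedWord (w : Equiv.Perm V) (l : List (Fin (D.n + 1))) : Prop :=
  l.length = D.len c w ∧
    ∀ x : V, w x = ((l.map fun j => sAff c (D.aSimple j)).foldr (· ∘ ·) id) x

/-- `e∨_τ(η) = ∏_{α ∈ R₀⁺} τ_{α∨}^{⟨η,α∨⟩}`. -/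
def etau (τ : V × ℤ → R) (η : V) : R :=
  ∏ α ∈ D.pos, τ (α, (0 : ℤ)) ^ ⌊⟪η, coroot α⟫⌋

/-- `h∨_τ = τ₀² e∨_τ(ϑ)`. -/
def hvee (τ : V × ℤ → R) : R := D.tauZero τ ^ 2 * D.etau τ D.hshort

/-- `θ(μ) = #{b ∈ R(w_μ) : b(μ) = -2}`. -/
def theta (wmin : V → Equiv.Perm V) (μ : V) : ℕ :=
  {b : V × ℤ | b ∈ D.RW c (wmin μ) ∧ aval c b μ = -2}.ncard

/-- The coefficient `c_{λ,η} = θ(λ-η) e∨_τ(η) (h∨_τ)^{-sign⟨λ,η∨⟩}`. -/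
def ccoef (τ : V × ℤ → R) (wmin : V → Equiv.Perm V) (lam η : V) : R :=
  (D.theta c wmin (lam - η) : R) * D.etau τ η *
    D.hvee τ ^ (-sgnZ ⟪lam, coroot η⟫)

/-- The coefficient `a_{λ,ν} = τ_{w_{w_λ(λ-ν)}} τ_{w_{w_λ(λ-ν)} w_λ} τ_{w_λ}⁻¹`. -/
def acoef (τ : V × ℤ → R) (wmin : V → Equiv.Perm V) (lam ν : V) : R :=
  D.tauw c τ (wmin ((wmin lam) (lam - ν))) *
    D.tauw c τ (wmin ((wmin lam) (lam - ν)) * wmin lam) *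
    (D.tauw c τ (wmin lam))⁻¹

/-- The coefficient `b_{λ,ν}`. -/
def bcoef (τ : V × ℤ → R) (wmin : V → Equiv.Perm V) (lam ν : V) : R :=
  if (wmin (lam - ν)) (lam - ν) = (wmin lam) lam then
    D.tauw c τ (wmin ((wmin lam) (lam - ν))) ^ 2 *
      (if D.IsAffNeg (ν, ⌊(1 - ⟪lam, coroot ν⟫) / c⌋) then 1 else 0)
  else D.ccoef c τ wmin ((wmin lam) lam) (linPart (wmin lam) ν)

/-- The intertwining operator `(𝒥f)(λ) = τ_{w_λ}⁻¹ (I_{w_λ} f)(λ₊)`, where `Iw` assigns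
to each `w_λ` the composite of integral-reflection operators along a reduced word. -/
def Jcal (τ : V × ℤ → R) (wmin : V → Equiv.Perm V)
    (Iw : Equiv.Perm V → (V → R) → V → R) (f : V → R) (x : V) : R :=
  (D.tauw c τ (wmin x))⁻¹ * Iw (wmin x) f ((wmin x) x)

end Ops

/-- The Yang–Yang type Morse function `𝒱_μ`. -/
def morse (t : V → ℝ) (μ ξ : V) : ℝ :=
  (c / 2) * ⟪ξ, ξ⟫ - 2 * Real.pi * ⟪D.rhoVee + μ, ξ⟫ +
    ∑ α ∈ D.pos, (2 / ⟪α, α⟫) * ∫ x in (0:ℝ)..(⟪ξ, α⟫), mvfun (t α) x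

/-- The critical equation `cξ + ∑_{α>0} v_α(⟨ξ,α⟩) α∨ = 2π(ρ∨+μ)`. -/
def criticalEq (t : V → ℝ) (μ ξ : V) : Prop :=
  c • ξ + ∑ α ∈ D.pos, mvfun (t α) ⟪ξ, α⟫ • coroot α
    = (2 * Real.pi) • (D.rhoVee + μ)

/-- The Hessian bilinear form `H_{η,ζ}(ξ)`. -/
def hessForm (t : V → ℝ) (ξ η ζ : V) : ℝ :=
  c * ⟪η, ζ⟫ + ∑ α ∈ D.R0,
    (1 - t α ^ 2) * ⟪η, α⟫ * ⟪ζ, α⟫ /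
      (⟪α, α⟫ * (1 - 2 * t α * Real.cos ⟪ξ, α⟫ + t α ^ 2))

/-- `κ_± = (2/n) ∑_{α>0} (1-t_α²)/(1 ± |t_α|)²`; here `s = ±1`. -/
def kappaPM (t : V → ℝ) (s : ℝ) : ℝ :=
  (2 / (D.n : ℝ)) * ∑ α ∈ D.pos, (1 - t α ^ 2) / (1 + s * |t α|) ^ 2

end RootSystemData

namespace AW
open RootSystemData

section basic
variable {V : Type*} [NormedAddCommGroup V] [InnerProductSpace ℝ V]

lemma inner_coroot (x α : V) : ⟪x, coroot α⟫ = 2 / ⟪α, α⟫ * ⟪x, α⟫ := by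
  simp [coroot, inner_smul_right]

lemma coroot_neg (α : V) : coroot (-α) = -coroot α := by
  simp [coroot]

lemma inner_self_pos {α : V} (h : α ≠ 0) : 0 < ⟪α, α⟫ := by
  rw [real_inner_self_eq_norm_sq]; positivity

lemma inner_coroot_self {α : V} (h : α ≠ 0) : ⟪α, coroot α⟫ = 2 := by
  have := inner_self_pos h
  rw [inner_coroot]; field_simp

lemma coroot_inj {α β : V} (hα : α ≠ 0) (hβ : β ≠ 0) (h : coroot α = coroot β) : α = β := by
  have e : ∀ γ : V, γ ≠ 0 → (2 / ⟪coroot γ, coroot γ⟫) • coroot γ = γ := by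
    intro γ hγ
    have := inner_self_pos hγ
    simp only [coroot, inner_smul_left, inner_smul_right, smul_smul]
    simp only [conj_trivial]
    have : (2 / (2 / ⟪γ, γ⟫ * (2 / ⟪γ, γ⟫ * ⟪γ, γ⟫)) * (2 / ⟪γ, γ⟫)) = 1 := by field_simp
    rw [this, one_smul]
  rw [← e α hα, ← e β hβ, h]

/-- the linear reflection -/
def refl (β x : V) : V := x - ⟪x, coroot β⟫ • β

lemma refl_refl {β : V} (h : β ≠ 0) (x : V) : refl β (refl β x) = x := by
  simp only [refl, inner_sub_left, inner_smul_left, inner_coroot_self h, conj_trivial]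
  module

lemma inner_refl (β : V) (h : β ≠ 0) (x y : V) : ⟪refl β x, refl β y⟫ = ⟪x, y⟫ := by
  have := inner_self_pos h
  simp only [refl, inner_sub_left, inner_sub_right, inner_smul_left, inner_smul_right,
    inner_coroot, conj_trivial]
  rw [real_inner_comm β y]
  field_simp
  ring

lemma inner_refl_left (β : V) (h : β ≠ 0) (x y : V) : ⟪refl β x, y⟫ = ⟪x, refl β y⟫ := by
  rw [← inner_refl β h (refl β x) y, refl_refl h]

lemma refl_smul (β : V) (t : ℝ) (x : V) : refl β (t • x) = t • refl β x := by
  simp only [refl, inner_smul_left, conj_trivial]; module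

lemma refl_neg (β x : V) : refl β (-x) = - refl β x := by
  simp only [refl, inner_neg_left]; module

lemma refl_sub (β x y : V) : refl β (x - y) = refl β x - refl β y := by
  simp only [refl, inner_sub_left]; module

lemma refl_self {β : V} (h : β ≠ 0) : refl β β = -β := by
  simp only [refl, inner_coroot_self h]; module

lemma coroot_refl (β : V) (h : β ≠ 0) (α : V) : coroot (refl β α) = refl β (coroot α) := by
  simp only [coroot, inner_refl β h, refl_smul]

lemma coroot_refl' (β : V) (h : β ≠ 0) (α : V) :
    coroot (refl β α) = coroot α - ⟪β, coroot α⟫ • coroot β := by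
  rw [coroot_refl β h]
  simp only [refl]
  congr 1
  rw [inner_coroot, inner_coroot β]
  simp only [coroot, inner_smul_left, smul_smul, conj_trivial]
  rw [real_inner_comm α β]
  congr 1; ring

lemma aval_sub (c : ℝ) (a : V × ℤ) (x y : V) :
    aval c a (x - y) = aval c a x - ⟪y, coroot a.1⟫ := by
  simp only [aval, inner_sub_left]; ring

lemma aval_add (c : ℝ) (a : V × ℤ) (x y : V) :
    aval c a (x + y) = aval c a x + ⟪y, coroot a.1⟫ := by
  simp only [aval, inner_add_left]; ring

lemma aval_neg (c : ℝ) (a : V × ℤ) (x : V) : aval c (-a) x = - aval c a x := by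
  simp only [aval, Prod.fst_neg, Prod.snd_neg, coroot_neg, inner_neg_right]; push_cast; ring

lemma aval_sAff (c : ℝ) (a b : V × ℤ) (x : V) :
    aval c a (sAff c b x) = aval c a x - ⟪b.1, coroot a.1⟫ * aval c b x := by
  rw [sAff, aval_sub, inner_smul_left]; simp; ring

lemma sAff_invol (c : ℝ) (b : V × ℤ) (h : b.1 ≠ 0) : Function.Involutive (sAff c b) := by
  intro x
  conv_lhs => rw [sAff]
  rw [aval_sAff, inner_coroot_self h, sAff]; module

/-- the affine reflection as a permutation -/
def sP (c : ℝ) (b : V × ℤ) : Equiv.Perm V :=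
  if h : Function.Involutive (sAff c b) then h.toPerm else 1

lemma sP_apply (c : ℝ) (b : V × ℤ) (h : b.1 ≠ 0) (x : V) : sP c b x = sAff c b x := by
  rw [sP, dif_pos (sAff_invol c b h)]; rfl

lemma sP_sP (c : ℝ) (b : V × ℤ) (h : b.1 ≠ 0) : sP c b * sP c b = 1 := by
  ext x
  simp only [Equiv.Perm.mul_apply, sP_apply c b h, Equiv.Perm.one_apply]
  exact sAff_invol c b h x

lemma sP_inv (c : ℝ) (b : V × ℤ) (h : b.1 ≠ 0) : (sP c b)⁻¹ = sP c b :=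
  inv_eq_of_mul_eq_one_left (sP_sP c b h)

/-- the reflected affine root `s_b a` -/
def srefl (b a : V × ℤ) : V × ℤ := (refl b.1 a.1, a.2 - ⌊⟪b.1, coroot a.1⟫⌋ * b.2)

lemma aval_inj {c : ℝ} (hc : 0 < c) {a b : V × ℤ} (ha : a.1 ≠ 0) (hb : b.1 ≠ 0)
    (h : ∀ x, aval c a x = aval c b x) : a = b := by
  have h0 := h 0
  simp only [aval, inner_zero_left, zero_add] at h0
  have h2 : a.2 = b.2 := by
    have := mul_right_cancel₀ hc.ne' h0
    exact_mod_cast this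
  have h1 : coroot a.1 = coroot b.1 := by
    refine ext_inner_left ℝ fun x => ?_
    have := h x
    simp only [aval, h2] at this
    linarith
  exact Prod.ext (coroot_inj ha hb h1) h2
end basic

section rs
variable {V : Type*} [NormedAddCommGroup V] [InnerProductSpace ℝ V] (D : RootSystemData V)

lemma refl_mem {α β : V} (hα : α ∈ D.R0) (hβ : β ∈ D.R0) : refl α β ∈ D.R0 :=
  D.reflect_mem α hα β hβ

lemma neg_mem {α : V} (hα : α ∈ D.R0) : -α ∈ D.R0 := by
  rw [← refl_self (D.ne_zero α hα)]; exact refl_mem D hα hα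

lemma pos_mem {α : V} (hα : α ∈ D.pos) : α ∈ D.R0 := D.pos_subset hα

lemma srefl_mem {a b : V × ℤ} (ha : D.IsAffRoot a) (hb : D.IsAffRoot b) :
    D.IsAffRoot (srefl b a) := refl_mem D hb ha

lemma aval_srefl (c : ℝ) {a b : V × ℤ} (ha : D.IsAffRoot a) (hb : D.IsAffRoot b) (x : V) :
    aval c (srefl b a) x = aval c a (sAff c b x) := by
  rw [aval_sAff]
  obtain ⟨k, hk⟩ := D.crystallographic a.1 ha b.1 hb
  simp only [aval, srefl, coroot_refl' b.1 (D.ne_zero _ hb), inner_sub_right, inner_smul_right, hk,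
    Int.floor_intCast]
  push_cast; ring

lemma simple_span : (⊤ : Submodule ℝ V) ≤ Submodule.span ℝ (Set.range D.simpleRoot) := by
  rw [← D.span_top, Submodule.span_le]
  have hp : ∀ α ∈ D.pos, α ∈ Submodule.span ℝ (Set.range D.simpleRoot) := by
    intro α hα
    obtain ⟨k, rfl⟩ := D.pos_natCombo α hα
    exact Submodule.sum_mem _ fun j _ => Submodule.smul_mem _ _ (Submodule.subset_span ⟨j, rfl⟩)
  intro α hα
  rcases D.pos_or_neg α hα with h | h
  · exact hp α h
  · have := Submodule.neg_mem _ (hp _ h)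
    rwa [neg_neg] at this

theorem fd {V : Type*} [NormedAddCommGroup V] [InnerProductSpace ℝ V] (D : RootSystemData V) :
    FiniteDimensional ℝ V := by
  have := D.n_pos
  exact FiniteDimensional.of_finrank_pos (by rw [D.rank_eq]; omega)

lemma simple_li : LinearIndependent ℝ D.simpleRoot := by
  haveI := fd D
  exact linearIndependent_of_top_le_span_of_card_eq_finrank (simple_span D) (by simp [D.rank_eq])

lemma exists_inner (f : Fin D.n → ℝ) : ∃ x : V, ∀ j, ⟪x, D.simpleRoot j⟫ = f j := by
  haveI := fd D
  let b := Module.Basis.mk (simple_li D) (simple_span D)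
  let φ : V →ₗ[ℝ] ℝ := b.constr ℝ f
  let ψ : V →L[ℝ] ℝ := LinearMap.toContinuousLinearMap φ
  refine ⟨(InnerProductSpace.toDual ℝ V).symm ψ, fun j => ?_⟩
  rw [InnerProductSpace.toDual_symm_apply]
  have : b j = D.simpleRoot j := by simp [b]
  show φ (D.simpleRoot j) = f j
  rw [← this, Module.Basis.constr_basis]

lemma coord_unique {k l : Fin D.n → ℝ} (h : ∑ j, k j • D.simpleRoot j = ∑ j, l j • D.simpleRoot j) :
    k = l := by
  have hl := Fintype.linearIndependent_iff.1 (simple_li D) (fun j => k j - l j) (by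
    simp only [sub_smul, Finset.sum_sub_distrib, h, sub_self])
  funext j
  linarith [hl j]

/-- a positive height vector -/
lemma exists_height : ∃ x : V, (∀ j, ⟪x, D.simpleRoot j⟫ = 1) ∧ ∀ α ∈ D.pos, 0 < ⟪x, α⟫ := by
  obtain ⟨x, hx⟩ := exists_inner D (fun _ => 1)
  refine ⟨x, hx, fun α hα => ?_⟩
  obtain ⟨k, hk⟩ := D.pos_natCombo α hα
  have h0 : α ≠ 0 := D.ne_zero α (pos_mem D hα)
  have : ⟪x, α⟫ = ∑ j, (k j : ℝ) := by
    rw [hk, inner_sum]; simp [inner_smul_right, hx]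
  rw [this]
  refine lt_of_le_of_ne (Finset.sum_nonneg fun j _ => Nat.cast_nonneg _) fun h => h0 ?_
  have := (Finset.sum_eq_zero_iff_of_nonneg (fun j _ => Nat.cast_nonneg (k j))).1 h.symm
  rw [hk]
  exact Finset.sum_eq_zero fun j hj => by rw [this j hj, zero_smul]

lemma inner_coroot_pos {x α : V} (h : α ≠ 0) : 0 < ⟪x, coroot α⟫ ↔ 0 < ⟪x, α⟫ := by
  rw [inner_coroot]
  have := inner_self_pos h
  constructor
  · intro h'; exact (mul_pos_iff_of_pos_left (by positivity)).1 h'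
  · intro h'; positivity

/-- an interior point of the fundamental alcove -/
lemma exists_x0 {c : ℝ} (hc : 0 < c) : ∃ x0 : V, ∀ a : V × ℤ, D.IsAffRoot a →
    (D.IsAffPos a ↔ 0 < aval c a x0) ∧ (D.IsAffNeg a ↔ aval c a x0 < 0) := by
  obtain ⟨x1, -, hx1⟩ := exists_height D
  set M : ℝ := 1 + ∑ α ∈ D.R0, |⟪x1, coroot α⟫| with hM
  have hMpos : 0 < M := by positivity
  have hlt : ∀ α ∈ D.R0, |⟪x1, coroot α⟫| < M := by
    intro α hα
    have := Finset.single_le_sum (f := fun α => |⟪x1, coroot α⟫|) (fun _ _ => abs_nonneg _) hα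
    linarith
  have key : ∀ a : V × ℤ, D.IsAffRoot a → (D.IsAffPos a ↔ 0 < aval c a ((c / M) • x1)) := by
    rintro ⟨α, r⟩ ha
    have ha' : α ∈ D.R0 := ha
    have h1 : |⟪(c / M) • x1, coroot α⟫| < c := by
      rw [inner_smul_left, abs_mul]
      simp only [conj_trivial]
      rw [abs_of_pos (by positivity), div_mul_eq_mul_div, div_lt_iff₀ hMpos]
      exact mul_lt_mul_of_pos_left (hlt α ha') hc
    have h2 : 0 < ⟪(c / M) • x1, coroot α⟫ ↔ α ∈ D.pos := by
      have e : 0 < ⟪(c / M) • x1, coroot α⟫ ↔ 0 < ⟪x1, α⟫ := by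
        rw [← inner_coroot_pos (D.ne_zero α ha'), inner_smul_left]
        simp only [conj_trivial]
        exact mul_pos_iff_of_pos_left (by positivity)
      rw [e]
      refine ⟨fun h => ?_, hx1 α⟩
      rcases D.pos_or_neg α ha' with h' | h'
      · exact h'
      · have := hx1 _ h'
        rw [inner_neg_right] at this; linarith
    simp only [RootSystemData.IsAffPos, aval]
    rw [abs_lt] at h1
    constructor
    · rintro ⟨-, h | ⟨h, h'⟩⟩
      · have : (1 : ℝ) ≤ r := by exact_mod_cast h
        nlinarith
      · rw [h]; have := h2.2 h'; simpa using this
    · intro h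
      refine ⟨ha', ?_⟩
      rcases lt_trichotomy r 0 with hr | hr | hr
      · have : (r : ℝ) ≤ -1 := by exact_mod_cast (by omega : r ≤ -1)
        nlinarith
      · right; refine ⟨hr, h2.1 ?_⟩; rw [hr] at h; simpa using h
      · left; omega
  refine ⟨(c / M) • x1, fun a ha => ⟨key a ha, ?_⟩⟩
  have := key (-a) (neg_mem D ha)
  rw [aval_neg] at this
  rw [RootSystemData.IsAffNeg]
  change D.IsAffPos (-a) ↔ _
  rw [this]; constructor <;> intro h <;> linarith
end rs
end AW

namespace AW
open RootSystemData

section rs2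
variable {V : Type*} [NormedAddCommGroup V] [InnerProductSpace ℝ V] (D : RootSystemData V)

/-- `x0` is an interior point of the alcove -/
def IsX0 (c : ℝ) (x0 : V) : Prop := ∀ a : V × ℤ, D.IsAffRoot a →
    (D.IsAffPos a ↔ 0 < aval c a x0) ∧ (D.IsAffNeg a ↔ aval c a x0 < 0)

lemma inner_coroot_nonneg {x α : V} (h : α ≠ 0) : 0 ≤ ⟪x, coroot α⟫ ↔ 0 ≤ ⟪x, α⟫ := by
  rw [inner_coroot]
  have := inner_self_pos h
  exact mul_nonneg_iff_of_pos_left (by positivity)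

lemma inner_coroot_zero {x α : V} (h : α ≠ 0) : ⟪x, coroot α⟫ = 0 ↔ ⟪x, α⟫ = 0 := by
  rw [inner_coroot]
  have := inner_self_pos h
  constructor
  · intro h'
    rcases mul_eq_zero.1 h' with h'' | h''
    · exfalso; revert h''; positivity
    · exact h''
  · intro h'; rw [h', mul_zero]

lemma inner_coroot_comm_pos {x α : V} (h : α ≠ 0) (h' : x ≠ 0) :
    0 < ⟪x, coroot α⟫ ↔ 0 < ⟪α, coroot x⟫ := by
  rw [inner_coroot_pos h, inner_coroot_pos h', real_inner_comm]

lemma simple_mem (j : Fin D.n) : D.simpleRoot j ∈ D.R0 := pos_mem D (D.simpleRoot_mem j)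

lemma simple_ne (j : Fin D.n) : D.simpleRoot j ≠ 0 := D.ne_zero _ (simple_mem D j)

lemma aSimple_zero : D.aSimple 0 = (-D.hshort, 1) := rfl
lemma aSimple_succ (j : Fin D.n) : D.aSimple j.succ = (D.simpleRoot j, 0) := rfl

lemma hshort_mem0 : D.hshort ∈ D.R0 := pos_mem D D.hshort_mem
lemma hshort_ne : D.hshort ≠ 0 := D.ne_zero _ (hshort_mem0 D)

lemma aSimple_root (j : Fin (D.n + 1)) : D.IsAffRoot (D.aSimple j) := by
  refine Fin.cases ?_ (fun i => ?_) j
  · rw [aSimple_zero]; exact neg_mem D (hshort_mem0 D)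
  · rw [aSimple_succ]; exact simple_mem D i

lemma aSimple_pos (j : Fin (D.n + 1)) : D.IsAffPos (D.aSimple j) := by
  refine Fin.cases ?_ (fun i => ?_) j
  · rw [aSimple_zero]; exact ⟨neg_mem D (hshort_mem0 D), Or.inl le_rfl⟩
  · rw [aSimple_succ]; exact ⟨simple_mem D i, Or.inr ⟨rfl, D.simpleRoot_mem i⟩⟩

lemma aSimple_ne (j : Fin (D.n + 1)) : (D.aSimple j).1 ≠ 0 := D.ne_zero _ (aSimple_root D j)

/-- finite reflection permutes positive roots -/
lemma refl_simple_pos (j : Fin D.n) {α : V} (hα : α ∈ D.pos) (hne : α ≠ D.simpleRoot j) :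
    refl (D.simpleRoot j) α ∈ D.pos := by
  obtain ⟨k, hk⟩ := D.pos_natCombo α hα
  have hex : ∃ i, i ≠ j ∧ k i ≠ 0 := by
    by_contra hcon
    push Not at hcon
    have : α = (k j : ℝ) • D.simpleRoot j := by
      rw [hk]
      exact Finset.sum_eq_single j (fun i _ hi => by rw [hcon i hi]; simp) (by simp)
    have hm : (k j : ℝ) • D.simpleRoot j ∈ D.R0 := this ▸ pos_mem D hα
    rcases D.reduced _ (simple_mem D j) _ hm with h | h
    · rw [h, one_smul] at this; exact hne this
    · have : (0:ℝ) ≤ k j := Nat.cast_nonneg _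
      linarith
  obtain ⟨i, hij, hki⟩ := hex
  rcases D.pos_or_neg _ (refl_mem D (simple_mem D j) (pos_mem D hα)) with h | h
  · exact h
  · exfalso
    obtain ⟨l, hl⟩ := D.pos_natCombo _ h
    have e : ∑ m, (k m : ℝ) • D.simpleRoot m
        = ∑ m, ((if m = j then ⟪α, coroot (D.simpleRoot j)⟫ else 0) - (l m : ℝ)) • D.simpleRoot m := by
      simp only [sub_smul, Finset.sum_sub_distrib, ← hl, ite_smul, zero_smul, Finset.sum_ite_eq',
        Finset.mem_univ, if_true, ← hk, refl]
      module
    have := congrFun (coord_unique D e) i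
    simp only [if_neg hij] at this
    have h1 : (0:ℝ) ≤ l i := Nat.cast_nonneg _
    have h2 : (0:ℝ) < k i := by exact_mod_cast Nat.pos_of_ne_zero hki
    linarith

lemma simple_inner_nonpos {i j : Fin D.n} (h : i ≠ j) :
    ⟪D.simpleRoot i, D.simpleRoot j⟫ ≤ 0 := by
  by_contra hcon
  push Not at hcon
  have hne : D.simpleRoot j ≠ D.simpleRoot i := fun e => h ((simple_li D).injective e).symm
  have hp := refl_simple_pos D i (D.simpleRoot_mem j) hne
  obtain ⟨k, hk⟩ := D.pos_natCombo _ hp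
  rw [real_inner_comm, ← inner_coroot_pos (simple_ne D i)] at hcon
  have e : ∑ m, (k m : ℝ) • D.simpleRoot m
        = ∑ m, ((if m = j then 1 else 0) - (if m = i then ⟪D.simpleRoot j, coroot (D.simpleRoot i)⟫ else 0)) • D.simpleRoot m := by
      simp only [sub_smul, Finset.sum_sub_distrib, ite_smul, zero_smul, Finset.sum_ite_eq',
        Finset.mem_univ, if_true, ← hk, refl, one_smul]
  have := congrFun (coord_unique D e) i
  simp only [if_neg h, if_true] at this
  have h1 : (0:ℝ) ≤ k i := Nat.cast_nonneg _
  linarith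

lemma hshort_dom_simple (j : Fin D.n) : 0 ≤ ⟪D.hshort, D.simpleRoot j⟫ := by
  have hn : ‖refl (D.simpleRoot j) D.hshort‖ = ‖D.hshort‖ := by
    rw [← sq_eq_sq₀ (norm_nonneg _) (norm_nonneg _), ← real_inner_self_eq_norm_sq,
      ← real_inner_self_eq_norm_sq, inner_refl _ (simple_ne D j)]
  obtain ⟨k, hk⟩ := D.hshort_highest _ (refl_mem D (simple_mem D j) (hshort_mem0 D)) hn
  rw [← inner_coroot_nonneg (simple_ne D j)]
  have e : ∑ m, (k m : ℝ) • D.simpleRoot m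
        = ∑ m, (if m = j then ⟪D.hshort, coroot (D.simpleRoot j)⟫ else 0) • D.simpleRoot m := by
      simp only [ite_smul, zero_smul, Finset.sum_ite_eq',
        Finset.mem_univ, if_true, ← hk, refl]
      module
  have := congrFun (coord_unique D e) j
  simp only [if_true] at this
  rw [← this]; exact Nat.cast_nonneg _

lemma hshort_dom {α : V} (hα : α ∈ D.pos) : 0 ≤ ⟪D.hshort, α⟫ := by
  obtain ⟨k, hk⟩ := D.pos_natCombo _ hα
  rw [hk, inner_sum]
  refine Finset.sum_nonneg fun j _ => ?_
  rw [inner_smul_right]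
  exact mul_nonneg (Nat.cast_nonneg _) (hshort_dom_simple D j)

lemma pos_of_inner_hshort {β : V} (hβ : β ∈ D.R0) (h : 0 < ⟪D.hshort, β⟫) : β ∈ D.pos := by
  rcases D.pos_or_neg β hβ with h' | h'
  · exact h'
  · have := hshort_dom D h'
    rw [inner_neg_right] at this; linarith

lemma short_pair_lt {θ β : V} (hβ0 : β ≠ 0) (hs : ‖θ‖ ≤ ‖β‖) (hne : β ≠ θ) :
    ⟪θ, coroot β⟫ < 2 := by
  rw [inner_coroot]
  have hp := inner_self_pos hβ0
  by_contra hcon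
  push Not at hcon
  rw [div_mul_eq_mul_div, le_div_iff₀ hp] at hcon
  have h1 : ⟪θ - β, θ - β⟫ ≤ 0 := by
    simp only [inner_sub_left, inner_sub_right]
    rw [real_inner_comm θ β]
    have : ⟪θ, θ⟫ ≤ ⟪β, β⟫ := by
      rw [real_inner_self_eq_norm_sq, real_inner_self_eq_norm_sq]
      gcongr
    linarith
  have : θ - β = 0 := by
    by_contra hne0
    have := inner_self_pos hne0
    linarith
  exact hne (sub_eq_zero.1 this).symm

lemma short_pair {θ β : V} (hβ : β ∈ D.R0) (hθ : θ ∈ D.R0) (hs : ‖θ‖ ≤ ‖β‖) (h1 : β ≠ θ)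
    (h2 : β ≠ -θ) : |⟪θ, coroot β⟫| ≤ 1 := by
  obtain ⟨k, hk⟩ := D.crystallographic β hβ θ hθ
  have hβ0 := D.ne_zero β hβ
  have a1 := short_pair_lt hβ0 hs h1
  have a2 := short_pair_lt (θ := -θ) hβ0 (by rwa [norm_neg]) h2
  rw [inner_neg_left] at a2
  rw [hk] at a1 a2 ⊢
  have b1 : k < 2 := by exact_mod_cast a1
  have b2 : -k < 2 := by exact_mod_cast a2
  have : |k| ≤ 1 := by rw [abs_le]; omega
  exact_mod_cast this

/-- simple affine reflections permute the other positive roots -/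
lemma srefl_simple_pos (j : Fin (D.n + 1)) {a : V × ℤ} (ha : D.IsAffPos a)
    (hne : a ≠ D.aSimple j) : D.IsAffPos (srefl (D.aSimple j) a) := by
  revert hne
  refine Fin.cases ?_ (fun i => ?_) j
  · intro hne
    obtain ⟨β, r⟩ := a
    obtain ⟨hβ, hr⟩ := ha
    simp only at hβ hr
    refine ⟨srefl_mem D (a := (β, r)) hβ (aSimple_root D 0), ?_⟩
    rw [aSimple_zero] at hne ⊢
    have hθ := hshort_mem0 D
    have hθ0 := hshort_ne D
    have hβ0 := D.ne_zero β hβ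
    have hrefl : refl (-D.hshort) β = refl D.hshort β := by
      simp only [refl, coroot_neg, inner_neg_right]; module
    obtain ⟨k, hk⟩ := D.crystallographic β hβ _ hθ
    have hfl : ⌊⟪-D.hshort, coroot β⟫⌋ = -k := by
      rw [inner_neg_left, hk, ← Int.cast_neg, Int.floor_intCast]
    simp only [srefl, hrefl, hfl]
    by_cases h1 : β = D.hshort
    · subst h1
      rw [inner_coroot_self hθ0] at hk
      have : k = 2 := by exact_mod_cast hk.symm
      left; rcases hr with h | h <;> omega
    by_cases h2 : β = -D.hshort
    · subst h2
      rw [coroot_neg, inner_neg_right, inner_coroot_self hθ0] at hk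
      have hk2 : k = -2 := by exact_mod_cast hk.symm
      have hr1 : r ≠ 1 := fun h => hne (by rw [h])
      have : ¬ (-D.hshort ∈ D.pos) := D.pos_not_both _ D.hshort_mem
      have : 1 ≤ r := by tauto
      by_cases h3 : r = 2
      · right; refine ⟨by omega, ?_⟩
        rw [refl_neg, refl_self hθ0, neg_neg]; exact D.hshort_mem
      · left; omega
    have hb := short_pair D hβ hθ (D.hshort_short β hβ) h1 h2
    rw [hk] at hb
    have hb' : |k| ≤ 1 := by exact_mod_cast hb
    rw [abs_le] at hb'
    have : k = -1 ∨ k = 0 ∨ k = 1 := by omega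
    rcases this with h | h | h
    · have hneg : ⟪D.hshort, coroot β⟫ < 0 := by rw [hk, h]; norm_num
      have hneg' : ⟪D.hshort, β⟫ < 0 := by
        by_contra hcon
        push Not at hcon
        rw [← inner_coroot_nonneg hβ0] at hcon
        linarith
      have hnp : β ∉ D.pos := fun hp => by have := hshort_dom D hp; linarith
      have hr1 : 1 ≤ r := by tauto
      have hp : refl D.hshort β ∈ D.pos := by
        refine pos_of_inner_hshort D (refl_mem D hθ hβ) ?_
        rw [← inner_refl_left _ hθ0, refl_self hθ0, inner_neg_left]; linarith
      by_cases h3 : r = 1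
      · right; exact ⟨by omega, hp⟩
      · left; omega
    · have : refl D.hshort β = β := by
        have h0 : ⟪D.hshort, β⟫ = 0 := by
          rw [← inner_coroot_zero hβ0, hk, h]; norm_num
        have : ⟪β, coroot D.hshort⟫ = 0 := by
          rw [inner_coroot_zero hθ0, real_inner_comm, h0]
        simp only [refl, this]; module
      rw [this, h]; simpa using hr
    · left
      rcases hr with h' | h' <;> omega
  · intro hne
    obtain ⟨β, r⟩ := a
    obtain ⟨hβ, hr⟩ := ha
    simp only at hβ hr
    refine ⟨srefl_mem D (a := (β, r)) hβ (aSimple_root D i.succ), ?_⟩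
    rw [aSimple_succ] at hne ⊢
    simp only [srefl, mul_zero, sub_zero]
    rcases hr with h | ⟨h, hp⟩
    · left; exact h
    · right
      refine ⟨h, refl_simple_pos D i hp fun e => hne ?_⟩
      rw [h, e]

/-- full support of the highest short root -/
lemma hshort_full : ∃ k : Fin D.n → ℝ, (∀ j, 0 < k j) ∧
    D.hshort = ∑ j, k j • D.simpleRoot j := by
  obtain ⟨k, hk⟩ := D.pos_natCombo _ D.hshort_mem
  refine ⟨fun j => (k j : ℝ), ?_, hk⟩
  by_contra hcon
  push Not at hcon
  obtain ⟨i0, hi0⟩ := hcon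
  have hi0' : k i0 = 0 := by
    have : (k i0 : ℝ) ≤ 0 := hi0
    exact_mod_cast le_antisymm this (Nat.cast_nonneg _)
  have hortho : ∀ i j, k i = 0 → k j ≠ 0 → ⟪D.simpleRoot j, D.simpleRoot i⟫ = 0 := by
    intro i j hi hj
    have h1 := hshort_dom_simple D i
    rw [hk, sum_inner] at h1
    have hterm : ∀ m ∈ Finset.univ, ⟪(k m : ℝ) • D.simpleRoot m, D.simpleRoot i⟫ ≤ 0 := by
      intro m _
      rw [inner_smul_left]
      by_cases hm : m = i
      · rw [hm, hi]; simp
      · exact mul_nonpos_of_nonneg_of_nonpos (by simp) (simple_inner_nonpos D hm)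
    have h2 := (Finset.sum_eq_zero_iff_of_nonpos hterm).1
      (le_antisymm (Finset.sum_nonpos hterm) h1) j (Finset.mem_univ _)
    rw [inner_smul_left] at h2
    rcases mul_eq_zero.1 h2 with h3 | h3
    · exfalso; apply hj; simpa using h3
    · exact h3
  set U := Submodule.span ℝ (D.simpleRoot '' {j | k j ≠ 0}) with hU
  set U' := Submodule.span ℝ (D.simpleRoot '' {j | k j = 0}) with hU'
  have hUU : U ⟂ U' := by
    rw [hU, hU', Submodule.isOrtho_span]
    rintro _ ⟨j, hj, rfl⟩ _ ⟨i, hi, rfl⟩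
    exact hortho i j hi hj
  have hoc : ∀ a ∈ U, ∀ b ∈ U', ⟪a, b⟫ = 0 := fun a ha b hb => hUU.inner_eq ha hb
  obtain ⟨hv, hv1, hv2⟩ := exists_height D
  have hpos : ∀ β ∈ D.pos, β ∈ U ∨ β ∈ U' := by
    by_contra hcon
    push Not at hcon
    set F := D.pos.filter (fun β => β ∉ U ∧ β ∉ U') with hF
    have hFn : F.Nonempty := by
      obtain ⟨β, hβ, h⟩ := hcon
      exact ⟨β, by simp [hF, hβ, h]⟩
    obtain ⟨β, hβF, hmin⟩ := Finset.exists_min_image F (fun β => ⟪hv, β⟫) hFn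
    simp only [hF, Finset.mem_filter] at hβF
    obtain ⟨hβ, hβU, hβU'⟩ := hβF
    have hβ0 := D.ne_zero β (pos_mem D hβ)
    have hex : ∃ j, 0 < ⟪β, D.simpleRoot j⟫ := by
      by_contra hc'
      push Not at hc'
      obtain ⟨l, hl⟩ := D.pos_natCombo _ hβ
      have := inner_self_pos hβ0
      conv at this => rhs; rw [hl]
      rw [sum_inner] at this
      have : ∑ i, ⟪(l i : ℝ) • D.simpleRoot i, ∑ j, (l j : ℝ) • D.simpleRoot j⟫ ≤ 0 := by
        refine Finset.sum_nonpos fun i _ => ?_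
        rw [← hl, inner_smul_left, real_inner_comm]
        exact mul_nonpos_of_nonneg_of_nonpos (by simp) (hc' i)
      linarith
    obtain ⟨j, hj⟩ := hex
    have hjU : D.simpleRoot j ∈ U ∨ D.simpleRoot j ∈ U' := by
      by_cases h : k j = 0
      · right; exact Submodule.subset_span ⟨j, h, rfl⟩
      · left; exact Submodule.subset_span ⟨j, h, rfl⟩
    have hne : β ≠ D.simpleRoot j := by
      rintro rfl
      tauto
    have hp := refl_simple_pos D j hβ hne
    have hlt : ⟪hv, refl (D.simpleRoot j) β⟫ < ⟪hv, β⟫ := by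
      rw [refl, inner_sub_right, inner_smul_right, hv1, mul_one]
      have := (inner_coroot_pos (simple_ne D j)).2 hj
      linarith
    have hnot : ¬ (refl (D.simpleRoot j) β ∉ U ∧ refl (D.simpleRoot j) β ∉ U') := by
      intro hc'
      have := hmin (refl (D.simpleRoot j) β) (by simp only [hF, Finset.mem_filter]; exact ⟨hp, hc'⟩)
      linarith
    have hback : β = refl (D.simpleRoot j) β + ⟪β, coroot (D.simpleRoot j)⟫ • D.simpleRoot j := by
      simp only [refl]; module
    have hneg : ⟪refl (D.simpleRoot j) β, D.simpleRoot j⟫ < 0 := by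
      rw [inner_refl_left _ (simple_ne D j), refl_self (simple_ne D j), inner_neg_right]; linarith
    rcases hjU with hjU | hjU
    · by_cases h : refl (D.simpleRoot j) β ∈ U
      · apply hβU; rw [hback]; exact U.add_mem h (U.smul_mem _ hjU)
      · have h' : refl (D.simpleRoot j) β ∈ U' := by tauto
        have := hoc _ hjU _ h'
        rw [real_inner_comm] at this; linarith
    · by_cases h : refl (D.simpleRoot j) β ∈ U'
      · apply hβU'; rw [hback]; exact U'.add_mem h (U'.smul_mem _ hjU)
      · have h' : refl (D.simpleRoot j) β ∈ U := by tauto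
        have := hoc _ h' _ hjU
        linarith
  have hall : ∀ β ∈ D.R0, β ∈ U ∨ β ∈ U' := by
    intro β hβ
    rcases D.pos_or_neg β hβ with h | h
    · exact hpos β h
    · rcases hpos _ h with h' | h'
      · left; simpa using U.neg_mem h'
      · right; simpa using U'.neg_mem h'
  have hi0U' : D.simpleRoot i0 ∈ U' := Submodule.subset_span ⟨i0, hi0', rfl⟩
  rcases D.irreducible (D.R0.filter (fun β => β ∈ U)) (Finset.filter_subset _ _) (by
    intro a ha b hb hbS
    simp only [Finset.mem_filter, not_and] at ha hbS
    have := hall b hb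
    exact hoc a ha.2 b (by tauto)) with h | h
  · have hex : ∃ j, k j ≠ 0 := by
      by_contra hc'
      push Not at hc'
      apply hshort_ne D
      rw [hk]
      exact Finset.sum_eq_zero fun j _ => by rw [hc' j]; simp
    obtain ⟨j, hj⟩ := hex
    have : D.simpleRoot j ∈ D.R0.filter (fun β => β ∈ U) := by
      rw [Finset.mem_filter]
      exact ⟨simple_mem D j, Submodule.subset_span ⟨j, hj, rfl⟩⟩
    rw [h] at this
    simp at this
  · have : D.simpleRoot i0 ∈ D.R0.filter (fun β => β ∈ U) := by rw [h]; exact simple_mem D i0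
    rw [Finset.mem_filter] at this
    have h1 := hoc _ this.2 _ hi0U'
    have h2 := inner_self_pos (simple_ne D i0)
    linarith

lemma exists_simple_pos {β : V} (hβ : β ∈ D.R0) : ∃ j, 0 < ⟪(D.aSimple j).1, β⟫ := by
  by_contra hcon
  push Not at hcon
  obtain ⟨k, hk, hsum⟩ := hshort_full D
  have h0 := hcon 0
  rw [aSimple_zero] at h0
  simp only [inner_neg_left] at h0
  have hj : ∀ j, ⟪D.simpleRoot j, β⟫ ≤ 0 := fun j => by
    have := hcon j.succ
    rwa [aSimple_succ] at this
  rw [hsum, sum_inner] at h0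
  have hterm : ∀ m ∈ Finset.univ, ⟪k m • D.simpleRoot m, β⟫ ≤ 0 := by
    intro m _
    rw [inner_smul_left]
    exact mul_nonpos_of_nonneg_of_nonpos (by simpa using (hk m).le) (hj m)
  have h2 := (Finset.sum_eq_zero_iff_of_nonpos hterm).1
      (le_antisymm (Finset.sum_nonpos hterm) (by linarith))
  have h3 : ∀ j, ⟪D.simpleRoot j, β⟫ = 0 := by
    intro j
    have := h2 j (Finset.mem_univ _)
    rw [inner_smul_left] at this
    rcases mul_eq_zero.1 this with h | h
    · have := hk j; simp at h; linarith
    · exact h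
  have h4 : ∀ x ∈ Submodule.span ℝ (Set.range D.simpleRoot), ⟪x, β⟫ = 0 := by
    intro x hx
    induction hx using Submodule.span_induction with
    | mem x hx => obtain ⟨j, rfl⟩ := hx; exact h3 j
    | zero => simp
    | add x y _ _ hx hy => rw [inner_add_left, hx, hy, add_zero]
    | smul t x _ hx => rw [inner_smul_left, hx, mul_zero]
  have := h4 β (simple_span D trivial)
  have h5 := inner_self_pos (D.ne_zero β hβ)
  linarith

variable {D} {c : ℝ} {x0 : V}

lemma aff_finite (hc : 0 < c) (x : V) (M : ℝ) :
    {a : V × ℤ | D.IsAffRoot a ∧ |aval c a x| ≤ M}.Finite := by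
  set K : ℝ := M + ∑ α ∈ D.R0, |⟪x, coroot α⟫| with hK
  refine Set.Finite.subset (s := (D.R0 : Set V) ×ˢ (Set.Icc (-⌈K / c⌉) ⌈K / c⌉))
    (Set.Finite.prod (Finset.finite_toSet _) (Set.finite_Icc _ _)) ?_
  rintro ⟨α, r⟩ ⟨hα, h⟩
  have hα' : α ∈ D.R0 := hα
  simp only [Set.mem_prod, Finset.mem_coe, Set.mem_Icc]
  refine ⟨hα', ?_⟩
  have hle := Finset.single_le_sum (f := fun α => |⟪x, coroot α⟫|) (fun _ _ => abs_nonneg _) hα'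
  simp only [aval] at h
  have h1 : |(r : ℝ) * c| ≤ K := by
    have : (r : ℝ) * c = (⟪x, coroot α⟫ + r * c) - ⟪x, coroot α⟫ := by ring
    rw [this]
    refine (abs_sub _ _).trans ?_
    linarith
  rw [abs_mul, abs_of_pos hc, ← le_div_iff₀ hc] at h1
  have h2 := h1.trans (Int.le_ceil (K / c))
  rw [abs_le] at h2
  constructor
  · exact_mod_cast h2.1
  · exact_mod_cast h2.2

lemma IsX0.pos (hx : IsX0 D c x0) {a : V × ℤ} (ha : D.IsAffPos a) : 0 < aval c a x0 :=
  (hx a ha.1).1.1 ha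

lemma aff_pos_or_neg {a : V × ℤ} (ha : D.IsAffRoot a) : D.IsAffPos a ∨ D.IsAffNeg a := by
  obtain ⟨α, r⟩ := a
  have hα : α ∈ D.R0 := ha
  have hα' := neg_mem D hα
  simp only [RootSystemData.IsAffNeg, RootSystemData.IsAffPos]
  have := D.pos_or_neg α hα
  rcases lt_trichotomy r 0 with h | h | h
  · right; exact ⟨hα', Or.inl (by omega)⟩
  · subst h
    rcases this with h | h
    · left; exact ⟨hα, Or.inr ⟨rfl, h⟩⟩
    · right; exact ⟨hα', Or.inr ⟨by simp, h⟩⟩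
  · left; exact ⟨hα, Or.inl (by omega)⟩

lemma IsX0.ne (hx : IsX0 D c x0) {a : V × ℤ} (ha : D.IsAffRoot a) : aval c a x0 ≠ 0 := by
  rcases aff_pos_or_neg ha with h | h
  · exact ((hx a ha).1.1 h).ne'
  · exact ((hx a ha).2.1 h).ne

/-- induction on positive affine roots -/
lemma aff_pos_induction (hc : 0 < c) {p : V × ℤ → Prop}
    (hs : ∀ j, p (D.aSimple j))
    (hstep : ∀ b j, D.IsAffPos b → b ≠ D.aSimple j → D.IsAffPos (srefl (D.aSimple j) b) →
      0 < ⟪(D.aSimple j).1, coroot b.1⟫ → p (srefl (D.aSimple j) b) → p b) :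
    ∀ b, D.IsAffPos b → p b := by
  obtain ⟨x0, hx⟩ := exists_x0 D hc
  change IsX0 D c x0 at hx
  by_contra hcon
  push Not at hcon
  obtain ⟨b0, hb0, hpb0⟩ := hcon
  set S := {b : V × ℤ | D.IsAffPos b ∧ ¬ p b ∧ aval c b x0 ≤ aval c b0 x0} with hS
  have hfin : S.Finite := by
    refine (aff_finite (D := D) hc x0 (aval c b0 x0)).subset ?_
    rintro b ⟨h1, h2, h3⟩
    refine ⟨h1.1, ?_⟩
    rw [abs_of_pos (hx.pos h1)]; exact h3
  obtain ⟨b, ⟨hb, hpb, hle⟩, hmin⟩ := Set.exists_min_image S (fun b => aval c b x0) hfin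
    ⟨b0, hb0, hpb0, le_rfl⟩
  obtain ⟨j, hj⟩ := exists_simple_pos D hb.1
  have hb0' := D.ne_zero _ hb.1
  have hne : b ≠ D.aSimple j := by
    rintro rfl; exact hpb (hs j)
  have hsp := srefl_simple_pos D j hb hne
  have hk : 0 < ⟪(D.aSimple j).1, coroot b.1⟫ := (inner_coroot_pos hb0').2 hj
  have hlt : aval c (srefl (D.aSimple j) b) x0 < aval c b x0 := by
    rw [aval_srefl D c hb.1 (aSimple_root D j), aval_sAff]
    have := hx.pos (aSimple_pos D j)
    nlinarith
  apply hpb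
  refine hstep b j hb hne hsp hk ?_
  by_contra hnp
  have := hmin _ ⟨hsp, hnp, hlt.le.trans hle⟩
  linarith

end rs2
end AW

namespace AW
open RootSystemData

section wr
variable {V : Type*} [NormedAddCommGroup V] [InnerProductSpace ℝ V] {D : RootSystemData V}
variable {c : ℝ} {x0 : V}

lemma p_apply_inv {α : Type*} (w : Equiv.Perm α) (x : α) : w (w⁻¹ x) = x := by simp
lemma p_inv_apply {α : Type*} (w : Equiv.Perm α) (x : α) : w⁻¹ (w x) = x := by simp

lemma root_ne {a : V × ℤ} (ha : D.IsAffRoot a) : a.1 ≠ 0 := D.ne_zero _ ha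

lemma sP_mem {a : V × ℤ} (ha : D.IsAffRoot a) : sP c a ∈ D.WR c :=
  Subgroup.subset_closure ⟨a, ha, fun x => sP_apply c a (root_ne ha) x⟩

/-- induction over the affine Weyl group -/
lemma WR_ind {p : Equiv.Perm V → Prop} (h1 : p 1)
    (hs : ∀ a w, D.IsAffRoot a → w ∈ D.WR c → p w → p (sP c a * w)) :
    ∀ w ∈ D.WR c, p w := by
  intro w hw
  have hgen : ∀ e ∈ D.AffGens c, ∃ a, D.IsAffRoot a ∧ e = sP c a := by
    rintro e ⟨a, ha, he⟩
    exact ⟨a, ha, by ext x; rw [he, sP_apply c a (root_ne ha)]⟩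
  refine Subgroup.closure_induction_left (p := fun w _ => p w) h1 ?_ ?_ hw
  · intro e he y hy hp
    obtain ⟨a, ha, rfl⟩ := hgen e he
    exact hs a y ha hy hp
  · intro e he y hy hp
    obtain ⟨a, ha, rfl⟩ := hgen e he
    rw [sP_inv c a (root_ne ha)]
    exact hs a y ha hy hp

lemma exists_pull {w : Equiv.Perm V} (hw : w ∈ D.WR c) : ∀ {a : V × ℤ}, D.IsAffRoot a →
    ∃ b, D.IsAffRoot b ∧ ∀ x, aval c b x = aval c a (w x) := by
  refine WR_ind (D := D) (c := c) (p := fun w => ∀ {a : V × ℤ}, D.IsAffRoot a →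
    ∃ b, D.IsAffRoot b ∧ ∀ x, aval c b x = aval c a (w x)) ?_ ?_ w hw
  · intro a ha; exact ⟨a, ha, fun x => rfl⟩
  · intro b w hb hw ih a ha
    obtain ⟨d, hd, h⟩ := ih (srefl_mem D ha hb)
    refine ⟨d, hd, fun x => ?_⟩
    rw [h, aval_srefl D c ha hb, Equiv.Perm.mul_apply, sP_apply c b (root_ne hb)]

/-- `pull w a = w⁻¹ a` -/
def pull (D : RootSystemData V) (c : ℝ) (w : Equiv.Perm V) (a : V × ℤ) : V × ℤ :=
  if h : ∃ b, D.IsAffRoot b ∧ ∀ x, aval c b x = aval c a (w x) then h.choose else a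

lemma pull_root {w : Equiv.Perm V} (hw : w ∈ D.WR c) {a : V × ℤ} (ha : D.IsAffRoot a) :
    D.IsAffRoot (pull D c w a) := by
  rw [pull, dif_pos (exists_pull hw ha)]
  exact (exists_pull hw ha).choose_spec.1

lemma aval_pull {w : Equiv.Perm V} (hw : w ∈ D.WR c) {a : V × ℤ} (ha : D.IsAffRoot a) (x : V) :
    aval c (pull D c w a) x = aval c a (w x) := by
  rw [pull, dif_pos (exists_pull hw ha)]
  exact (exists_pull hw ha).choose_spec.2 x

lemma aval_ext (hc : 0 < c) {a b : V × ℤ} (ha : D.IsAffRoot a) (hb : D.IsAffRoot b)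
    (h : ∀ x, aval c a x = aval c b x) : a = b := aval_inj hc (root_ne ha) (root_ne hb) h

lemma pull_mul (hc : 0 < c) {v w : Equiv.Perm V} (hv : v ∈ D.WR c) (hw : w ∈ D.WR c) {a : V × ℤ}
    (ha : D.IsAffRoot a) : pull D c (v * w) a = pull D c w (pull D c v a) := by
  refine aval_ext hc (pull_root (mul_mem hv hw) ha) (pull_root hw (pull_root hv ha)) fun x => ?_
  rw [aval_pull (mul_mem hv hw) ha, aval_pull hw (pull_root hv ha), aval_pull hv ha]; rfl

lemma pull_one (hc : 0 < c) {a : V × ℤ}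
    (ha : D.IsAffRoot a) : pull D c 1 a = a := by
  refine aval_ext hc (pull_root (one_mem _) ha) ha fun x => ?_
  rw [aval_pull (one_mem _) ha]; rfl

lemma pull_pull_inv (hc : 0 < c) {w : Equiv.Perm V} (hw : w ∈ D.WR c) {a : V × ℤ}
    (ha : D.IsAffRoot a) : pull D c w (pull D c w⁻¹ a) = a := by
  rw [← pull_mul hc (inv_mem hw) hw ha, inv_mul_cancel, pull_one hc ha]

lemma pull_inv_pull (hc : 0 < c) {w : Equiv.Perm V} (hw : w ∈ D.WR c) {a : V × ℤ}
    (ha : D.IsAffRoot a) : pull D c w⁻¹ (pull D c w a) = a := by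
  rw [← pull_mul hc hw (inv_mem hw) ha, mul_inv_cancel, pull_one hc ha]

lemma pull_sP (hc : 0 < c) {b : V × ℤ} (hb : D.IsAffRoot b) {a : V × ℤ}
    (ha : D.IsAffRoot a) : pull D c (sP c b) a = srefl b a := by
  refine aval_ext hc (pull_root (sP_mem hb) ha) (srefl_mem D ha hb) fun x => ?_
  rw [aval_pull (sP_mem hb) ha, aval_srefl D c ha hb, sP_apply c b (root_ne hb)]

lemma neg_root {a : V × ℤ} (ha : D.IsAffRoot a) : D.IsAffRoot (-a) := neg_mem D ha

lemma pull_inj (hc : 0 < c) {w : Equiv.Perm V} (hw : w ∈ D.WR c) {a b : V × ℤ}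
    (ha : D.IsAffRoot a) (hb : D.IsAffRoot b) (h : pull D c w a = pull D c w b) : a = b := by
  rw [← pull_inv_pull hc hw ha, h, pull_inv_pull hc hw hb]

lemma mem_RW (hx : IsX0 D c x0) {w : Equiv.Perm V} (hw : w ∈ D.WR c) {a : V × ℤ} :
    a ∈ D.RW c w ↔ D.IsAffRoot a ∧ 0 < aval c a x0 ∧ aval c a (w⁻¹ x0) < 0 := by
  constructor
  · rintro ⟨ha, b, hb, hm⟩
    have hbr : D.IsAffRoot b := by
      have := neg_mem D hb.1
      rw [neg_neg] at this
      exact this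
    refine ⟨ha.1, hx.pos ha, ?_⟩
    rw [hm]; exact (hx b hbr).2.1 hb
  · rintro ⟨ha, h1, h2⟩
    refine ⟨(hx a ha).1.2 h1, pull D c w⁻¹ a, ?_, fun x => (aval_pull (inv_mem hw) ha x).symm⟩
    rw [(hx _ (pull_root (inv_mem hw) ha)).2, aval_pull (inv_mem hw) ha]; exact h2

lemma RW_finite (hc : 0 < c) (hx : IsX0 D c x0) {w : Equiv.Perm V} (hw : w ∈ D.WR c) :
    (D.RW c w).Finite := by
  refine (aff_finite (D := D) hc x0 (∑ α ∈ D.R0, |⟪x0 - w⁻¹ x0, coroot α⟫|)).subset ?_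
  intro a ha
  rw [mem_RW hx hw] at ha
  obtain ⟨ha, h1, h2⟩ := ha
  refine ⟨ha, ?_⟩
  have hle := Finset.single_le_sum (f := fun α => |⟪x0 - w⁻¹ x0, coroot α⟫|)
    (fun _ _ => abs_nonneg _) ha
  refine le_trans ?_ hle
  have e := aval_sub c a x0 (x0 - w⁻¹ x0)
  rw [sub_sub_cancel] at e
  rw [abs_of_pos h1]
  refine le_trans ?_ (le_abs_self _)
  linarith

lemma aval_w_ne (hx : IsX0 D c x0) {w : Equiv.Perm V} (hw : w ∈ D.WR c) {a : V × ℤ}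
    (ha : D.IsAffRoot a) : aval c a (w x0) ≠ 0 := by
  rw [← aval_pull hw ha]; exact hx.ne (pull_root hw ha)

/-- additivity condition -/
def Addi (D : RootSystemData V) (c : ℝ) (v w : Equiv.Perm V) : Prop :=
  ∀ b, b ∈ D.RW c v → b ∉ D.RW c w⁻¹

lemma RW_mul (hc : 0 < c) (hx : IsX0 D c x0) {v w : Equiv.Perm V} (hv : v ∈ D.WR c)
    (hw : w ∈ D.WR c) (h : Addi D c v w) :
    D.RW c (v * w) = D.RW c w ∪ pull D c w '' D.RW c v := by
  have hvw := mul_mem hv hw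
  ext a
  constructor
  · intro ha
    rw [mem_RW hx hvw] at ha
    obtain ⟨ha, h1, h2⟩ := ha
    rw [mul_inv_rev, Equiv.Perm.mul_apply] at h2
    rcases lt_or_gt_of_ne (aval_w_ne hx (inv_mem hw) ha) with h3 | h3
    · left; exact (mem_RW hx hw).2 ⟨ha, h1, h3⟩
    · right
      refine ⟨pull D c w⁻¹ a, (mem_RW hx hv).2 ⟨pull_root (inv_mem hw) ha, ?_, ?_⟩,
        pull_pull_inv hc hw ha⟩
      · rwa [aval_pull (inv_mem hw) ha]
      · rwa [aval_pull (inv_mem hw) ha]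
  · rintro (ha | ⟨b, hb, rfl⟩)
    · rw [mem_RW hx hw] at ha
      obtain ⟨ha, h1, h2⟩ := ha
      refine (mem_RW hx hvw).2 ⟨ha, h1, ?_⟩
      rw [mul_inv_rev, Equiv.Perm.mul_apply]
      have hpr := pull_root (inv_mem hw) ha
      have hbr : D.IsAffRoot (-pull D c w⁻¹ a) := neg_root hpr
      have hb1 : (-pull D c w⁻¹ a) ∈ D.RW c w⁻¹ := by
        rw [mem_RW hx (inv_mem hw)]
        refine ⟨hbr, ?_, ?_⟩
        · rw [aval_neg, aval_pull (inv_mem hw) ha]; linarith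
        · rw [aval_neg, aval_pull (inv_mem hw) ha]; simp; linarith
      have hb2 : (-pull D c w⁻¹ a) ∉ D.RW c v := fun h' => h _ h' hb1
      rw [mem_RW hx hv] at hb2
      rw [mem_RW hx (inv_mem hw)] at hb1
      have hn := aval_w_ne hx (inv_mem hv) hbr
      have h5 : 0 < aval c (-pull D c w⁻¹ a) (v⁻¹ x0) := by
        rcases lt_or_gt_of_ne hn with h6 | h6
        · exact absurd ⟨hb1.1, hb1.2.1, h6⟩ hb2
        · exact h6
      rw [aval_neg, aval_pull (inv_mem hw) ha] at h5
      linarith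
    · have hb' := hb
      rw [mem_RW hx hv] at hb
      obtain ⟨hb, h1, h2⟩ := hb
      refine (mem_RW hx hvw).2 ⟨pull_root hw hb, ?_, ?_⟩
      · rw [aval_pull hw hb]
        rcases lt_or_gt_of_ne (aval_w_ne hx hw hb) with h6 | h6
        · exfalso
          exact h _ hb' ((mem_RW hx (inv_mem hw)).2 ⟨hb, h1, by simpa using h6⟩)
        · exact h6
      · rw [aval_pull hw hb, mul_inv_rev, Equiv.Perm.mul_apply, p_apply_inv]
        exact h2

lemma RW_mul_disj (hx : IsX0 D c x0) {v w : Equiv.Perm V} (hv : v ∈ D.WR c)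
    (hw : w ∈ D.WR c) : Disjoint (D.RW c w) (pull D c w '' D.RW c v) := by
  rw [Set.disjoint_left]
  rintro _ ha ⟨b, hb, rfl⟩
  rw [mem_RW hx hv] at hb
  rw [mem_RW hx hw, aval_pull hw hb.1, aval_pull hw hb.1, p_apply_inv] at ha
  linarith [ha.2.2, hb.2.1]

lemma len_mul (hc : 0 < c) (hx : IsX0 D c x0) {v w : Equiv.Perm V} (hv : v ∈ D.WR c)
    (hw : w ∈ D.WR c) (h : Addi D c v w) : D.len c (v * w) = D.len c v + D.len c w := by
  rw [RootSystemData.len, RW_mul hc hx hv hw h,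
    Set.ncard_union_eq (RW_mul_disj hx hv hw) (RW_finite hc hx hw)
      ((RW_finite hc hx hv).image _), Set.InjOn.ncard_image, add_comm]
  · rfl
  · intro a ha b hb hab
    exact pull_inj hc hw ((mem_RW hx hv).1 ha).1 ((mem_RW hx hv).1 hb).1 hab

lemma WR_le_Wext : D.WR c ≤ D.Wext c := Subgroup.closure_mono Set.subset_union_left

lemma tau_pull {τ : V × ℤ → ℂ} (hτ : D.IsMultiplicity c τ) {w : Equiv.Perm V} (hw : w ∈ D.WR c)
    {a : V × ℤ} (ha : D.IsAffRoot a) : τ (pull D c w a) = τ a := by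
  refine hτ.2 w (WR_le_Wext hw) _ _ (pull_root hw ha) ha fun x => ?_
  rw [aval_pull hw ha, p_apply_inv]

lemma tauw_mul (hc : 0 < c) (hx : IsX0 D c x0) {τ : V × ℤ → ℂ} (hτ : D.IsMultiplicity c τ)
    {v w : Equiv.Perm V} (hv : v ∈ D.WR c)
    (hw : w ∈ D.WR c) (h : Addi D c v w) :
    D.tauw c τ (v * w) = D.tauw c τ v * D.tauw c τ w := by
  rw [tauw, RW_mul hc hx hv hw h, finprod_mem_union (RW_mul_disj hx hv hw) (RW_finite hc hx hw)
      ((RW_finite hc hx hv).image _), finprod_mem_image, mul_comm]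
  · congr 1
    refine finprod_mem_congr rfl fun a ha => tau_pull hτ hw ((mem_RW hx hv).1 ha).1
  · intro a ha b hb hab
    exact pull_inj hc hw ((mem_RW hx hv).1 ha).1 ((mem_RW hx hv).1 hb).1 hab

lemma tauw_ne (hx : IsX0 D c x0) {τ : V × ℤ → ℂ} (hτ : D.IsMultiplicity c τ)
    {w : Equiv.Perm V} (hw : w ∈ D.WR c) : D.tauw c τ w ≠ 0 := by
  rw [tauw]
  refine finprod_mem_induction (p := fun z : ℂ => z ≠ 0) one_ne_zero (fun _ _ => mul_ne_zero) ?_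
  intro a ha
  exact hτ.1 a ((mem_RW hx hw).1 ha).1

/-- simple reflections -/
def sj (D : RootSystemData V) (c : ℝ) (j : Fin (D.n + 1)) : Equiv.Perm V := sP c (D.aSimple j)

lemma sj_mem (j : Fin (D.n + 1)) : sj D c j ∈ D.WR c := sP_mem (aSimple_root D j)
lemma sj_sj (j : Fin (D.n + 1)) : sj D c j * sj D c j = 1 := sP_sP c _ (aSimple_ne D j)
lemma sj_inv (j : Fin (D.n + 1)) : (sj D c j)⁻¹ = sj D c j := sP_inv c _ (aSimple_ne D j)
lemma sj_apply (j : Fin (D.n + 1)) (x : V) : sj D c j x = sAff c (D.aSimple j) x :=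
  sP_apply c _ (aSimple_ne D j) x
lemma sj_cancel (j : Fin (D.n + 1)) (w : Equiv.Perm V) : sj D c j * (sj D c j * w) = w := by
  rw [← mul_assoc, sj_sj, one_mul]
lemma sj_sj_apply (j : Fin (D.n + 1)) (x : V) : sj D c j (sj D c j x) = x := by
  rw [← Equiv.Perm.mul_apply, sj_sj]; rfl

lemma aval_sj (j : Fin (D.n + 1)) (x : V) :
    aval c (D.aSimple j) (sj D c j x) = - aval c (D.aSimple j) x := by
  rw [sj_apply, aval_sAff, inner_coroot_self (aSimple_ne D j)]; ring

lemma RW_sj (hx : IsX0 D c x0) (j : Fin (D.n + 1)) : D.RW c (sj D c j) = {D.aSimple j} := by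
  ext a
  rw [mem_RW hx (sj_mem j), sj_inv]
  constructor
  · rintro ⟨ha, h1, h2⟩
    by_contra hne
    have := hx.pos (srefl_simple_pos D j ((hx a ha).1.2 h1) hne)
    rw [aval_srefl D c ha (aSimple_root D j), ← sj_apply] at this
    linarith
  · intro h
    rw [Set.mem_singleton_iff] at h
    subst h
    have := hx.pos (aSimple_pos D j)
    refine ⟨aSimple_root D j, this, ?_⟩
    rw [aval_sj]; linarith

lemma tauw_sj (hx : IsX0 D c x0) (τ : V × ℤ → ℂ) (j : Fin (D.n + 1)) :
    D.tauw c τ (sj D c j) = τ (D.aSimple j) := by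
  rw [tauw, RW_sj hx, finprod_mem_singleton]

lemma len_sj (hx : IsX0 D c x0) (j : Fin (D.n + 1)) : D.len c (sj D c j) = 1 := by
  rw [RootSystemData.len, RW_sj hx, Set.ncard_singleton]

lemma RW_one (hx : IsX0 D c x0) : D.RW c 1 = ∅ := by
  ext a
  rw [mem_RW hx (one_mem _)]
  simp only [inv_one, Equiv.Perm.one_apply, Set.mem_empty_iff_false, iff_false]
  rintro ⟨-, h1, h2⟩; linarith

lemma tauw_one (hx : IsX0 D c x0) (τ : V × ℤ → ℂ) : D.tauw c τ 1 = 1 := by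
  rw [tauw, RW_one hx, finprod_mem_empty]

lemma len_one (hx : IsX0 D c x0) : D.len c 1 = 0 := by
  rw [RootSystemData.len, RW_one hx, Set.ncard_empty]

lemma addi_sj (hx : IsX0 D c x0) {w : Equiv.Perm V} (hw : w ∈ D.WR c) {j : Fin (D.n + 1)}
    (h : 0 < aval c (D.aSimple j) (w x0)) : Addi D c (sj D c j) w := by
  intro b hb hb'
  rw [RW_sj hx, Set.mem_singleton_iff] at hb
  subst hb
  rw [mem_RW hx (inv_mem hw), inv_inv] at hb'
  linarith [hb'.2.2]

lemma len_asc (hc : 0 < c) (hx : IsX0 D c x0) {w : Equiv.Perm V} (hw : w ∈ D.WR c)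
    {j : Fin (D.n + 1)} (h : 0 < aval c (D.aSimple j) (w x0)) :
    D.len c (sj D c j * w) = D.len c w + 1 := by
  rw [len_mul hc hx (sj_mem j) hw (addi_sj hx hw h), len_sj hx, add_comm]

lemma tauw_asc (hc : 0 < c) (hx : IsX0 D c x0) {τ : V × ℤ → ℂ} (hτ : D.IsMultiplicity c τ)
    {w : Equiv.Perm V} (hw : w ∈ D.WR c)
    {j : Fin (D.n + 1)} (h : 0 < aval c (D.aSimple j) (w x0)) :
    D.tauw c τ (sj D c j * w) = τ (D.aSimple j) * D.tauw c τ w := by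
  rw [tauw_mul hc hx hτ (sj_mem j) hw (addi_sj hx hw h), tauw_sj hx]

lemma len_desc (hc : 0 < c) (hx : IsX0 D c x0) {w : Equiv.Perm V} (hw : w ∈ D.WR c)
    {j : Fin (D.n + 1)} (h : aval c (D.aSimple j) (w x0) < 0) :
    D.len c w = D.len c (sj D c j * w) + 1 := by
  have := len_asc hc hx (mul_mem (sj_mem j) hw) (j := j) (by
    rw [Equiv.Perm.mul_apply, aval_sj]; linarith)
  rwa [sj_cancel] at this

/-- evaluation of a word -/
def ev (D : RootSystemData V) (c : ℝ) (l : List (Fin (D.n + 1))) : Equiv.Perm V :=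
  (l.map (sj D c)).prod

lemma ev_nil : ev D c [] = 1 := rfl
lemma ev_cons (j : Fin (D.n + 1)) (l : List (Fin (D.n + 1))) :
    ev D c (j :: l) = sj D c j * ev D c l := by simp [ev]
lemma ev_append (l m : List (Fin (D.n + 1))) : ev D c (l ++ m) = ev D c l * ev D c m := by
  simp [ev]
lemma ev_mem (l : List (Fin (D.n + 1))) : ev D c l ∈ D.WR c := by
  induction l with
  | nil => exact one_mem _
  | cons j l ih => rw [ev_cons]; exact mul_mem (sj_mem j) ih

lemma sP_conj {a b : V × ℤ} (ha : D.IsAffRoot a) (hb : D.IsAffRoot b) :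
    sP c (srefl b a) = sP c b * sP c a * sP c b := by
  ext x
  simp only [Equiv.Perm.mul_apply, sP_apply c _ (root_ne ha), sP_apply c _ (root_ne hb),
    sP_apply c _ (root_ne (srefl_mem D ha hb))]
  conv_lhs => rw [sAff, aval_srefl D c ha hb]
  rw [sAff.eq_def c a]
  conv_rhs => rw [sAff, aval_sub]
  simp only [srefl, refl, inner_smul_left, conj_trivial]
  have : aval c b (sAff c b x) = - aval c b x := by
    rw [aval_sAff, inner_coroot_self (root_ne hb)]; ring
  rw [this]
  simp only [sAff]
  module

lemma sP_neg (a : V × ℤ) (ha : a.1 ≠ 0) : sP c (-a) = sP c a := by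
  ext x
  rw [sP_apply c _ ha, sP_apply c _ (by simpa using ha)]
  simp only [sAff, aval_neg, Prod.fst_neg]; module

lemma WR_eq_ev (hc : 0 < c) {w : Equiv.Perm V} (hw : w ∈ D.WR c) : ∃ l, w = ev D c l := by
  have hpos : ∀ b, D.IsAffPos b → ∃ l, sP c b = ev D c l := by
    refine aff_pos_induction hc (fun j => ⟨[j], by simp [ev, sj]⟩) ?_
    rintro b j hb hne hsp hk ⟨l, hl⟩
    refine ⟨j :: (l ++ [j]), ?_⟩
    rw [ev_cons, ev_append, ← hl, ev_cons, ev_nil, mul_one, sP_conj hb.1 (aSimple_root D j)]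
    change _ = sj D c j * (sj D c j * _ * sj D c j * sj D c j)
    rw [mul_assoc _ _ (sj D c j), sj_sj, mul_one, sj_cancel]
  refine WR_ind (D := D) (c := c) (p := fun w => ∃ l, w = ev D c l) ⟨[], rfl⟩ ?_ w hw
  rintro a w ha hw ⟨l, rfl⟩
  rcases aff_pos_or_neg ha with h | h
  · obtain ⟨m, hm⟩ := hpos a h
    exact ⟨m ++ l, by rw [ev_append, hm]⟩
  · obtain ⟨m, hm⟩ := hpos _ h
    change sP c (-a) = _ at hm
    rw [sP_neg a (root_ne ha)] at hm
    exact ⟨m ++ l, by rw [ev_append, hm]⟩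

lemma mem_alcove_iff (hc : 0 < c) {x : V} :
    x ∈ D.alcove c ↔ ∀ j, 0 ≤ aval c (D.aSimple j) x := by
  constructor
  · intro h j; exact h _ (aSimple_pos D j)
  · intro h
    refine aff_pos_induction hc h ?_
    intro b j hb hne hsp hk ih
    rw [aval_srefl D c hb.1 (aSimple_root D j), aval_sAff] at ih
    have := h j
    nlinarith

lemma exchange (hc : 0 < c) (hx : IsX0 D c x0) (l : List (Fin (D.n + 1))) :
    ∀ b, D.IsAffPos b → aval c b (ev D c l x0) < 0 →
      ∃ l', sP c b * ev D c l = ev D c l' ∧ l'.length < l.length := by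
  induction l with
  | nil =>
    intro b hb h
    have := hx.pos hb
    rw [ev_nil, Equiv.Perm.one_apply] at h
    linarith
  | cons k t ih =>
    intro b hb h
    by_cases hbk : b = D.aSimple k
    · refine ⟨t, ?_, by simp⟩
      rw [hbk, ev_cons]; exact sj_cancel k _
    · have hp := srefl_simple_pos D k hb hbk
      obtain ⟨t', h1, h2⟩ := ih _ hp (by
        rw [aval_srefl D c hb.1 (aSimple_root D k), ← sj_apply]
        rwa [ev_cons] at h)
      refine ⟨k :: t', ?_, by simpa using h2⟩
      rw [ev_cons, ev_cons, ← h1, sP_conj hb.1 (aSimple_root D k)]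
      change _ = sj D c k * (sj D c k * _ * sj D c k * _)
      simp only [mul_assoc]
      rw [sj_cancel]

lemma exists_reduced (hc : 0 < c) (hx : IsX0 D c x0) {w : Equiv.Perm V} (hw : w ∈ D.WR c) :
    ∃ l, ev D c l = w ∧ l.length = D.len c w := by
  have main : ∀ l : List (Fin (D.n + 1)), (∀ l', ev D c l' = ev D c l → l.length ≤ l'.length) →
      D.len c (ev D c l) = l.length := by
    intro l
    induction l with
    | nil => intro _; rw [ev_nil, len_one hx]; rfl
    | cons j t ih =>
      intro hmin
      have ht := ih (by
        intro l' hl'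
        have := hmin (j :: l') (by rw [ev_cons, ev_cons, hl'])
        simpa using this)
      rcases lt_or_gt_of_ne (aval_w_ne hx (ev_mem t) (aSimple_root D j)) with h | h
      · exfalso
        obtain ⟨t', h1, h2⟩ := exchange hc hx t _ (aSimple_pos D j) h
        have := hmin t' (by rw [ev_cons, ← h1]; rfl)
        simp at this; omega
      · rw [ev_cons, len_asc hc hx (ev_mem t) h, ht]; rfl
  have hex : ∃ n, ∃ l, ev D c l = w ∧ l.length = n := by
    obtain ⟨l, hl⟩ := WR_eq_ev hc hw
    exact ⟨_, l, hl.symm, rfl⟩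
  obtain ⟨l, h1, h2⟩ := Nat.find_spec hex
  refine ⟨l, h1, ?_⟩
  rw [← h1]
  refine (main l fun l' hl' => ?_).symm
  rw [h2]
  exact Nat.find_min' hex ⟨l', hl'.trans h1, rfl⟩

lemma len_ev_le (hc : 0 < c) (hx : IsX0 D c x0) (l : List (Fin (D.n + 1))) :
    D.len c (ev D c l) ≤ l.length := by
  induction l with
  | nil => rw [ev_nil, len_one hx]; simp
  | cons j t ih =>
    rw [ev_cons]
    rcases lt_or_gt_of_ne (aval_w_ne hx (ev_mem t) (aSimple_root D j)) with h | h
    · have := len_desc hc hx (ev_mem t) h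
      simp; omega
    · rw [len_asc hc hx (ev_mem t) h]; simpa using ih

/-- `l` is reduced -/
def Red (D : RootSystemData V) (c : ℝ) (l : List (Fin (D.n + 1))) : Prop :=
  l.length = D.len c (ev D c l)

lemma red_cons (hc : 0 < c) (hx : IsX0 D c x0) {j : Fin (D.n + 1)} {t : List (Fin (D.n + 1))} :
    Red D c (j :: t) ↔ Red D c t ∧ 0 < aval c (D.aSimple j) (ev D c t x0) := by
  unfold Red
  rw [ev_cons]
  have h0 := len_ev_le hc hx t
  rcases lt_or_gt_of_ne (aval_w_ne hx (ev_mem t) (aSimple_root D j)) with h | h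
  · have := len_desc hc hx (ev_mem t) h
    constructor
    · intro h'; simp at h'; omega
    · rintro ⟨-, h'⟩; linarith
  · rw [len_asc hc hx (ev_mem t) h]
    simp [h]

lemma red_nil (hx : IsX0 D c x0) : Red D c [] := by
  unfold Red
  rw [ev_nil, len_one hx]; rfl

/-- induction along ascents -/
lemma wr_induction (hc : 0 < c) (hx : IsX0 D c x0) {p : Equiv.Perm V → Prop} (h1 : p 1)
    (hs : ∀ j w, w ∈ D.WR c → 0 < aval c (D.aSimple j) (w x0) → p w → p (sj D c j * w)) :
    ∀ w ∈ D.WR c, p w := by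
  have key : ∀ l, Red D c l → p (ev D c l) := by
    intro l
    induction l with
    | nil => intro _; exact h1
    | cons j t ih =>
      intro hr
      rw [red_cons hc hx] at hr
      rw [ev_cons]
      exact hs j _ (ev_mem t) hr.2 (ih hr.1)
  intro w hw
  obtain ⟨l, rfl, h2⟩ := exists_reduced hc hx hw
  exact key l h2

lemma RW_asc (hc : 0 < c) (hx : IsX0 D c x0) {w : Equiv.Perm V} (hw : w ∈ D.WR c)
    {j : Fin (D.n + 1)} (h : 0 < aval c (D.aSimple j) (w x0)) :
    D.RW c (sj D c j * w) = D.RW c w ∪ {pull D c w (D.aSimple j)} := by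
  rw [RW_mul hc hx (sj_mem j) hw (addi_sj hx hw h), RW_sj hx, Set.image_singleton]

lemma fix_of_vanish (hc : 0 < c) (hx : IsX0 D c x0) {w : Equiv.Perm V} (hw : w ∈ D.WR c) {x : V}
    (h : ∀ a ∈ D.RW c w, aval c a x = 0) : w x = x := by
  revert h
  refine wr_induction hc hx (p := fun w => (∀ a ∈ D.RW c w, aval c a x = 0) → w x = x)
    (fun _ => rfl) ?_ w hw
  intro j w hw ha ih h
  rw [RW_asc hc hx hw ha] at h
  have h1 := ih fun a ha => h a (Or.inl ha)
  have h2 := h _ (Or.inr rfl)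
  rw [aval_pull hw (aSimple_root D j), h1] at h2
  rw [Equiv.Perm.mul_apply, h1, sj_apply, sAff, h2, zero_smul, sub_zero]

lemma vanish_of_alcove (hc : 0 < c) (hx : IsX0 D c x0) {w : Equiv.Perm V} (hw : w ∈ D.WR c) {x : V}
    (h1 : x ∈ D.alcove c) (h2 : w x ∈ D.alcove c) : ∀ a ∈ D.RW c w, aval c a x = 0 := by
  intro a ha
  rw [mem_RW hx hw] at ha
  obtain ⟨ha, ha1, ha2⟩ := ha
  have hb : D.IsAffPos (-(pull D c w⁻¹ a)) := by
    rw [(hx _ (neg_root (pull_root (inv_mem hw) ha))).1, aval_neg, aval_pull (inv_mem hw) ha]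
    linarith
  have h3 := h2 _ hb
  rw [aval_neg, aval_pull (inv_mem hw) ha, p_inv_apply] at h3
  have h4 := h1 a ((hx a ha).1.2 ha1)
  linarith

lemma alcove_unique (hc : 0 < c) (hx : IsX0 D c x0) {w : Equiv.Perm V} (hw : w ∈ D.WR c) {x : V}
    (h1 : x ∈ D.alcove c) (h2 : w x ∈ D.alcove c) : w x = x :=
  fix_of_vanish hc hx hw (vanish_of_alcove hc hx hw h1 h2)

/-- the negative set of a point -/
def Nx (D : RootSystemData V) (c : ℝ) (x : V) : Set (V × ℤ) := {a | D.IsAffPos a ∧ aval c a x < 0}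

lemma Nx_finite (hc : 0 < c) (hx : IsX0 D c x0) (x : V) : (Nx D c x).Finite := by
  refine (aff_finite (D := D) hc x0 (∑ α ∈ D.R0, |⟪x0 - x, coroot α⟫|)).subset ?_
  rintro a ⟨ha, h2⟩
  refine ⟨ha.1, ?_⟩
  have h1 := hx.pos ha
  have hle := Finset.single_le_sum (f := fun α => |⟪x0 - x, coroot α⟫|)
    (fun _ _ => abs_nonneg _) ha.1
  refine le_trans ?_ hle
  have e := aval_sub c a x0 (x0 - x)
  rw [sub_sub_cancel] at e
  rw [abs_of_pos h1]
  refine le_trans ?_ (le_abs_self _)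
  linarith

lemma exists_greedy (hc : 0 < c) (hx : IsX0 D c x0) : ∀ n : ℕ, ∀ x : V, (Nx D c x).ncard = n →
    ∃ w ∈ D.WR c, w x ∈ D.alcove c ∧ D.RW c w = Nx D c x := by
  intro n
  induction n with
  | zero =>
    intro x h
    rw [Set.ncard_eq_zero (Nx_finite hc hx x)] at h
    refine ⟨1, one_mem _, ?_, by rw [RW_one hx, h]⟩
    intro a ha
    by_contra hcon
    push Not at hcon
    have : a ∈ Nx D c x := ⟨ha, hcon⟩
    rw [h] at this; exact this
  | succ n ih =>
    intro x h
    have hnot : x ∉ D.alcove c := by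
      intro hA
      have : Nx D c x = ∅ := by
        ext a
        simp only [Set.mem_empty_iff_false, iff_false]
        rintro ⟨ha, h'⟩
        linarith [hA a ha]
      rw [this] at h; simp at h
    rw [mem_alcove_iff hc] at hnot
    push Not at hnot
    obtain ⟨j, hj⟩ := hnot
    have hmem : D.aSimple j ∈ Nx D c x := ⟨aSimple_pos D j, hj⟩
    have hN : Nx D c x = insert (D.aSimple j) (pull D c (sj D c j) '' Nx D c (sj D c j x)) := by
      ext a
      constructor
      · rintro ⟨ha, h'⟩
        by_cases hne : a = D.aSimple j
        · left; exact hne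
        · right
          refine ⟨srefl (D.aSimple j) a, ⟨srefl_simple_pos D j ha hne, ?_⟩, ?_⟩
          · rw [aval_srefl D c ha.1 (aSimple_root D j), ← sj_apply, sj_sj_apply]; exact h'
          · rw [← pull_sP hc (aSimple_root D j) ha.1]
            change pull D c (sj D c j) (pull D c (sj D c j) a) = a
            rw [← pull_mul hc (sj_mem j) (sj_mem j) ha.1, sj_sj, pull_one hc ha.1]
      · rintro (rfl | ⟨b, ⟨hb, hb'⟩, rfl⟩)
        · exact hmem
        · have hne : b ≠ D.aSimple j := by
            rintro rfl
            rw [aval_sj] at hb'; linarith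
          refine ⟨?_, ?_⟩
          · change D.IsAffPos (pull D c (sP c (D.aSimple j)) b)
            rw [pull_sP hc (aSimple_root D j) hb.1]
            exact srefl_simple_pos D j hb hne
          · rwa [aval_pull (sj_mem j) hb.1]
    have hnm : D.aSimple j ∉ pull D c (sj D c j) '' Nx D c (sj D c j x) := by
      rintro ⟨b, ⟨hb, hb'⟩, hb2⟩
      have h3 := aval_pull (sj_mem (c := c) j) hb.1 x0
      have h4 := aval_pull (sj_mem (c := c) j) hb.1 x
      rw [hb2] at h3 h4
      have h5 : aval c b = fun y => - aval c (D.aSimple j) y := by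
        funext y
        have := aval_pull (sj_mem (c := c) j) hb.1 (sj D c j y)
        rw [hb2, sj_sj_apply, aval_sj] at this
        exact this.symm
      have h6 := hx.pos hb
      rw [h5] at h6
      have h7 := hx.pos (aSimple_pos D j)
      linarith
    have hcard : (Nx D c (sj D c j x)).ncard = n := by
      have hf := (Nx_finite hc hx (sj D c j x)).image (pull D c (sj D c j))
      rw [hN, Set.ncard_insert_of_notMem hnm hf, Set.InjOn.ncard_image] at h
      · omega
      · intro a ha b hb hab
        exact pull_inj hc (sj_mem j) ha.1.1 hb.1.1 hab
    obtain ⟨w, hw, hwA, hwR⟩ := ih _ hcard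
    refine ⟨w * sj D c j, mul_mem hw (sj_mem j), hwA, ?_⟩
    rw [RW_mul hc hx hw (sj_mem j), hwR, RW_sj hx, hN]
    · rfl
    · intro b hb hb'
      rw [sj_inv, RW_sj hx, Set.mem_singleton_iff] at hb'
      rw [hwR, hb'] at hb
      have := hb.2
      rw [aval_sj] at this; linarith

lemma Nx_subset (hx : IsX0 D c x0) {w : Equiv.Perm V} (hw : w ∈ D.WR c) {x : V}
    (h : w x ∈ D.alcove c) : Nx D c x ⊆ D.RW c w := by
  rintro a ⟨ha, h'⟩
  rw [mem_RW hx hw]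
  refine ⟨ha.1, hx.pos ha, ?_⟩
  have hr := pull_root (inv_mem hw) ha.1
  rw [← aval_pull (inv_mem hw) ha.1, ← (hx _ hr).2]
  rcases aff_pos_or_neg hr with h1 | h1
  · have := h _ h1
    rw [aval_pull (inv_mem hw) ha.1, p_inv_apply] at this
    linarith
  · exact h1

lemma RW_wmin (hc : 0 < c) (hx : IsX0 D c x0) {wmin : V → Equiv.Perm V} (hw : D.IsWmin c wmin)
    (x : V) : D.RW c (wmin x) = Nx D c x := by
  obtain ⟨u, hu, huA, huR⟩ := exists_greedy hc hx _ x rfl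
  obtain ⟨h1, h2, h3⟩ := hw x
  rcases h3 u hu huA with h | h
  · exfalso
    rw [RootSystemData.len, RootSystemData.len, huR] at h
    have := Set.ncard_le_ncard (Nx_subset hx h1 h2) (RW_finite hc hx h1)
    omega
  · rw [← h, huR]

/-- factorization through `w_x` -/
lemma wmin_factor (hc : 0 < c) (hx : IsX0 D c x0) {wmin : V → Equiv.Perm V} (hw : D.IsWmin c wmin)
    {x : V} {w : Equiv.Perm V} (hwR : w ∈ D.WR c) (hA : w x ∈ D.alcove c) :
    w x = wmin x x ∧ Addi D c (w * (wmin x)⁻¹) (wmin x) ∧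
      ∀ a ∈ D.RW c (w * (wmin x)⁻¹), aval c a (wmin x x) = 0 := by
  obtain ⟨h1, h2, -⟩ := hw x
  have hv := mul_mem hwR (inv_mem h1)
  have hvx : (w * (wmin x)⁻¹) (wmin x x) = w x := by simp
  have hvan := vanish_of_alcove hc hx hv h2 (by rw [hvx]; exact hA)
  refine ⟨?_, ?_, hvan⟩
  · rw [← hvx]; exact fix_of_vanish hc hx hv hvan
  · intro b hb hb'
    have h0 := hvan b hb
    rw [mem_RW hx (inv_mem h1), inv_inv] at hb'
    obtain ⟨hbr, hb1, hb2⟩ := hb'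
    have hn : -(pull D c (wmin x) b) ∈ D.RW c (wmin x) := by
      rw [mem_RW hx h1]
      refine ⟨neg_root (pull_root h1 hbr), ?_, ?_⟩
      · rw [aval_neg, aval_pull h1 hbr]; linarith
      · rw [aval_neg, aval_pull h1 hbr, p_apply_inv]; linarith
    rw [RW_wmin hc hx hw] at hn
    have := hn.2
    rw [aval_neg, aval_pull h1 hbr, h0] at this
    linarith

/-- linear part -/
lemma exists_lin {w : Equiv.Perm V} (hw : w ∈ D.WR c) :
    ∃ g ∈ D.W0, ∀ x y, w (x + y) = w x + g y := by
  refine WR_ind (D := D) (c := c) (p := fun w => ∃ g ∈ D.W0, ∀ x y, w (x + y) = w x + g y) ?_ ?_ w hw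
  · exact ⟨1, one_mem _, fun x y => rfl⟩
  · rintro a w ha hw ⟨g, hg, h⟩
    refine ⟨sP c (a.1, 0) * g, mul_mem (Subgroup.subset_closure ⟨a.1, ha, fun x => ?_⟩) hg, ?_⟩
    · rw [sP_apply c _ (root_ne (a := (a.1, 0)) ha)]; simp [sAff, aval]
    · intro x y
      rw [Equiv.Perm.mul_apply, Equiv.Perm.mul_apply, Equiv.Perm.mul_apply, h,
        sP_apply c _ (root_ne (a := (a.1, 0)) ha),
        sP_apply c _ (root_ne ha), sP_apply c _ (root_ne ha)]
      simp only [sAff, aval, inner_add_left]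
      push_cast
      module

lemma linPart_spec {w : Equiv.Perm V} (hw : w ∈ D.WR c) :
    (∃ g ∈ D.W0, ∀ y, linPart w y = g y) ∧ ∀ x y, w (x + y) = w x + linPart w y := by
  obtain ⟨g, hg, h⟩ := exists_lin hw
  have e : ∀ y, linPart w y = g y := fun y => by
    have := h 0 y
    rw [zero_add] at this
    rw [linPart, this]; abel
  exact ⟨⟨g, hg, e⟩, fun x y => by rw [e, h]⟩

lemma linPart_add {w : Equiv.Perm V} (hw : w ∈ D.WR c) (x y : V) :
    linPart w (x + y) = linPart w x + linPart w y := by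
  have h := (linPart_spec hw).2
  have := h 0 (x + y)
  rw [zero_add, h x y, ← zero_add x, h 0 x] at this
  rw [zero_add] at this
  have h2 : w 0 + (linPart w x + linPart w y) = w 0 + linPart w (x + y) := by
    rw [← this]; abel
  exact (add_left_cancel h2).symm

lemma linPart_neg {w : Equiv.Perm V} (hw : w ∈ D.WR c) (x : V) :
    linPart w (-x) = -linPart w x := by
  have h0 : linPart w 0 = 0 := by simp [linPart]
  have := linPart_add hw x (-x)
  rw [add_neg_cancel, h0] at this
  exact (neg_eq_of_add_eq_zero_right this.symm).symm

lemma w_sub {w : Equiv.Perm V} (hw : w ∈ D.WR c) (x y : V) : w (x - y) = w x - linPart w y := by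
  rw [sub_eq_add_neg, (linPart_spec hw).2, linPart_neg hw, ← sub_eq_add_neg]

end wr
end AW

namespace AW
open RootSystemData
variable {V : Type*} [NormedAddCommGroup V] [InnerProductSpace ℝ V]

/-- Functionals that are finite combinations of point evaluations. -/
inductive FF : ((V → ℂ) → ℂ) → Prop
  | zero : FF (fun _ => 0)
  | ev (x : V) : FF (fun f => f x)
  | add {φ ψ : (V → ℂ) → ℂ} : FF φ → FF ψ → FF (fun f => φ f + ψ f)
  | smul {φ : (V → ℂ) → ℂ} (z : ℂ) : FF φ → FF (fun f => z * φ f)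

lemma FF.sum {ι : Type*} (s : Finset ι) (φ : ι → (V → ℂ) → ℂ) (h : ∀ i ∈ s, FF (φ i)) :
    FF (fun f => ∑ i ∈ s, φ i f) := by
  induction s using Finset.induction_on with
  | empty => simpa using FF.zero
  | insert a s ha ih =>
    simp only [Finset.sum_insert ha]
    exact FF.add (h a (Finset.mem_insert_self a s))
      (ih fun i hi => h i (Finset.mem_insert_of_mem hi))

lemma FF.neg {φ : (V → ℂ) → ℂ} (h : FF φ) : FF (fun f => - φ f) := by
  have := FF.smul (-1) h
  simpa using this

lemma FF.sub {φ ψ : (V → ℂ) → ℂ} (h : FF φ) (h' : FF ψ) : FF (fun f => φ f - ψ f) := by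
  simpa [sub_eq_add_neg] using FF.add h h'.neg

lemma FF.comp {T : (V → ℂ) → V → ℂ} (hT : ∀ x, FF (fun f => T f x)) {φ : (V → ℂ) → ℂ}
    (h : FF φ) : FF (fun f => φ (T f)) := by
  induction h with
  | zero => exact FF.zero
  | ev x => exact hT x
  | add _ _ h1 h2 => exact FF.add h1 h2
  | smul z _ h1 => exact FF.smul z h1

lemma FF.rep {φ : (V → ℂ) → ℂ} (h : FF φ) :
    ∃ d : V →₀ ℂ, ∀ f, φ f = d.sum fun x z => z * f x := by
  induction h with
  | zero => exact ⟨0, by simp⟩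
  | ev x => exact ⟨Finsupp.single x 1, by simp⟩
  | add _ _ h1 h2 =>
    obtain ⟨d, hd⟩ := h1
    obtain ⟨e, he⟩ := h2
    refine ⟨d + e, fun f => ?_⟩
    beta_reduce
    rw [Finsupp.sum_add_index', hd, he]
    · simp
    · intros; ring
  | smul z _ h1 =>
    obtain ⟨d, hd⟩ := h1
    refine ⟨z • d, fun f => ?_⟩
    beta_reduce
    rw [Finsupp.sum_smul_index', hd, Finsupp.sum, Finsupp.sum, Finset.mul_sum]
    · refine Finset.sum_congr rfl fun x _ => ?_
      simp [mul_assoc]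
    · simp

/-- FF functionals are linear. -/
lemma FF.map_sum {φ : (V → ℂ) → ℂ} (h : FF φ) {ι : Type*} (s : Finset ι) (v : ι → ℂ)
    (E : ι → V → ℂ) : φ (fun x => ∑ k ∈ s, v k * E k x) = ∑ k ∈ s, v k * φ (E k) := by
  induction h with
  | zero => simp
  | ev x => rfl
  | add _ _ h1 h2 => beta_reduce; rw [h1, h2, ← Finset.sum_add_distrib]; exact Finset.sum_congr rfl fun k _ => by ring
  | smul z _ h1 => beta_reduce; rw [h1, Finset.mul_sum]; exact Finset.sum_congr rfl fun k _ => by ring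

lemma FF_Jop (c : ℝ) (a : V × ℤ) (x : V) : FF (fun f => Jop (R := ℂ) c a f x) := by
  unfold Jop
  split_ifs
  · exact (FF.sum _ _ fun k _ => FF.ev _).neg
  · exact FF.zero
  · exact FF.sum _ _ fun k _ => FF.ev _

lemma FF_Iop (c : ℝ) (τ : V × ℤ → ℂ) (a : V × ℤ) (x : V) : FF (fun f => Iop c τ a f x) := by
  unfold Iop
  exact FF.add (FF.smul _ (FF.ev _)) (FF.smul _ (FF_Jop c a x))

lemma wordOp_nil (D : RootSystemData V) (c : ℝ) (τ : V × ℤ → ℂ) (f : V → ℂ) :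
    D.wordOp c τ [] f = f := rfl

lemma wordOp_cons (D : RootSystemData V) (c : ℝ) (τ : V × ℤ → ℂ) (j : Fin (D.n + 1))
    (l : List (Fin (D.n + 1))) (f : V → ℂ) :
    D.wordOp c τ (j :: l) f = Iop c τ (D.aSimple j) (D.wordOp c τ l f) := rfl

lemma wordOp_append (D : RootSystemData V) (c : ℝ) (τ : V × ℤ → ℂ)
    (l l' : List (Fin (D.n + 1))) (f : V → ℂ) :
    D.wordOp c τ (l ++ l') f = D.wordOp c τ l (D.wordOp c τ l' f) := by
  induction l with
  | nil => rfl
  | cons j l ih => rw [List.cons_append, wordOp_cons, ih, wordOp_cons]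

lemma FF_wordOp (D : RootSystemData V) (c : ℝ) (τ : V × ℤ → ℂ)
    (l : List (Fin (D.n + 1))) (x : V) : FF (fun f => D.wordOp c τ l f x) := by
  induction l generalizing x with
  | nil => exact FF.ev x
  | cons j l ih =>
    simp only [wordOp_cons]
    exact FF.comp (φ := fun f => Iop c τ (D.aSimple j) f x) ih (FF_Iop c τ _ x)

/-- exponentials -/
def ee (ξ x : V) : ℂ := ((Real.exp ⟪x, ξ⟫ : ℝ) : ℂ)

lemma ee_ne (ξ x : V) : ee ξ x ≠ 0 := by
  unfold ee; exact_mod_cast (Real.exp_pos _).ne'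

lemma ee_add (ξ x y : V) : ee ξ (x + y) = ee ξ x * ee ξ y := by
  unfold ee; rw [inner_add_left, Real.exp_add]; push_cast; ring

lemma ee_neg (ξ x : V) : ee ξ (-x) = (ee ξ x)⁻¹ := by
  unfold ee; rw [inner_neg_left, Real.exp_neg]; push_cast; ring

lemma ee_zsmul (ξ x : V) (k : ℤ) : ee ξ (k • x) = ee ξ x ^ k := by
  unfold ee
  rw [← Int.cast_smul_eq_zsmul ℝ k x, real_inner_smul_left, mul_comm, Real.exp_mul, Real.rpow_intCast]; push_cast; rfl

lemma ee_nsmul_right (ξ x : V) (k : ℕ) : ee ((k : ℝ) • ξ) x = ee ξ x ^ k := by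
  unfold ee
  rw [real_inner_smul_right, Real.exp_nat_mul]; push_cast; rfl

lemma ee_inj {ξ x y : V} (h : ⟪x - y, ξ⟫ ≠ 0) : ee ξ x ≠ ee ξ y := by
  unfold ee
  intro h'
  have h2 : Real.exp ⟪x, ξ⟫ = Real.exp ⟪y, ξ⟫ := by exact_mod_cast h'
  have := Real.exp_injective h2
  rw [inner_sub_left] at h; exact h (by linarith)

lemma ee_ne_one {ξ x : V} (h : ⟪x, ξ⟫ ≠ 0) : ee ξ x ≠ 1 := by
  have := ee_inj (ξ := ξ) (x := x) (y := 0) (by simpa using h)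
  simpa [ee] using this

/-- generic spectral parameter -/
def Gen (D : RootSystemData V) (ξ : V) : Prop := ∀ α ∈ D.R0, ⟪α, ξ⟫ ≠ 0

lemma exists_gen (D : RootSystemData V) (s : Finset V) (hs : ∀ x ∈ s, x ≠ 0) :
    ∃ ξ : V, ∀ x ∈ s, ⟪x, ξ⟫ ≠ 0 := by
  haveI := fd D
  obtain ⟨φ, hφ⟩ := Module.exists_dual_forall_apply_ne_zero (K := ℝ) (M := V) (ι := s)
    (fun i => (i : V)) (fun i => hs i i.2)
  refine ⟨(InnerProductSpace.toDual ℝ V).symm (LinearMap.toContinuousLinearMap φ), fun x hx => ?_⟩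
  rw [real_inner_comm, InnerProductSpace.toDual_symm_apply]
  exact hφ ⟨x, hx⟩

lemma FF.zero_of {φ : (V → ℂ) → ℂ} (D : RootSystemData V) (h : FF φ)
    (h0 : ∀ ξ, Gen D ξ → φ (ee ξ) = 0) (f : V → ℂ) : φ f = 0 := by
  obtain ⟨d, hd⟩ := h.rep
  obtain ⟨ξ, hξ⟩ := exists_gen D (D.R0 ∪ ((d.support ×ˢ d.support).image
    (fun p => p.1 - p.2)).erase 0) (by
      intro x hx
      rcases Finset.mem_union.1 hx with hx | hx
      · exact D.ne_zero x hx
      · exact Finset.ne_of_mem_erase hx)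
  let e := d.support.equivFin
  have key := Matrix.eq_zero_of_forall_pow_sum_mul_pow_eq_zero
    (f := fun j => ee ξ (e.symm j)) (v := fun j => d (e.symm j) * ee ξ (e.symm j)) (by
      intro i j hij
      by_contra hne
      have hne' : ((e.symm i : V)) ≠ e.symm j := by
        intro h; exact hne (e.symm.injective (Subtype.ext h))
      refine ee_inj (hξ _ ?_) hij
      apply Finset.mem_union_right
      rw [Finset.mem_erase]
      refine ⟨sub_ne_zero.2 hne', Finset.mem_image.2 ⟨(e.symm i, e.symm j), ?_, rfl⟩⟩
      exact Finset.mem_product.2 ⟨(e.symm i).2, (e.symm j).2⟩) (by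
      intro i
      have hg : Gen D (((i + 1 : ℕ) : ℝ) • ξ) := by
        intro α hα
        rw [real_inner_smul_right]
        refine mul_ne_zero (by positivity) (hξ _ (Finset.mem_union_left _ hα))
      have := h0 _ hg
      rw [hd, Finsupp.sum, ← Finset.sum_coe_sort, ← e.symm.sum_comp] at this
      rw [← this]
      refine Finset.sum_congr rfl fun j _ => ?_
      rw [ee_nsmul_right]; ring)
  rw [hd, Finsupp.sum]
  refine Finset.sum_eq_zero fun x hx => ?_
  have := congrFun key (e ⟨x, hx⟩)
  simp only [Equiv.symm_apply_apply, Pi.zero_apply, mul_eq_zero] at this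
  rcases this with h | h
  · rw [h, zero_mul]
  · exact absurd h (ee_ne _ _)

lemma FF.eq_of {φ ψ : (V → ℂ) → ℂ} (D : RootSystemData V) (h : FF φ) (h' : FF ψ)
    (h0 : ∀ ξ, Gen D ξ → φ (ee ξ) = ψ (ee ξ)) (f : V → ℂ) : φ f = ψ f :=
  sub_eq_zero.1 ((h.sub h').zero_of D (fun ξ hξ => sub_eq_zero.2 (h0 ξ hξ)) f)

end AW

namespace AW

def Tv {N : ℕ} (σ : Fin N → Fin N) (t κ : ℂ) (G v : Fin N → ℂ) : Fin N → ℂ :=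
  fun k => (t + κ * G (σ k)) * v (σ k) - κ * G k * v k

lemma braid2 (X Y t k s l : ℂ)
    (h1 : X - 1 ≠ 0)    (h2 : Y - 1 ≠ 0)
    (g1 g2 : ℂ)
    (e1 : g1 = 1 / (X - 1))    (e2 : g2 = 1 / (Y - 1))
 :
    let Ti := Tv ![1, 0, 3, 2] t k
      ![g1, (-1 - g1), (-1 - g1), g1]
    let Tj := Tv ![3, 2, 1, 0] s l
      ![g2, g2, (-1 - g2), (-1 - g2)]
    Ti (Tj ![1, 0, 0, 0])
      = Tj (Ti ![1, 0, 0, 0]) := by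
  intro Ti Tj
  have HI : ∀ v0 v1 v2 v3, Ti ![v0, v1, v2, v3] =
      ![(t + k * (-1 - g1)) * v1 - k * g1 * v0,
        (t + k * g1) * v0 - k * (-1 - g1) * v1,
        (t + k * g1) * v3 - k * (-1 - g1) * v2,
        (t + k * (-1 - g1)) * v2 - k * g1 * v3] := by
    intros; funext i; fin_cases i <;> rfl
  have HJ : ∀ v0 v1 v2 v3, Tj ![v0, v1, v2, v3] =
      ![(s + l * (-1 - g2)) * v3 - l * g2 * v0,
        (s + l * (-1 - g2)) * v2 - l * g2 * v1,
        (s + l * g2) * v1 - l * (-1 - g2) * v2,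
        (s + l * g2) * v0 - l * (-1 - g2) * v3] := by
    intros; funext i; fin_cases i <;> rfl
  simp only [HI, HJ, mul_zero, mul_one, sub_zero, zero_sub]
  subst e1 e2
  refine congrArg₂ Matrix.vecCons ?_ (congrArg₂ Matrix.vecCons ?_ (congrArg₂ Matrix.vecCons ?_ (congrArg₂ Matrix.vecCons ?_ rfl)))
  all_goals first | rfl | (field_simp; done) | (field_simp; ring)

lemma braid3 (X Y t k : ℂ)
    (h1 : X - 1 ≠ 0)    (h2 : X * Y - 1 ≠ 0)    (h3 : Y - 1 ≠ 0)

    (g1 g2 g3 : ℂ)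
    (e1 : g1 = 1 / (X - 1))    (e2 : g2 = 1 / (X * Y - 1))
    (e3 : g3 = 1 / (Y - 1)) :
    let Ti := Tv ![1, 0, 3, 2, 5, 4] t k
      ![g1, (-1 - g1), g3, (-1 - g3), (-1 - g2), g2]
    let Tj := Tv ![5, 2, 1, 4, 3, 0] t k
      ![g3, g2, (-1 - g2), (-1 - g1), g1, (-1 - g3)]
    Ti (Tj (Ti ![1, 0, 0, 0, 0, 0]))
      = Tj (Ti (Tj ![1, 0, 0, 0, 0, 0])) := by
  intro Ti Tj
  have HI : ∀ v0 v1 v2 v3 v4 v5, Ti ![v0, v1, v2, v3, v4, v5] =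
      ![(t + k * (-1 - g1)) * v1 - k * g1 * v0,
        (t + k * g1) * v0 - k * (-1 - g1) * v1,
        (t + k * (-1 - g3)) * v3 - k * g3 * v2,
        (t + k * g3) * v2 - k * (-1 - g3) * v3,
        (t + k * g2) * v5 - k * (-1 - g2) * v4,
        (t + k * (-1 - g2)) * v4 - k * g2 * v5] := by
    intros; funext i; fin_cases i <;> rfl
  have HJ : ∀ v0 v1 v2 v3 v4 v5, Tj ![v0, v1, v2, v3, v4, v5] =
      ![(t + k * (-1 - g3)) * v5 - k * g3 * v0,
        (t + k * (-1 - g2)) * v2 - k * g2 * v1,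
        (t + k * g2) * v1 - k * (-1 - g2) * v2,
        (t + k * g1) * v4 - k * (-1 - g1) * v3,
        (t + k * (-1 - g1)) * v3 - k * g1 * v4,
        (t + k * g3) * v0 - k * (-1 - g3) * v5] := by
    intros; funext i; fin_cases i <;> rfl
  simp only [HI, HJ, mul_zero, mul_one, sub_zero, zero_sub]
  subst e1 e2 e3
  refine congrArg₂ Matrix.vecCons ?_ (congrArg₂ Matrix.vecCons ?_ (congrArg₂ Matrix.vecCons ?_ (congrArg₂ Matrix.vecCons ?_ (congrArg₂ Matrix.vecCons ?_ (congrArg₂ Matrix.vecCons ?_ rfl)))))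
  all_goals first | rfl | (field_simp; done) | (field_simp; ring)

lemma braid4 (X Y t k s l : ℂ)
    (h1 : X - 1 ≠ 0)    (h2 : X * Y - 1 ≠ 0)    (h3 : X * Y ^ 2 - 1 ≠ 0)
    (h4 : Y - 1 ≠ 0)
    (g1 g2 g3 g4 : ℂ)
    (e1 : g1 = 1 / (X - 1))    (e2 : g2 = 1 / (X * Y - 1))
    (e3 : g3 = 1 / (X * Y ^ 2 - 1))    (e4 : g4 = 1 / (Y - 1))
 :
    let Ti := Tv ![1, 0, 3, 2, 5, 4, 7, 6] t k
      ![g1, (-1 - g1), g3, (-1 - g3), (-1 - g1), g1, (-1 - g3), g3]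
    let Tj := Tv ![7, 2, 1, 4, 3, 6, 5, 0] s l
      ![g4, g2, (-1 - g2), g4, (-1 - g4), (-1 - g2), g2, (-1 - g4)]
    Ti (Tj (Ti (Tj ![1, 0, 0, 0, 0, 0, 0, 0])))
      = Tj (Ti (Tj (Ti ![1, 0, 0, 0, 0, 0, 0, 0]))) := by
  intro Ti Tj
  have HI : ∀ v0 v1 v2 v3 v4 v5 v6 v7, Ti ![v0, v1, v2, v3, v4, v5, v6, v7] =
      ![(t + k * (-1 - g1)) * v1 - k * g1 * v0,
        (t + k * g1) * v0 - k * (-1 - g1) * v1,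
        (t + k * (-1 - g3)) * v3 - k * g3 * v2,
        (t + k * g3) * v2 - k * (-1 - g3) * v3,
        (t + k * g1) * v5 - k * (-1 - g1) * v4,
        (t + k * (-1 - g1)) * v4 - k * g1 * v5,
        (t + k * g3) * v7 - k * (-1 - g3) * v6,
        (t + k * (-1 - g3)) * v6 - k * g3 * v7] := by
    intros; funext i; fin_cases i <;> rfl
  have HJ : ∀ v0 v1 v2 v3 v4 v5 v6 v7, Tj ![v0, v1, v2, v3, v4, v5, v6, v7] =
      ![(s + l * (-1 - g4)) * v7 - l * g4 * v0,
        (s + l * (-1 - g2)) * v2 - l * g2 * v1,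
        (s + l * g2) * v1 - l * (-1 - g2) * v2,
        (s + l * (-1 - g4)) * v4 - l * g4 * v3,
        (s + l * g4) * v3 - l * (-1 - g4) * v4,
        (s + l * g2) * v6 - l * (-1 - g2) * v5,
        (s + l * (-1 - g2)) * v5 - l * g2 * v6,
        (s + l * g4) * v0 - l * (-1 - g4) * v7] := by
    intros; funext i; fin_cases i <;> rfl
  simp only [HI, HJ, mul_zero, mul_one, sub_zero, zero_sub]
  subst e1 e2 e3 e4
  refine congrArg₂ Matrix.vecCons ?_ (congrArg₂ Matrix.vecCons ?_ (congrArg₂ Matrix.vecCons ?_ (congrArg₂ Matrix.vecCons ?_ (congrArg₂ Matrix.vecCons ?_ (congrArg₂ Matrix.vecCons ?_ (congrArg₂ Matrix.vecCons ?_ (congrArg₂ Matrix.vecCons ?_ rfl)))))))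
  all_goals first | rfl | (field_simp; done) | (field_simp; ring)


set_option maxRecDepth 100000 in
set_option maxHeartbeats 4000000 in
lemma braid6 (t k s l : ℂ)
    (g1 g2 g3 g4 g5 g6 : ℂ)
    (r1 : g2 * (1 + g1 + g6) - g1 * g6 = 0)
    (r2 : g3 * (1 + g1 + g5) - g1 * g5 = 0)
    (r3 : g3 * (1 + g2 + g4) - g2 * g4 = 0)
    (r4 : g4 * (1 + g2 + g6) - g2 * g6 = 0)
    (r5 : g5 * (1 + g4 + g6) - g4 * g6 = 0) :
    let Ti := Tv ![1, 0, 3, 2, 5, 4, 7, 6, 9, 8, 11, 10] t k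
      ![g1, (-1 - g1), g3, (-1 - g3), g5, (-1 - g5), (-1 - g1), g1, (-1 - g3), g3, (-1 - g5), g5]
    let Tj := Tv ![11, 2, 1, 4, 3, 6, 5, 8, 7, 10, 9, 0] s l
      ![g6, g2, (-1 - g2), g4, (-1 - g4), g6, (-1 - g6), (-1 - g2), g2, (-1 - g4), g4, (-1 - g6)]
    Ti (Tj (Ti (Tj (Ti (Tj ![1, 0, 0, 0, 0, 0, 0, 0, 0, 0, 0, 0])))))
      = Tj (Ti (Tj (Ti (Tj (Ti ![1, 0, 0, 0, 0, 0, 0, 0, 0, 0, 0, 0]))))) := by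
  intro Ti Tj
  have HI : ∀ v0 v1 v2 v3 v4 v5 v6 v7 v8 v9 v10 v11, Ti ![v0, v1, v2, v3, v4, v5, v6, v7, v8, v9, v10, v11] =
      ![(t + k * (-1 - g1)) * v1 - k * g1 * v0,
        (t + k * g1) * v0 - k * (-1 - g1) * v1,
        (t + k * (-1 - g3)) * v3 - k * g3 * v2,
        (t + k * g3) * v2 - k * (-1 - g3) * v3,
        (t + k * (-1 - g5)) * v5 - k * g5 * v4,
        (t + k * g5) * v4 - k * (-1 - g5) * v5,
        (t + k * g1) * v7 - k * (-1 - g1) * v6,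
        (t + k * (-1 - g1)) * v6 - k * g1 * v7,
        (t + k * g3) * v9 - k * (-1 - g3) * v8,
        (t + k * (-1 - g3)) * v8 - k * g3 * v9,
        (t + k * g5) * v11 - k * (-1 - g5) * v10,
        (t + k * (-1 - g5)) * v10 - k * g5 * v11] := by
    intros; funext i; fin_cases i <;> rfl
  have HJ : ∀ v0 v1 v2 v3 v4 v5 v6 v7 v8 v9 v10 v11, Tj ![v0, v1, v2, v3, v4, v5, v6, v7, v8, v9, v10, v11] =
      ![(s + l * (-1 - g6)) * v11 - l * g6 * v0,
        (s + l * (-1 - g2)) * v2 - l * g2 * v1,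
        (s + l * g2) * v1 - l * (-1 - g2) * v2,
        (s + l * (-1 - g4)) * v4 - l * g4 * v3,
        (s + l * g4) * v3 - l * (-1 - g4) * v4,
        (s + l * (-1 - g6)) * v6 - l * g6 * v5,
        (s + l * g6) * v5 - l * (-1 - g6) * v6,
        (s + l * g2) * v8 - l * (-1 - g2) * v7,
        (s + l * (-1 - g2)) * v7 - l * g2 * v8,
        (s + l * g4) * v10 - l * (-1 - g4) * v9,
        (s + l * (-1 - g4)) * v9 - l * g4 * v10,
        (s + l * g6) * v0 - l * (-1 - g6) * v11] := by
    intros; funext i; fin_cases i <;> rfl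
  simp only [HI, HJ, mul_zero, mul_one, sub_zero, zero_sub]
  refine congrArg₂ Matrix.vecCons ?_ (congrArg₂ Matrix.vecCons ?_ (congrArg₂ Matrix.vecCons ?_ (congrArg₂ Matrix.vecCons ?_ (congrArg₂ Matrix.vecCons ?_ (congrArg₂ Matrix.vecCons ?_ (congrArg₂ Matrix.vecCons ?_ (congrArg₂ Matrix.vecCons ?_ (congrArg₂ Matrix.vecCons ?_ (congrArg₂ Matrix.vecCons ?_ (congrArg₂ Matrix.vecCons ?_ (congrArg₂ Matrix.vecCons ?_ rfl)))))))))))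
  · ring
  · linear_combination (t*k^2*s^2*l*(g5 - g3)
      + t*k^2*s*l^2*(-g5 + g3)
      + t^2*k*l^3*(-g4 - g4*g6 + g2*g6 - g2*g4)
      + t*k^2*l^3*(g4 - g5*g6 + g4*g6 - g3*g6 - 2*g2*g6 + g2*g4 + 2*g2*g3 + g2^2 - g5*g6^2 - g3*g6^2 + g2*g6^2 - g2^2*g6 + 2*g2^2*g3 + g1*g6^2 - 2*g1*g2*g6 + g1*g2^2)
      + k^3*s^2*l*(-g3 - g5*g6 + g3*g6 - g3^2 + 2*g1*g5 - 2*g1*g3)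
      + k^3*s*l^2*(g3 + g5*g6 - g3*g6 + g3^2 - 2*g1*g5 + 2*g1*g3)
      + k^3*l^3*(g3*g4 + g3^2 + g5*g6^2 - g3*g6^2 + g3*g4*g6 + 2*g3^2*g6 + g3^2*g4 - 3*g2*g3*g6 + g2*g3*g4 + 2*g2*g3^2 - 2*g1*g5*g6 - g1*g2*g6 + 2*g1*g2*g3 + g1*g2^2 + g5*g6^3 - g3*g6^3 + g3^2*g6^2 + g3^2*g4*g6 - 2*g2*g3*g6^2 + g2*g3^2*g6 + g2*g3^2*g4 + g2^2*g6^2 - 2*g2^2*g3*g6 + g2^2*g3^2 - 2*g1*g5*g6^2 + g1*g2*g6^2 - g1*g2^2*g6 + 2*g1*g2^2*g3 + g1^2*g6^2 - 2*g1^2*g2*g6 + g1^2*g2^2)) * r1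
    + (t*k^2*s^2*l*(g6 - g2)
      + t*k^2*s*l^2*(-g6 + g2)
      + t*k^2*l^3*(-g6^2 + g2*g6 - g6^3 + g2*g6^2)
      + k^3*s^2*l*(-g5 - g4 - g3 + g2 + g6^2 - g5*g6 - g4*g5 - g3*g6 - g3*g4 + g2*g6)
      + k^3*s*l^2*(g5 + g4 + g3 - g2 - g6^2 + g5*g6 + g4*g5 + g3*g6 + g3*g4 - g2*g6)
      + k^3*l^3*(g5*g6 + g4*g6 + g3*g6 - g2*g6 - g6^3 + 2*g5*g6^2 + g4*g6^2 + g4*g5*g6 + 2*g3*g6^2 + g3*g4*g6 - 2*g2*g6^2 - g6^4 + g5*g6^3 + g4*g5*g6^2 + g3*g6^3 + g3*g4*g6^2 - g2*g6^3)) * r2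
    + (t*k^2*s^2*l*(g5 - g3)
      + t*k^2*s*l^2*(-g5 + g3)
      + t*k^2*l^3*(g6^2 - g5*g6 - g4^2 - g2*g6 + g2*g4 + g2*g3 + g6^3 - g5*g6^2 - g4^2*g6 + 2*g2*g4*g6 - g2*g4^2 - 2*g2^2*g6 + g2^2*g4 + g2^2*g3)
      + k^3*s^2*l*(-g5 + g3 - g6^2 + g4*g6 - g4*g5 + g3*g6)
      + k^3*s*l^2*(g5 - g3 + g6^2 - g4*g6 + g4*g5 - g3*g6)
      + k^3*l^3*(g5*g6 - g4*g6 + g4^2 - g3*g6 + g2*g6 - g2*g4 - g2*g3 + g6^3 + g5*g6^2 - 3*g4*g6^2 + g4*g5*g6 + 2*g4^2*g6 - 2*g3*g6^2 + 3*g2*g6^2 - 4*g2*g4*g6 + g2*g4^2 - 2*g2*g3*g6 + 2*g2^2*g6 - g2^2*g4 - g2^2*g3 + g6^4 - 2*g4*g6^3 + g4*g5*g6^2 + g4^2*g6^2 - g3*g6^3 + 2*g2*g6^3 - 3*g2*g4*g6^2 + g2*g4^2*g6 - g2*g3*g6^2 + 2*g2^2*g6^2 - g2^2*g4*g6 - g2^2*g3*g6))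 * r3
    + (t*k^2*s^2*l*(g5 - g3)
      + t*k^2*s*l^2*(-g5 + g3)
      + t^3*l^3*(g6 - g2)
      + t^2*k*l^3*(-g6 + 2*g2 + g2*g6)
      + t*k^2*l^3*(-g2 - g5*g6 + g3*g4 - g2*g6 - g5*g6^2 + g3*g4^2 + g2*g6^2 - g2*g4^2 - g2^2*g6 + g2^2*g4)
      + k^3*s^2*l*(-g5 + g3 - g5*g6 + g4*g6 - g4*g5 + g3*g5)
      + k^3*s*l^2*(g5 - g3 + g5*g6 - g4*g6 + g4*g5 - g3*g5)
      + k^3*l^3*(g5*g6 - g3*g4 + 2*g5*g6^2 - g4*g6^2 + g4*g5*g6 - g3*g5*g6 - g3*g4^2 - g2*g4*g6 + g2*g4^2 + g2^2*g6 - g2^2*g4 + g5*g6^3 - g4*g6^3 + g4*g5*g6^2 - g3*g5*g6^2 + g3*g4*g6^2 - g3*g4^2*g6 - g2*g4*g6^2 + g2*g4^2*g6 + g2^2*g6^2 - g2^2*g4*g6)) * r4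
    + (t*k^2*s^2*l*(g5 - g3)
      + t*k^2*s*l^2*(-g5 + g3)
      + t*k^2*l^3*(-g5*g6 + g3*g6 - g5*g6^2 + g3*g6^2)
      + k^3*s^2*l*(g4 + 2*g3 + g4*g6 - g3*g6 + g3*g5 + g3*g4 + g3^2)
      + k^3*s*l^2*(-g4 - 2*g3 - g4*g6 + g3*g6 - g3*g5 - g3*g4 - g3^2)
      + k^3*l^3*(-g4*g6 - 2*g3*g6 - 2*g4*g6^2 - g3*g6^2 - g3*g5*g6 - g3*g4*g6 - g3^2*g6 - g4*g6^3 + g3*g6^3 - g3*g5*g6^2 - g3*g4*g6^2 - g3^2*g6^2)) * r5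
  · linear_combination (t^2*k*l^3*(g4 + g4*g6 - g2*g6 + g2*g4)
      + t*k^2*s*l^2*(-2*g3 - g2 - 2*g3*g6 + g2*g6 - 2*g2*g3 + g1*g6 - g1*g2)
      + t*k^2*l^3*(-g4 - g4*g6 + g2*g6 - g2*g4 - 2*g2*g3 - g2^2 - 2*g2*g3*g6 + g2^2*g6 - 2*g2^2*g3 + g1*g2*g6 - g1*g2^2)
      + k^3*s*l^2*(-g3 - g5*g6 + g4*g6 + 2*g3*g6 - g3*g4 - 2*g3^2 + g1*g5 - 3*g1*g3 - g1*g2 - 2*g5*g6^2 + g4*g6^2 + 2*g3*g6^2 + 2*g3*g5*g6 - 2*g3^2*g6 - g3^2*g4 - g2*g6^2 + 2*g2*g3*g6 - g2*g3^2 - 2*g1*g3*g6 + g1*g2*g6 - 2*g1*g2*g3 + g1^2*g6 - g1^2*g2)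
      + k^3*l^3*(-g3*g4 - g3^2 - g5*g6^2 + g4*g6^2 + 2*g3*g6^2 - 2*g3*g4*g6 - 3*g3^2*g6 - g3^2*g4 + 3*g2*g3*g6 - g2*g3*g4 - 2*g2*g3^2 + g1*g5*g6 - g1*g3*g6 - 2*g1*g2*g3 - g1*g2^2 - 2*g5*g6^3 + g4*g6^3 + 2*g3*g6^3 + g3*g5*g6^2 - 2*g3^2*g6^2 - 2*g3^2*g4*g6 - g2*g6^3 + 4*g2*g3*g6^2 - 2*g2*g3^2*g6 - g2*g3^2*g4 - g2^2*g6^2 + 2*g2^2*g3*g6 - g2^2*g3^2 + g1*g5*g6^2 - g1*g3*g6^2 - 2*g1*g2*g3*g6 + g1*g2^2*g6 - 2*g1*g2^2*g3 + g1^2*g2*g6 - g1^2*g2^2)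
      + k^3*s^2*l*(g3 + g3*g5 - g1*g5 + g1*g3)) * r1
    + (t*k^2*s*l^2*(-g6 - g2 - g6^2)
      + t*k^2*l^3*(-g2*g6 - g2*g6^2)
      + k^3*s*l^2*(-g4 - g3 + g2 + g6^2 - 3*g4*g6 - 3*g3*g6 - g3*g4 + g2*g6 - 2*g1*g6 + 2*g6^3 - 2*g4*g6^2 - 2*g3*g6^2 - 2*g3*g4*g6 - g1*g6^2)
      + k^3*l^3*(-g4*g6 - g3*g6 + g2*g6 + g6^3 - 3*g4*g6^2 - 3*g3*g6^2 - g3*g4*g6 + 2*g2*g6^2 - g1*g6^2 + 2*g6^4 - 2*g4*g6^3 - 2*g3*g6^3 - 2*g3*g4*g6^2 + g2*g6^3 - g1*g6^3)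
      + t*k^2*s^3*(1)
      + t*k^2*s^2*l*(-1 + g2)
      + k^3*s^3*(g1)
      + k^3*s^2*l*(-g2 - g1 - g2*g6 + g1*g6)) * r2
    + (t*k^2*s*l^2*(g6 - g4 - g3 + g6^2 - g4*g6 - g3*g6 + 2*g2*g6 - g2*g4 - g2*g3)
      + t*k^2*l^3*(-g4*g6 + g4^2 + g2*g6 - g2*g4 - g2*g3 - g4*g6^2 + g4^2*g6 + 2*g2*g6^2 - 3*g2*g4*g6 + g2*g4^2 - g2*g3*g6 + 2*g2^2*g6 - g2^2*g4 - g2^2*g3)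
      + k^3*s*l^2*(-g5 + g4 + g3 - g6^2 - 2*g5*g6 + 3*g4*g6 - g4*g5 + 3*g3*g6 - 2*g2*g6 + g2*g4 + g2*g3 + g1*g6 - g1*g5 - 2*g6^3 + 3*g4*g6^2 - 2*g4*g5*g6 + 2*g3*g6^2 - 2*g2*g6^2 + g2*g4*g6 + g2*g3*g6 + 2*g1*g6^2 - 2*g1*g5*g6)
      + k^3*l^3*(-g5*g6 + 2*g4*g6 - g4^2 + g3*g6 - g2*g6 + g2*g4 + g2*g3 - g6^3 - 2*g5*g6^2 + 5*g4*g6^2 - g4*g5*g6 - 2*g4^2*g6 + 3*g3*g6^2 - 5*g2*g6^2 + 5*g2*g4*g6 - g2*g4^2 + 3*g2*g3*g6 - 2*g2^2*g6 + g2^2*g4 + g2^2*g3 + g1*g6^2 - g1*g5*g6 - 2*g6^4 + 4*g4*g6^3 - 2*g4*g5*g6^2 - g4^2*g6^2 + 2*g3*g6^3 - 4*g2*g6^3 + 4*g2*g4*g6^2 - g2*g4^2*g6 + 2*g2*g3*g6^2 - 2*g2^2*g6^2 + g2^2*g4*g6 + g2^2*g3*g6 + 2*g1*g6^3 - 2*g1*g5*g6^2))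 * r3
    + (t^3*s*l^2*(1)
      + t^2*k*s*l^2*(-1 + g1)
      + t^3*l^3*(g2)
      + t^2*k*l^3*(-2*g2 - g2*g6 + g1*g6)
      + t*k^2*s*l^2*(-g1 - g3*g6 + g3*g4 + g2*g6 - g2*g4)
      + t*k^2*l^3*(g2 + g3*g6 - g3*g4 + g2*g6 - g1*g6 + g3*g4*g6 - g3*g4^2 - g2*g4*g6 + g2*g4^2 + g2^2*g6 - g2^2*g4)
      + k^3*s*l^2*(-g5 - 3*g5*g6 + g4*g6 - g4*g5 + g3*g6 + g3*g5 - g3*g4 - g2*g6 + g2*g4 - g1*g5 - 2*g5*g6^2 + 2*g4*g6^2 - 2*g4*g5*g6 + 2*g3*g5*g6 - g3*g4*g6 - g2*g6^2 + g2*g4*g6 + g1*g6^2 - 2*g1*g5*g6)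
      + k^3*l^3*(-g5*g6 - g3*g6 + g3*g4 - 3*g5*g6^2 + g4*g6^2 - g4*g5*g6 + g3*g5*g6 - g3*g4*g6 + g3*g4^2 - g2*g6^2 + 2*g2*g4*g6 - g2*g4^2 - g2^2*g6 + g2^2*g4 - g1*g5*g6 - 2*g5*g6^3 + 2*g4*g6^3 - 2*g4*g5*g6^2 + 2*g3*g5*g6^2 - 2*g3*g4*g6^2 + g3*g4^2*g6 - g2*g6^3 + 2*g2*g4*g6^2 - g2*g4^2*g6 - g2^2*g6^2 + g2^2*g4*g6 + g1*g6^3 - 2*g1*g5*g6^2)) * r4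
    + (k^3*s*l^2*(g4 + g3 + 3*g4*g6 + g3*g6 + g3*g4 + g3^2 + 2*g4*g6^2 - 2*g3*g6^2 + 2*g3*g4*g6 + 2*g3^2*g6)
      + k^3*l^3*(g4*g6 + g3*g6 + 3*g4*g6^2 + g3*g6^2 + g3*g4*g6 + g3^2*g6 + 2*g4*g6^3 - 2*g3*g6^3 + 2*g3*g4*g6^2 + 2*g3^2*g6^2)) * r5
  · linear_combination (t^2*k*s*l^2*(g6 - g4)
      + t*k^2*s*l^2*(g4*g6 - g4^2 + g1*g6 - g1*g4)
      + t^2*k*l^3*(g2*g6 - g2*g4)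
      + t*k^2*l^3*(g5*g6 + g4*g6 - g4*g5 - g4^2 + g3*g6 - g3*g4 + g5*g6^2 + g4*g6^2 - g4^2*g6 - g4^2*g5 - g3*g6^2 + 2*g3*g4*g6 - g3*g4^2 - g2*g6^2 + g2*g4*g6 + 2*g2*g3*g6 - 2*g2*g3*g4 + g1*g2*g6 - g1*g2*g4)
      + k^3*s*l^2*(g5*g6 - g4*g5 - g4^2 + g3*g4 + 2*g5*g6^2 - g4^2*g6 - 2*g4^2*g5 - 2*g3*g6^2 - 2*g3*g5*g6 + 3*g3*g4*g6 + 2*g3*g4*g5 + g3^2*g6 - g3^2*g4 + g1*g3*g6 - g1*g3*g4)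
      + k^3*l^3*(g5*g6^2 - g4*g5*g6 - g4^2*g6 + g3*g5*g6 + 2*g3*g4*g6 - g3*g4*g5 - g3*g4^2 + g3^2*g6 - g3^2*g4 + 2*g5*g6^3 - g4^2*g6^2 - 2*g4^2*g5*g6 - 2*g3*g6^3 - g3*g5*g6^2 + 3*g3*g4*g6^2 + 2*g3*g4*g5*g6 - g3*g4^2*g5 + g3^2*g6^2 - g3^2*g4^2 - g2*g3*g6^2 + g2*g3*g4*g6 + g2*g3^2*g6 - g2*g3^2*g4 + g1*g2*g3*g6 - g1*g2*g3*g4)) * r1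
    + (t*k^2*s*l^2*(-g6 + g4 - g6^2 + g4^2)
      + t*k^2*l^3*(-g6^2 + g4*g6 - g6^3 + g4^2*g6)
      + k^3*s*l^2*(g4 - g6^2 + 4*g4*g6 + g3*g6 - g3*g4 - 2*g6^3 + 2*g4*g6^2 + 2*g4^2*g6 + g3*g6^2 - g3*g4^2)
      + k^3*l^3*(g4*g6 - g6^3 + 4*g4*g6^2 + g3*g6^2 - g3*g4*g6 - 2*g6^4 + 2*g4*g6^3 + 2*g4^2*g6^2 + g3*g6^3 - g3*g4^2*g6)) * r2
    + (t^2*k*s*l^2*(g6 - g4)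
      + t*k^2*s*l^2*(g6 - g4 + g6^2 - g4*g6 + g3*g6 - g3*g4 + 2*g1*g6 - 2*g1*g4)
      + t^2*k*l^3*(g2*g6 - g2*g4)
      + t*k^2*l^3*(g6^2 - g4^2 - g2*g6 + g2*g4 + g6^3 - g4^2*g6 - 2*g2*g6^2 + 3*g2*g4*g6 - g2*g4^2 + g2*g3*g6 - g2*g3*g4 + 2*g1*g6^2 - 2*g1*g4*g6)
      + k^3*s*l^2*(-g4 + g6^2 + g5*g6 - 3*g4*g6 - g4*g5 - g3*g6 + g3*g4 - g1*g4 + 2*g6^3 - 3*g4*g6^2 - g3*g6^2 + g3*g4*g6 + g1*g6^2 + 2*g1*g5*g6 - 2*g1*g4*g6 - 2*g1*g4*g5)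
      + k^3*l^3*(-2*g4*g6 + g4^2 + g6^3 + g5*g6^2 - 5*g4*g6^2 - g4*g5*g6 + 2*g4^2*g6 - g3*g6^2 + g3*g4*g6 + g2*g6^2 - 2*g2*g4*g6 + g2*g4^2 - g2*g3*g6 + g2*g3*g4 - g1*g4*g6 + 2*g6^4 - 4*g4*g6^3 + g4^2*g6^2 - g3*g6^3 + g3*g4*g6^2 + g2*g6^3 - 2*g2*g4*g6^2 + g2*g4^2*g6 - g2*g3*g6^2 + g2*g3*g4*g6 + g1*g6^3 + 2*g1*g5*g6^2 - 2*g1*g4*g6^2 - 2*g1*g4*g5*g6)) * r3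
    + (t^2*k*s*l^2*(g6 - g4)
      + t*k^2*s*l^2*(g3*g6 - g3*g4 + g1*g6 - g1*g4)
      + t^2*k*l^3*(-g5 - g5*g6 + g4*g6 - g4*g5 + g2*g6 - g2*g4)
      + t*k^2*l^3*(g5 + 2*g5*g6 - g4*g6 + g4*g5 - g3*g6 - g3*g5 + g3*g4 - g2*g6 + g2*g4 + g5*g6^2 - g4*g6^2 + g4*g5*g6 - g3*g5*g6 - g3*g4*g5 + g3*g4^2 - g2*g6^2 + 2*g2*g4*g6 - g2*g4^2 + g1*g6^2 - g1*g4*g6)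
      + k^3*s*l^2*(g5 + 3*g5*g6 - g4*g6 + g4*g5 - g3*g6 - g3*g5 + g3*g4 + g1*g5 + 2*g5*g6^2 - 2*g4*g6^2 + 2*g4*g5*g6 - 2*g3*g5*g6 + g3*g4*g6 + 2*g1*g5*g6 - g1*g4*g6)
      + k^3*l^3*(g5*g6 + g3*g6 + g3*g5 - g3*g4 + 3*g5*g6^2 - g4*g6^2 + g4*g5*g6 + g3*g5*g6 + g3*g4*g5 - g3*g4^2 - g2*g4*g6 + g2*g4^2 + g1*g5*g6 + 2*g5*g6^3 - 2*g4*g6^3 + 2*g4*g5*g6^2 - g3*g5*g6^2 + g3*g4*g6^2 + g3*g4*g5*g6 - g3*g4^2*g6 - g2*g4*g6^2 + g2*g4^2*g6 + 2*g1*g5*g6^2 - g1*g4*g6^2)) * r4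
    + (t^2*k*s*l^2*(g6 - g4)
      + t*k^2*s*l^2*(2*g3*g6 - 2*g3*g4)
      + t^2*k*l^3*(g4 + g4*g6)
      + t*k^2*l^3*(-g4 - 2*g4*g6 + g3*g4 - g4*g6^2 + g3*g6^2)
      + k^3*s*l^2*(-g4 - 3*g4*g6 - g3*g6 + g3*g4 - 2*g4*g6^2 + 2*g3*g6^2 - 2*g3*g4*g6 - g3^2*g6 + g3^2*g4)
      + k^3*l^3*(-g4*g6 - g3*g4 - 3*g4*g6^2 - g3*g6^2 - g3*g4*g6 - 2*g4*g6^3 + 2*g3*g6^3 - 3*g3*g4*g6^2 - g3^2*g6^2 + g3^2*g4*g6)) * r5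
  · linear_combination (t^2*k*s^2*l*(1)
      + t*k^2*s^2*l*(g4 + g1)
      + t^2*k*s*l^2*(g5 + g4 - g3 + g2)
      + t*k^2*s*l^2*(g4 + 2*g3 + g5*g6 + g4*g6 + g4*g5 + g4^2 - g3*g6 + g3*g4 - g2*g6 + 2*g2*g3 + g1*g4 + g1*g2)
      + k^3*s^2*l*(g5*g6 + g4*g5 - g3*g6 - 2*g3*g5 + g3^2 + g1*g3)
      + k^3*s*l^2*(-2*g5*g6 + g4*g5 + g4^2 + g3*g6 + g3*g5 + g3^2 - g5*g6^2 + 2*g4*g5*g6 + g4^2*g6 + 2*g4^2*g5 + g3*g6^2 - g3*g5*g6 - 3*g3*g4*g6 - g3*g4*g5 + g3^2*g6 + 2*g3^2*g4 - g2*g3*g6 + g2*g3^2 + g1*g3*g4 + g1*g2*g3)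
      + t^2*k*l^3*(g5*g6 - g3*g6 + g2*g4)
      + t*k^2*l^3*(-g5*g6 + g4*g5 + g4^2 + g3*g6 + g3*g4 + g4*g5*g6 + g4^2*g6 + g4^2*g5 - g3*g4*g6 + g3*g4^2 - g2*g4*g6 + 2*g2*g3*g4 + g1*g2*g4)
      + k^3*l^3*(-2*g5*g6^2 + g4*g5*g6 + g4^2*g6 + g3*g6^2 - g3*g4*g6 + g3*g4*g5 + g3*g4^2 + g3^2*g4 - 2*g5*g6^3 + g4*g5*g6^2 + g4^2*g6^2 + 2*g4^2*g5*g6 + 2*g3*g6^3 - 3*g3*g4*g6^2 - g3*g4*g5*g6 + g3*g4^2*g5 + g3^2*g4*g6 + g3^2*g4^2 - g2*g3*g4*g6 + g2*g3^2*g4 + g1*g2*g3*g4)) * r1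
    + (t*k^2*s^2*l*(-1 - g6 - g4)
      + t^2*k*s*l^2*(-g6 + g2)
      + t*k^2*s*l^2*(-g4 - g2 - g6^2 - 2*g4*g6 - g4^2)
      + k^3*s^2*l*(g4 + g3 - g6^2 + g3*g6 + g3*g4)
      + k^3*s*l^2*(-g4 + 2*g6^2 - 2*g4*g6 + g3*g6 + g3*g4 - g2*g6 + g6^3 - 2*g4*g6^2 - 2*g4^2*g6 + g3*g6^2 + 2*g3*g4*g6 + g3*g4^2 - g2*g6^2)
      + t^2*k*l^3*(-g6^2 + g2*g6)
      + t*k^2*l^3*(g6^2 - g4*g6 - g2*g6 - g4*g6^2 - g4^2*g6)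
      + k^3*l^3*(-g4*g6 + 2*g6^3 - 3*g4*g6^2 + g3*g4*g6 - g2*g6^2 + 2*g6^4 - 2*g4*g6^3 - 2*g4^2*g6^2 + g3*g4*g6^2 + g3*g4^2*g6 - g2*g6^3)) * r2
    + (t^2*k*s^2*l*(1)
      + t*k^2*s^2*l*(1 + g6 + g3 + 2*g1)
      + t^2*k*s*l^2*(g6 - g5 + g4 + g2)
      + t*k^2*s*l^2*(2*g5 + 2*g4 - g2 + g6^2 + g5*g6 + g4*g6 + g4*g5 + g3*g4 - 2*g2*g6 + g2*g4 + g2*g3 + 2*g1*g6 + 2*g1*g4)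
      + k^3*s^2*l*(2*g5 - g3 + g6^2 + g5*g6 - g4*g6 + g4*g5 - g3*g6 + 2*g1*g5)
      + k^3*s*l^2*(-g5 - 2*g6^2 + 2*g5*g6 + 2*g4*g6 - g3*g6 - g3*g4 + g2*g6 - g2*g4 - g2*g3 + g1*g4 - g6^3 + 2*g5*g6^2 + g4*g6^2 + g4*g5*g6 - g3*g6^2 - g3*g4*g6 + g2*g6^2 - g2*g4*g6 - g2*g3*g6 - g1*g6^2 + 2*g1*g5*g6 + 2*g1*g4*g6 + 2*g1*g4*g5)
      + t^2*k*l^3*(g6^2 - g5*g6 + g2*g4)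
      + t*k^2*l^3*(-g6^2 + 2*g5*g6 + g4*g6 + g4^2 - g2*g4 + g5*g6^2 + g4*g5*g6 + g4^2*g6 - 2*g2*g4*g6 + g2*g4^2 + g2*g3*g4 + 2*g1*g4*g6)
      + k^3*l^3*(-g5*g6 + g4*g6 - g4^2 - 2*g6^3 + 4*g4*g6^2 - 2*g4^2*g6 - g3*g4*g6 + g2*g4*g6 - g2*g4^2 - g2*g3*g4 + g1*g4*g6 - 2*g6^4 + g5*g6^3 + 3*g4*g6^3 - g4^2*g6^2 - g3*g4*g6^2 + g2*g4*g6^2 - g2*g4^2*g6 - g2*g3*g4*g6 - g1*g6^3 + 2*g1*g4*g6^2 + 2*g1*g4*g5*g6)) * r3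
    + (t^2*k*s^2*l*(1)
      + t*k^2*s^2*l*(g3 + g1)
      + t^2*k*s*l^2*(g4 + g2)
      + t*k^2*s*l^2*(g5 - g3 - g2 + g5*g6 - g4*g6 + g4*g5 - g2*g6 + g2*g4 + g1*g6 + g1*g4)
      + k^3*s^2*l*(g5 - g3 + g5*g6 - g4*g6 + g4*g5 - g3*g5 + g1*g5)
      + k^3*s*l^2*(-2*g5 + g3 - 3*g5*g6 + 2*g4*g6 - 2*g4*g5 + g3*g5 - g2*g4 - g1*g5 - g5*g6^2 + g4*g6^2 - g4*g5*g6 - g2*g4*g6 + g1*g4*g6)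
      + t^2*k*l^3*(g5 + g5*g6 - g4*g6 + g4*g5 + g2*g4)
      + t*k^2*l^3*(-g5 - g5*g6 + g4*g6 - g4*g5 + g3*g5 - g3*g4 - g2*g4 + g3*g5*g6 - g3*g4*g6 + g3*g4*g5 - g3*g4^2 - g2*g4*g6 + g2*g4^2 + g1*g4*g6)
      + k^3*l^3*(-2*g5*g6 - g3*g5 + g3*g4 - 4*g5*g6^2 + 2*g4*g6^2 - 2*g4*g5*g6 - g3*g5*g6 + g3*g4*g6 - g3*g4*g5 + g3*g4^2 - g2*g4^2 - g1*g5*g6 - 2*g5*g6^3 + 2*g4*g6^3 - 2*g4*g5*g6^2 - g3*g4*g5*g6 + g3*g4^2*g6 - g2*g4^2*g6 - g1*g5*g6^2 + g1*g4*g6^2)) * r4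
    + (t^2*k*s^2*l*(1)
      + t*k^2*s^2*l*(2*g3)
      + t^2*k*s*l^2*(g4 + g3)
      + t*k^2*s*l^2*(-g4 - 2*g3 - g4*g6 + g3*g6 + g3*g4)
      + k^3*s^2*l*(-g4 - 2*g3 - g4*g6 + g3*g6 - g3*g4 - g3^2)
      + k^3*s*l^2*(2*g4 + g3 + 3*g4*g6 - 3*g3*g6 + g4*g6^2 - g3*g6^2 + g3*g4*g6 - g3^2*g6 - g3^2*g4)
      + t^2*k*l^3*(-g4 - g4*g6 + g3*g6)
      + t*k^2*l^3*(g4 + g4*g6 - 2*g3*g6 - g3*g4 - g3*g4*g6)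
      + k^3*l^3*(2*g4*g6 + g3*g6 + g3*g4 + 4*g4*g6^2 - g3*g6^2 + 2*g3*g4*g6 + 2*g4*g6^3 - 2*g3*g6^3 + 3*g3*g4*g6^2 - g3^2*g4*g6)) * r5
  · ring
  · ring
  · ring
  · linear_combination (t^2*k*s^2*l*(-1)
      + t^2*k*s*l^2*(-g6 - g4)
      + t*k^2*s^2*l*(-g5 - g3)
      + t*k^2*s*l^2*(-g5*g6 - g4*g5 - g3*g6 - g3*g4)
      + t^2*k*l^3*(-g4*g6)
      + t*k^2*l^3*(-g4*g5*g6 - g3*g4*g6)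
      + k^3*s^2*l*(-g3*g5)
      + k^3*s*l^2*(-g3*g5*g6 - g3*g4*g5)
      + k^3*l^3*(-g3*g4*g5*g6)) * r1
    + (t^2*k*s^2*l*(-1)
      + t^2*k*s*l^2*(-g6 - g4)
      + t*k^2*s^2*l*(-g5 - g3)
      + t*k^2*s*l^2*(-g5*g6 - g4*g5 - g3*g6 - g3*g4)
      + t^2*k*l^3*(-g4*g6)
      + t*k^2*l^3*(-g4*g5*g6 - g3*g4*g6)
      + k^3*s^2*l*(-g3*g5)
      + k^3*s*l^2*(-g3*g5*g6 - g3*g4*g5)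
      + k^3*l^3*(-g3*g4*g5*g6)) * r3
    + (t^2*k*s^2*l*(-1)
      + t^2*k*s*l^2*(-g6 - g4)
      + t*k^2*s^2*l*(-g5 - g3)
      + t*k^2*s*l^2*(-g5*g6 - g4*g5 - g3*g6 - g3*g4)
      + t^2*k*l^3*(-g4*g6)
      + t*k^2*l^3*(-g4*g5*g6 - g3*g4*g6)
      + k^3*s^2*l*(-g3*g5)
      + k^3*s*l^2*(-g3*g5*g6 - g3*g4*g5)
      + k^3*l^3*(-g3*g4*g5*g6)) * r4
    + (t^2*k*s^2*l*(-1)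
      + t^2*k*s*l^2*(-g6 - g4)
      + t*k^2*s^2*l*(-g5 - g3)
      + t*k^2*s*l^2*(-g5*g6 - g4*g5 - g3*g6 - g3*g4)
      + t^2*k*l^3*(-g4*g6)
      + t*k^2*l^3*(-g4*g5*g6 - g3*g4*g6)
      + k^3*s^2*l*(-g3*g5)
      + k^3*s*l^2*(-g3*g5*g6 - g3*g4*g5)
      + k^3*l^3*(-g3*g4*g5*g6)) * r5
  · linear_combination (t*k^2*s^2*l*(-g4 + 2*g3 - g1)
      + t*k^2*s*l^2*(-g4*g6 - g4^2 + 2*g3*g6 + 2*g3*g4 - g1*g6 - g1*g4)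
      + k^3*s^2*l*(-g4*g5 + 2*g3*g5 - g1*g5)
      + k^3*s*l^2*(g5*g6 - g4*g5 - g4^2 + g3*g4 + g5*g6^2 - g4*g5*g6 - g4^2*g6 - 2*g4^2*g5 - g3*g6^2 + 2*g3*g5*g6 + 2*g3*g4*g6 + 2*g3*g4*g5 - g1*g5*g6 - g1*g4*g5)
      + t*k^2*l^3*(-g4^2*g6 + 2*g3*g4*g6 - g1*g4*g6)
      + k^3*l^3*(g5*g6^2 - g4*g5*g6 - g4^2*g6 + g3*g4*g6 + g5*g6^3 - g4^2*g6^2 - 2*g4^2*g5*g6 - g3*g6^3 + 2*g3*g4*g6^2 + 2*g3*g4*g5*g6 - g1*g4*g5*g6)) * r1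
    + (t*k^2*s^2*l*(1 + g6 + g4)
      + t*k^2*s*l^2*(g6 + g4 + g6^2 + 2*g4*g6 + g4^2)
      + k^3*s^2*l*(g5 + g5*g6 + g4*g5)
      + k^3*s*l^2*(g4 - g6^2 + g5*g6 + 3*g4*g6 + g4*g5 + g4^2 - g6^3 + g5*g6^2 + g4*g6^2 + 2*g4*g5*g6 + 2*g4^2*g6 + g4^2*g5)
      + t*k^2*l^3*(g4*g6 + g4*g6^2 + g4^2*g6)
      + k^3*l^3*(g4*g6 - g6^3 + 3*g4*g6^2 + g4*g5*g6 + g4^2*g6 - g6^4 + g4*g6^3 + g4*g5*g6^2 + 2*g4^2*g6^2 + g4^2*g5*g6)) * r2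
    + (t*k^2*s^2*l*(-1 - g6 + g3 - 2*g1)
      + t*k^2*s*l^2*(-g6 - g4 - g6^2 - g4*g6 + g3*g6 + g3*g4 - 2*g1*g6 - 2*g1*g4)
      + k^3*s^2*l*(-g5 - g5*g6 + g3*g5 - 2*g1*g5)
      + k^3*s*l^2*(-g4 + g6^2 - g5*g6 - 3*g4*g6 - g4*g5 - g1*g4 + g6^3 - g5*g6^2 - 2*g4*g6^2 - g4*g5*g6 + g3*g5*g6 + g3*g4*g5 + g1*g6^2 - 2*g1*g5*g6 - 2*g1*g4*g6 - 2*g1*g4*g5)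
      + t*k^2*l^3*(-g4*g6 - g4*g6^2 + g3*g4*g6 - 2*g1*g4*g6)
      + k^3*l^3*(-g4*g6 + g6^3 - 3*g4*g6^2 - g4*g5*g6 - g1*g4*g6 + g6^4 - 2*g4*g6^3 - g4*g5*g6^2 + g3*g4*g5*g6 + g1*g6^3 - 2*g1*g4*g6^2 - 2*g1*g4*g5*g6)) * r3
    + (t*k^2*s^2*l*(g3 - g1)
      + t*k^2*s*l^2*(g3*g6 + g3*g4 - g1*g6 - g1*g4)
      + k^3*s^2*l*(g3*g5 - g1*g5)
      + k^3*s*l^2*(g5 + 2*g5*g6 - g4*g6 + g4*g5 + g1*g5 + g5*g6^2 - g4*g6^2 + g4*g5*g6 + g3*g5*g6 + g3*g4*g5 - g1*g4*g6)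
      + t*k^2*l^3*(g3*g4*g6 - g1*g4*g6)
      + k^3*l^3*(g5*g6 + 2*g5*g6^2 - g4*g6^2 + g4*g5*g6 + g1*g5*g6 + g5*g6^3 - g4*g6^3 + g4*g5*g6^2 + g3*g4*g5*g6 + g1*g5*g6^2 - g1*g4*g6^2)) * r4
    + (k^3*s*l^2*(-g4 - 2*g4*g6 - g3*g4 - g4*g6^2 + g3*g6^2 - 2*g3*g4*g6)
      + k^3*l^3*(-g4*g6 - 2*g4*g6^2 - g3*g4*g6 - g4*g6^3 + g3*g6^3 - 2*g3*g4*g6^2)) * r5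
  · linear_combination (t*k^2*s*l^2*(-g4*g6 + g4^2 + 2*g3*g6 - 2*g3*g4 - g1*g6 + g1*g4)
      + t*k^2*l^3*(-g4*g6^2 + g4^2*g6 + 2*g3*g6^2 - 2*g3*g4*g6 - g1*g6^2 + g1*g4*g6)
      + k^3*s*l^2*(-g5*g6 + g4*g5 + g4^2 - g3*g4 - g5*g6^2 - g4*g5*g6 + g4^2*g6 + 2*g4^2*g5 + g3*g6^2 + 2*g3*g5*g6 - 2*g3*g4*g6 - 2*g3*g4*g5 - g1*g5*g6 + g1*g4*g5)
      + k^3*l^3*(-g5*g6^2 + g4*g5*g6 + g4^2*g6 - g3*g4*g6 - g5*g6^3 - g4*g5*g6^2 + g4^2*g6^2 + 2*g4^2*g5*g6 + g3*g6^3 + 2*g3*g5*g6^2 - 2*g3*g4*g6^2 - 2*g3*g4*g5*g6 - g1*g5*g6^2 + g1*g4*g5*g6)) * r1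
    + (t*k^2*s*l^2*(3*g6 - g4 + 2*g6^2 - g4^2)
      + t*k^2*s^3*(-1)
      + t*k^2*s^2*l*(1 - g6)
      + t*k^2*l^3*(2*g6^2 - g4*g6 + 2*g6^3 - g4^2*g6)
      + k^3*s*l^2*(-g4 + g6^2 + 3*g5*g6 - 3*g4*g6 - g4*g5 - g4^2 + g6^3 + 2*g5*g6^2 - g4*g6^2 - 2*g4^2*g6 - g4^2*g5)
      + k^3*s^3*(-g5)
      + k^3*s^2*l*(g5 - g5*g6)
      + k^3*l^3*(-g4*g6 + g6^3 + 2*g5*g6^2 - 3*g4*g6^2 - g4*g5*g6 - g4^2*g6 + g6^4 + 2*g5*g6^3 - g4*g6^3 - 2*g4^2*g6^2 - g4^2*g5*g6)) * r2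
    + (t*k^2*s*l^2*(-2*g6 + 2*g4 - 2*g6^2 + 2*g4*g6 - 2*g1*g6 + 2*g1*g4)
      + t*k^2*l^3*(-2*g6^2 + 2*g4*g6 - 2*g6^3 + 2*g4*g6^2 - 2*g1*g6^2 + 2*g1*g4*g6)
      + k^3*s*l^2*(g4 - g6^2 - 2*g5*g6 + 3*g4*g6 + 2*g4*g5 + g1*g4 - g6^3 - 2*g5*g6^2 + 2*g4*g6^2 + 2*g4*g5*g6 - g1*g6^2 - 2*g1*g5*g6 + 2*g1*g4*g6 + 2*g1*g4*g5)
      + k^3*l^3*(g4*g6 - g6^3 - 2*g5*g6^2 + 3*g4*g6^2 + 2*g4*g5*g6 + g1*g4*g6 - g6^4 - 2*g5*g6^3 + 2*g4*g6^3 + 2*g4*g5*g6^2 - g1*g6^3 - 2*g1*g5*g6^2 + 2*g1*g4*g6^2 + 2*g1*g4*g5*g6)) * r3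
    + (t^3*s*l^2*(-1)
      + t^2*k*s*l^2*(1 - g5)
      + t*k^2*s*l^2*(g5 + g4 + g4*g6 - g1*g6 + g1*g4)
      + t^3*l^3*(-g6)
      + t^2*k*l^3*(g6 - g5*g6)
      + t*k^2*l^3*(g5*g6 + g4*g6 + g4*g6^2 - g1*g6^2 + g1*g4*g6)
      + k^3*s*l^2*(-g5 - 2*g5*g6 + g4*g6 - g1*g5 - g5*g6^2 + g4*g6^2 - 2*g1*g5*g6 + g1*g4*g6)
      + k^3*l^3*(-g5*g6 - 2*g5*g6^2 + g4*g6^2 - g1*g5*g6 - g5*g6^3 + g4*g6^3 - 2*g1*g5*g6^2 + g1*g4*g6^2)) * r4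
    + (t*k^2*s*l^2*(g5 + 2*g4 + g5*g6 + g4*g6 + g4*g5 - 2*g3*g6 + 2*g3*g4)
      + t*k^2*l^3*(g5*g6 + 2*g4*g6 + g5*g6^2 + g4*g6^2 + g4*g5*g6 - 2*g3*g6^2 + 2*g3*g4*g6)
      + k^3*s*l^2*(g4 + g5^2 + 2*g4*g6 + 2*g4*g5 + g3*g4 + g5^2*g6 + g4*g6^2 + g4*g5*g6 + g4*g5^2 - g3*g6^2 - 2*g3*g5*g6 + 2*g3*g4*g6 + 2*g3*g4*g5)
      + k^3*l^3*(g4*g6 + g5^2*g6 + 2*g4*g6^2 + 2*g4*g5*g6 + g3*g4*g6 + g5^2*g6^2 + g4*g6^3 + g4*g5*g6^2 + g4*g5^2*g6 - g3*g6^3 - 2*g3*g5*g6^2 + 2*g3*g4*g6^2 + 2*g3*g4*g5*g6)) * r5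
  · linear_combination (t^2*k*s*l^2*(-g5 + g4 + g3 - g2)
      + t^2*k*l^3*(-g5*g6 + g4*g6 + g3*g6 - g2*g6)
      + t*k^2*s*l^2*(g5 - g4 - g3 + g2)
      + t*k^2*l^3*(g5*g6 - g4*g6 - g3*g6 + g2*g6)
      + k^3*s*l^2*(g5*g6 - g4*g6 - 2*g3*g6 - g3*g5 + g1*g5 + g1*g3 + g1*g2 + g5*g6^2 - g4*g6^2 - g3*g6^2 - 2*g3*g5*g6 + g2*g6^2 - g2*g3*g6 + 2*g1*g5*g6 + g1*g3*g6 - g1*g2*g6 + g1*g2*g3 - g1^2*g6 + g1^2*g2)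
      + k^3*l^3*(g5*g6^2 - g4*g6^2 - 2*g3*g6^2 - g3*g5*g6 + g1*g5*g6 + g1*g3*g6 + g1*g2*g6 + g5*g6^3 - g4*g6^3 - g3*g6^3 - 2*g3*g5*g6^2 + g2*g6^3 - g2*g3*g6^2 + 2*g1*g5*g6^2 + g1*g3*g6^2 - g1*g2*g6^2 + g1*g2*g3*g6 - g1^2*g6^2 + g1^2*g2*g6)) * r1
    + (t^2*k*s*l^2*(g6 - g2)
      + t^2*k*l^3*(g6^2 - g2*g6)
      + t*k^2*s*l^2*(-g6 + g2)
      + t*k^2*l^3*(-g6^2 + g2*g6)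
      + k^3*s^3*(g5 - g1)
      + k^3*s^2*l*(-g5 + g1 + g5*g6 - g1*g6)
      + k^3*s*l^2*(-g5 - g6^2 - 5*g5*g6 + g4*g6 - g4*g5 + g2*g6 + 2*g1*g6 - g6^3 - 3*g5*g6^2 + 2*g4*g6^2 - 2*g4*g5*g6 + g2*g6^2 + g1*g6^2)
      + k^3*l^3*(-g5*g6 - g6^3 - 4*g5*g6^2 + g4*g6^2 - g4*g5*g6 + g2*g6^2 + g1*g6^2 - g6^4 - 3*g5*g6^3 + 2*g4*g6^3 - 2*g4*g5*g6^2 + g2*g6^3 + g1*g6^3)) * r2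
    + (t^2*k*s*l^2*(-g6 + g5 + g4 - g2)
      + t^2*k*l^3*(-g6^2 + g5*g6 + g4*g6 - g2*g6)
      + t*k^2*s*l^2*(g6 - g5 - g4 + g2)
      + t*k^2*l^3*(g6^2 - g5*g6 - g4*g6 + g2*g6)
      + k^3*s*l^2*(g5 + g6^2 + 2*g5*g6 - g4*g6 + g2*g6 - g1*g6 + g1*g5 + g6^3 + g5*g6^2 - g4*g6^2 + g2*g6^2 - 2*g1*g6^2 + 2*g1*g5*g6)
      + k^3*l^3*(g5*g6 + g6^3 + 2*g5*g6^2 - g4*g6^2 + g2*g6^2 - g1*g6^2 + g1*g5*g6 + g6^4 + g5*g6^3 - g4*g6^3 + g2*g6^3 - 2*g1*g6^3 + 2*g1*g5*g6^2)) * r3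
    + (t^2*k*s*l^2*(g5 + g4 - g2 - g1)
      + t^2*k*l^3*(g5*g6 + g4*g6 - g2*g6 - g1*g6)
      + t*k^2*s*l^2*(-g5 - g4 + g2 + g1)
      + t*k^2*l^3*(-g5*g6 - g4*g6 + g2*g6 + g1*g6)
      + k^3*s*l^2*(g5 + 2*g5*g6 - g4*g6 + g2*g6 + g1*g5 + g5*g6^2 - g4*g6^2 + g2*g6^2 - g1*g6^2 + 2*g1*g5*g6)
      + k^3*l^3*(g5*g6 + 2*g5*g6^2 - g4*g6^2 + g2*g6^2 + g1*g5*g6 + g5*g6^3 - g4*g6^3 + g2*g6^3 - g1*g6^3 + 2*g1*g5*g6^2)) * r4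
    + (t^2*k*s*l^2*(g4 - g3)
      + t^2*k*l^3*(g4*g6 - g3*g6)
      + t*k^2*s*l^2*(-g4 + g3)
      + t*k^2*l^3*(-g4*g6 + g3*g6)
      + k^3*s*l^2*(-g4 - g5^2 - 2*g4*g6 - 2*g4*g5 + 2*g3*g6 + g3*g5 - g3*g4 - g5^2*g6 - g4*g6^2 - g4*g5*g6 - g4*g5^2 + g3*g6^2 + 3*g3*g5*g6 - g3*g4*g6 - g3*g4*g5)
      + k^3*l^3*(-g4*g6 - g5^2*g6 - 2*g4*g6^2 - 2*g4*g5*g6 + 2*g3*g6^2 + g3*g5*g6 - g3*g4*g6 - g5^2*g6^2 - g4*g6^3 - g4*g5*g6^2 - g4*g5^2*g6 + g3*g6^3 + 3*g3*g5*g6^2 - g3*g4*g6^2 - g3*g4*g5*g6)) * r5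

end AW

namespace AW
open RootSystemData
variable {V : Type*} [NormedAddCommGroup V] [InnerProductSpace ℝ V]
variable {D : RootSystemData V} {cz : ℤ}

lemma P_sub {x y : V} (hx : x ∈ D.weightLattice) (hy : y ∈ D.weightLattice) :
    x - y ∈ D.weightLattice := by
  intro α hα
  obtain ⟨k, hk⟩ := hx α hα
  obtain ⟨l, hl⟩ := hy α hα
  exact ⟨k - l, by rw [inner_sub_left, hk, hl]; push_cast; ring⟩

lemma P_zsmul {x : V} (hx : x ∈ D.weightLattice) (n : ℤ) :
    n • x ∈ D.weightLattice := by
  intro α hα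
  obtain ⟨k, hk⟩ := hx α hα
  exact ⟨n * k, by
    rw [← Int.cast_smul_eq_zsmul ℝ n x, real_inner_smul_left, hk]; push_cast; ring⟩

lemma P_add {x y : V} (hx : x ∈ D.weightLattice) (hy : y ∈ D.weightLattice) :
    x + y ∈ D.weightLattice := by
  have := P_sub hx (P_zsmul hy (-1))
  simpa using this

lemma P_root {α : V} (hα : α ∈ D.R0) : α ∈ D.weightLattice :=
  fun β hβ => D.crystallographic β hβ α hα

lemma aval_int {a : V × ℤ} (ha : D.IsAffRoot a) {x : V} (hx : x ∈ D.weightLattice) :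
    ∃ k : ℤ, aval (cz : ℝ) a x = k := by
  obtain ⟨k, hk⟩ := hx a.1 ha
  exact ⟨k + a.2 * cz, by unfold aval; rw [hk]; push_cast; ring⟩

lemma P_sAff {a : V × ℤ} (ha : D.IsAffRoot a) {x : V} (hx : x ∈ D.weightLattice) :
    sAff (cz : ℝ) a x ∈ D.weightLattice := by
  obtain ⟨k, hk⟩ := aval_int (cz := cz) ha hx
  unfold sAff
  rw [hk, Int.cast_smul_eq_zsmul]
  exact P_sub hx (P_zsmul (P_root ha) k)

lemma Iop_congr (τ : V × ℤ → ℂ) {a : V × ℤ} (ha : D.IsAffRoot a) {f g : V → ℂ}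
    (h : ∀ x ∈ D.weightLattice, f x = g x) {x : V} (hx : x ∈ D.weightLattice) :
    Iop (cz : ℝ) τ a f x = Iop (cz : ℝ) τ a g x := by
  unfold Iop
  rw [h _ (P_sAff ha hx)]
  congr 2
  unfold Jop
  split_ifs
  · congr 1
    exact Finset.sum_congr rfl fun k _ => h _ (P_sub hx (P_zsmul (P_root ha) k))
  · rfl
  · exact Finset.sum_congr rfl fun k _ => h _ (P_add hx (P_zsmul (P_root ha) k))

lemma wordOp_congr (τ : V × ℤ → ℂ) (l : List (Fin (D.n + 1))) {f g : V → ℂ}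
    (h : ∀ x ∈ D.weightLattice, f x = g x) {x : V} (hx : x ∈ D.weightLattice) :
    D.wordOp (cz : ℝ) τ l f x = D.wordOp (cz : ℝ) τ l g x := by
  induction l generalizing x with
  | nil => exact h x hx
  | cons j l ih =>
    rw [wordOp_cons, wordOp_cons]
    exact Iop_congr τ (aSimple_root D j) (fun y hy => ih hy) hx

lemma geo_Ico (q : ℂ) (hq : q ≠ 0) (hq1 : q ≠ 1) (m : ℕ) :
    ∑ k ∈ Finset.Ico (0 : ℤ) m, q ^ k = (q ^ (m : ℤ) - 1) / (q - 1) := by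
  have h1 : q - 1 ≠ 0 := sub_ne_zero.2 hq1
  induction m with
  | zero => simp
  | succ m ih =>
    have : Finset.Ico (0 : ℤ) ((m + 1 : ℕ) : ℤ) = insert (m : ℤ) (Finset.Ico (0 : ℤ) m) := by
      ext k; simp only [Finset.mem_Ico, Finset.mem_insert]; push_cast; omega
    rw [this, Finset.sum_insert (by simp), ih]
    push_cast
    rw [zpow_add₀ hq, zpow_one]
    field_simp
    ring

lemma geo_Icc (q : ℂ) (hq : q ≠ 0) (hq1 : q ≠ 1) (m : ℕ) :
    ∑ k ∈ Finset.Icc (1 : ℤ) m, q ^ (-k) = (1 - q ^ (-(m : ℤ))) / (q - 1) := by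
  have h1 : q - 1 ≠ 0 := sub_ne_zero.2 hq1
  induction m with
  | zero => simp
  | succ m ih =>
    have : Finset.Icc (1 : ℤ) ((m + 1 : ℕ) : ℤ) = insert ((m : ℤ) + 1) (Finset.Icc (1 : ℤ) m) := by
      ext k; simp only [Finset.mem_Icc, Finset.mem_insert]; push_cast; omega
    rw [this, Finset.sum_insert (by simp), ih]
    push_cast
    rw [neg_add, zpow_add₀ hq, zpow_neg_one]
    field_simp
    ring

lemma Iop_exp (τ : V × ℤ → ℂ) {a : V × ℤ} (ha : D.IsAffRoot a) {E : V → ℂ} {q : ℂ}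
    (hq : q ≠ 0) (hq1 : q ≠ 1) {x : V} (hx : x ∈ D.weightLattice)
    (hE : ∀ (x : V) (n : ℤ), E (x + n • a.1) = q ^ n * E x) :
    Iop (cz : ℝ) τ a E x = (τ a + (τ a - (τ a)⁻¹) * (1 / (q - 1))) * E (sAff (cz : ℝ) a x)
      - (τ a - (τ a)⁻¹) * (1 / (q - 1)) * E x := by
  obtain ⟨k, hk⟩ := aval_int (cz := cz) ha hx
  have hs : E (sAff (cz : ℝ) a x) = q ^ (-k) * E x := by
    rw [← hE]; unfold sAff; rw [hk, Int.cast_smul_eq_zsmul, neg_smul, sub_eq_add_neg]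
  have hJ : Jop (cz : ℝ) a E x = 1 / (q - 1) * (E (sAff (cz : ℝ) a x) - E x) := by
    rw [hs]
    unfold Jop
    rw [hk, Int.floor_intCast]
    split_ifs with h1 h2
    · have h1' : 0 < k := by exact_mod_cast h1
      obtain ⟨m, rfl⟩ : ∃ m : ℕ, k = m := ⟨k.toNat, by omega⟩
      have : ∀ j : ℤ, E (x - j • a.1) = q ^ (-j) * E x := fun j => by
        rw [← hE, neg_smul, sub_eq_add_neg]
      simp only [this]
      rw [← Finset.sum_mul, geo_Icc q hq hq1]
      ring
    · have h2' : k = 0 := by exact_mod_cast h2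
      subst h2'
      simp
    · have h1' : k < 0 := by
        rcases lt_trichotomy k 0 with h | h | h
        · exact h
        · exact absurd (by exact_mod_cast h) h2
        · exact absurd (by exact_mod_cast h) h1
      obtain ⟨m, rfl⟩ : ∃ m : ℕ, k = -(m : ℤ) := ⟨(-k).toNat, by omega⟩
      simp only [hE]
      rw [← Finset.sum_mul, neg_neg, geo_Ico q hq hq1]
      ring
  unfold Iop
  rw [hJ]; ring

def Rep (D : RootSystemData V) {N : ℕ} (E : Fin N → V → ℂ) (v : Fin N → ℂ) (f : V → ℂ) : Prop :=
  ∀ x ∈ D.weightLattice, f x = ∑ k, v k * E k x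

lemma rep_step (τ : V × ℤ → ℂ) {a : V × ℤ} (ha : D.IsAffRoot a) {N : ℕ} (σ : Fin N → Fin N)
    (G : Fin N → ℂ) (E : Fin N → V → ℂ) (Q : Fin N → ℂ) (hQ : ∀ k, Q k ≠ 0) (hQ1 : ∀ k, Q k ≠ 1)
    (hG : ∀ k, G k = 1 / (Q k - 1)) (hσ : ∀ k x, E (σ k) x = E k (sAff (cz : ℝ) a x))
    (hE : ∀ k x (n : ℤ), E k (x + n • a.1) = Q k ^ n * E k x) (hσσ : ∀ k, σ (σ k) = k)
    (v : Fin N → ℂ) (f : V → ℂ) (hf : Rep D E v f) :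
    Rep D E (Tv σ (τ a) (τ a - (τ a)⁻¹) G v) (Iop (cz : ℝ) τ a f) := by
  intro x hx
  rw [Iop_congr τ ha hf hx, (FF_Iop (cz : ℝ) τ a x).map_sum]
  have h1 : ∀ k, v k * Iop (cz : ℝ) τ a (E k) x =
      (τ a + (τ a - (τ a)⁻¹) * G k) * v k * E (σ k) x
       - (τ a - (τ a)⁻¹) * G k * v k * E k x := fun k => by
    rw [Iop_exp τ ha (hQ k) (hQ1 k) hx (hE k), hσ, hG]; ring
  rw [Finset.sum_congr rfl fun k _ => h1 k, Finset.sum_sub_distrib]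
  have h2 := Equiv.sum_comp (Function.Involutive.toPerm σ hσσ)
    (fun k => (τ a + (τ a - (τ a)⁻¹) * G k) * v k * E (σ k) x)
  rw [← h2, ← Finset.sum_sub_distrib]
  refine Finset.sum_congr rfl fun k _ => ?_
  have hp : ∀ k, Function.Involutive.toPerm σ hσσ k = σ k := fun _ => rfl
  simp only [hp, hσσ, Tv]
  ring

/-- `φ` is additive along two directions. -/
def Lin2 (α β : V) (φ : V → V) (ρ σ : V) : Prop :=
  (∀ x (n : ℤ), φ (x + n • α) = φ x + n • ρ) ∧ (∀ x (n : ℤ), φ (x + n • β) = φ x + n • σ)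

lemma sAff_add_zsmul (c : ℝ) (a : V × ℤ) (x y : V) (n : ℤ) :
    sAff c a (x + n • y) = sAff c a x + n • (y - ⟪y, coroot a.1⟫ • a.1) := by
  unfold sAff aval
  rw [inner_add_left, ← Int.cast_smul_eq_zsmul ℝ n y, real_inner_smul_left,
    ← Int.cast_smul_eq_zsmul ℝ n (y - _)]
  module

lemma Lin2.i {c : ℝ} {a b : V × ℤ} (ha : a.1 ≠ 0) {p : ℤ} (hp : ⟪b.1, coroot a.1⟫ = -(p : ℝ))
    {φ : V → V} {ρ σ : V} (h : Lin2 a.1 b.1 φ ρ σ) :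
    Lin2 a.1 b.1 (fun x => φ (sAff c a x)) (-ρ) (σ + p • ρ) := by
  constructor
  · intro x n
    beta_reduce
    rw [sAff_add_zsmul, inner_coroot_self ha]
    have : n • (a.1 - (2 : ℝ) • a.1) = (-n) • a.1 := by
      rw [two_smul]; simp
    rw [this, h.1]; simp
  · intro x n
    beta_reduce
    rw [sAff_add_zsmul, hp]
    have : n • (b.1 - (-(p : ℝ)) • a.1) = n • b.1 + (n * p) • a.1 := by
      rw [neg_smul, sub_neg_eq_add, smul_add, Int.cast_smul_eq_zsmul, smul_smul]
    rw [this, ← add_assoc, h.1, h.2, add_assoc, smul_add, smul_smul]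

lemma Lin2.symm {α β : V} {φ : V → V} {ρ σ : V} (h : Lin2 α β φ ρ σ) : Lin2 β α φ σ ρ := ⟨h.2, h.1⟩

lemma Lin2.j {c : ℝ} {a b : V × ℤ} (hb : b.1 ≠ 0) {q : ℤ} (hq : ⟪a.1, coroot b.1⟫ = -(q : ℝ))
    {φ : V → V} {ρ σ : V} (h : Lin2 a.1 b.1 φ ρ σ) :
    Lin2 a.1 b.1 (fun x => φ (sAff c b x)) (ρ + q • σ) (-σ) :=
  (Lin2.i hb hq h.symm).symm

lemma gneg {q : ℂ} (hq : q ≠ 0) (hq1 : q ≠ 1) : -1 - 1 / (q - 1) = 1 / (q⁻¹ - 1) := by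
  have h1 : q - 1 ≠ 0 := sub_ne_zero.2 hq1
  have h2 : 1 - q ≠ 0 := sub_ne_zero.2 hq1.symm
  have h3 : q⁻¹ - 1 ≠ 0 := by
    intro h; apply h2; field_simp at h; simpa using h
  rw [eq_div_iff h3]
  field_simp
  ring


/-- integral combination of two vectors -/
def RR (α β : V) (u v : ℤ) : V := u • α + v • β

lemma RR_neg (α β : V) (u v : ℤ) : RR α β (-u) (-v) = - RR α β u v := by
  unfold RR; module

lemma ee_RR (ξ α β : V) (u v : ℤ) : ee ξ (RR α β u v) = ee ξ α ^ u * ee ξ β ^ v := by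
  unfold RR; rw [ee_add, ee_zsmul, ee_zsmul]

lemma Lin2.iR {c : ℝ} {a b : V × ℤ} (ha : a.1 ≠ 0) {p : ℤ} (hp : ⟪b.1, coroot a.1⟫ = -(p : ℝ))
    {φ : V → V} {u v u' v' : ℤ} (h : Lin2 a.1 b.1 φ (RR a.1 b.1 u v) (RR a.1 b.1 u' v')) :
    Lin2 a.1 b.1 (fun x => φ (sAff c a x)) (RR a.1 b.1 (-u) (-v))
      (RR a.1 b.1 (u' + p * u) (v' + p * v)) := by
  have := Lin2.i (c := c) ha hp h
  rw [RR_neg]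
  have e : RR a.1 b.1 (u' + p * u) (v' + p * v) = RR a.1 b.1 u' v' + p • RR a.1 b.1 u v := by
    unfold RR; module
  rw [e]; exact this

lemma Lin2.jR {c : ℝ} {a b : V × ℤ} (hb : b.1 ≠ 0) {q : ℤ} (hq : ⟪a.1, coroot b.1⟫ = -(q : ℝ))
    {φ : V → V} {u v u' v' : ℤ} (h : Lin2 a.1 b.1 φ (RR a.1 b.1 u v) (RR a.1 b.1 u' v')) :
    Lin2 a.1 b.1 (fun x => φ (sAff c b x)) (RR a.1 b.1 (u + q * u') (v + q * v'))
      (RR a.1 b.1 (-u') (-v')) := by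
  have := Lin2.j (c := c) hb hq h
  rw [RR_neg]
  have e : RR a.1 b.1 (u + q * u') (v + q * v') = RR a.1 b.1 u v + q • RR a.1 b.1 u' v' := by
    unfold RR; module
  rw [e]; exact this

lemma RR_refl_i {α β : V} (hα : α ∈ D.R0) {p : ℤ} (hp : ⟪β, coroot α⟫ = -(p : ℝ)) {u v : ℤ}
    (h : RR α β u v ∈ D.R0) : RR α β (-u + p * v) v ∈ D.R0 := by
  have := refl_mem D hα h
  convert this using 1
  unfold RR refl
  simp only [← Int.cast_smul_eq_zsmul ℝ, inner_add_left, real_inner_smul_left,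
    inner_coroot_self (D.ne_zero α hα), hp]
  push_cast
  module

lemma RR_refl_j {α β : V} (hβ : β ∈ D.R0) {q : ℤ} (hq : ⟪α, coroot β⟫ = -(q : ℝ)) {u v : ℤ}
    (h : RR α β u v ∈ D.R0) : RR α β u (-v + q * u) ∈ D.R0 := by
  have := refl_mem D hβ h
  convert this using 1
  unfold RR refl
  simp only [← Int.cast_smul_eq_zsmul ℝ, inner_add_left, real_inner_smul_left,
    inner_coroot_self (D.ne_zero β hβ), hq]
  push_cast
  module

lemma RR_ne {α β ξ : V} (hξ : Gen D ξ) {u v : ℤ} (h : RR α β u v ∈ D.R0) :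
    ee ξ (RR α β u v) ≠ 1 ∧ ee ξ (RR α β (-u) (-v)) ≠ 1 := by
  refine ⟨ee_ne_one (hξ _ h), ?_⟩
  rw [RR_neg]; exact ee_ne_one (hξ _ (neg_mem D h))

lemma RR_gneg {α β ξ : V} (hξ : Gen D ξ) {u v : ℤ} (h : RR α β u v ∈ D.R0) :
    -1 - 1 / (ee ξ (RR α β u v) - 1) = 1 / (ee ξ (RR α β (-u) (-v)) - 1) := by
  rw [RR_neg, ee_neg]; exact gneg (ee_ne _ _) (RR_ne hξ h).1

lemma sAff_coord (c : ℝ) {a b : V × ℤ} (ha : a.1 ≠ 0) {p : ℝ} (hp : ⟪b.1, coroot a.1⟫ = -p)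
    (x : V) (u v : ℝ) :
    sAff c a (x - u • a.1 - v • b.1) = x - (aval c a x - u + p * v) • a.1 - v • b.1 := by
  unfold sAff aval
  simp only [inner_sub_left, real_inner_smul_left, inner_coroot_self ha, hp]
  module

lemma sAff_coord' (c : ℝ) {a b : V × ℤ} (hb : b.1 ≠ 0) {q : ℝ} (hq : ⟪a.1, coroot b.1⟫ = -q)
    (x : V) (u v : ℝ) :
    sAff c b (x - u • a.1 - v • b.1) = x - u • a.1 - (aval c b x - v + q * u) • b.1 := by
  unfold sAff aval
  simp only [inner_sub_left, real_inner_smul_left, inner_coroot_self hb, hq]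
  module

lemma grel {X Y : ℂ} (hX : X ≠ 1) (hY : Y ≠ 1) (hXY : X * Y ≠ 1) :
    1 / (X * Y - 1) * (1 + 1 / (X - 1) + 1 / (Y - 1)) - 1 / (X - 1) * (1 / (Y - 1)) = 0 := by
  have h1 := sub_ne_zero.2 hX
  have h2 := sub_ne_zero.2 hY
  have h3 := sub_ne_zero.2 hXY
  field_simp
  ring

lemma bop2 (τ : V × ℤ → ℂ) {a b : V × ℤ} (ha : D.IsAffRoot a) (hb : D.IsAffRoot b)
    (hp : ⟪b.1, coroot a.1⟫ = -((0 : ℤ) : ℝ)) (hq : ⟪a.1, coroot b.1⟫ = -((0 : ℤ) : ℝ))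
    {ξ : V} (hξ : Gen D ξ) {x : V} (hx : x ∈ D.weightLattice) :
    Iop (cz : ℝ) τ a (Iop (cz : ℝ) τ b (ee ξ)) x
      = Iop (cz : ℝ) τ b (Iop (cz : ℝ) τ a (ee ξ)) x := by
  have ha0 := D.ne_zero _ ha
  have hb0 := D.ne_zero _ hb
  obtain ⟨f0, hf0⟩ : ∃ f : V → V, f = fun x => x := ⟨_, rfl⟩
  obtain ⟨f1, hf1⟩ : ∃ f : V → V, f = fun x => f0 (sAff (cz : ℝ) a x) := ⟨_, rfl⟩
  obtain ⟨f2, hf2⟩ : ∃ f : V → V, f = fun x => f1 (sAff (cz : ℝ) b x) := ⟨_, rfl⟩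
  obtain ⟨f3, hf3⟩ : ∃ f : V → V, f = fun x => f2 (sAff (cz : ℝ) a x) := ⟨_, rfl⟩
  have L0 : Lin2 a.1 b.1 f0 (RR a.1 b.1 1 0) (RR a.1 b.1 0 1) := by
    subst hf0; exact ⟨fun x n => by simp [RR], fun x n => by simp [RR]⟩
  have L1 : Lin2 a.1 b.1 f1 (RR a.1 b.1 (-1) 0) (RR a.1 b.1 0 1) := by
    subst hf1; exact Lin2.iR ha0 hp L0
  have L2 : Lin2 a.1 b.1 f2 (RR a.1 b.1 (-1) 0) (RR a.1 b.1 0 (-1)) := by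
    subst hf2; exact Lin2.jR hb0 hq L1
  have L3 : Lin2 a.1 b.1 f3 (RR a.1 b.1 1 0) (RR a.1 b.1 0 (-1)) := by
    subst hf3; exact Lin2.iR ha0 hp L2
  have Si := fun x u v => sAff_coord (cz : ℝ) ha0 hp x u v
  have Sj := fun x u v => sAff_coord' (cz : ℝ) hb0 hq x u v
  have hcl : ∀ x, f3 (sAff (cz : ℝ) b x) = x := by
    intro x
    have key : f3 (sAff (cz : ℝ) b (x - (0 : ℝ) • a.1 - (0 : ℝ) • b.1)) = x := by
      rw [hf3, hf2, hf1, hf0]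
      simp only [Si, Sj]
      push_cast
      module
    rwa [zero_smul, zero_smul, sub_zero, sub_zero] at key
  have r10 : RR a.1 b.1 1 0 ∈ D.R0 := by simpa [RR] using (show a.1 ∈ D.R0 from ha)
  have r01 : RR a.1 b.1 0 1 ∈ D.R0 := by simpa [RR] using (show b.1 ∈ D.R0 from hb)
  have hQ1i : ∀ k, ee ξ ((![RR a.1 b.1 1 0, RR a.1 b.1 (-1) 0, RR a.1 b.1 (-1) 0, RR a.1 b.1 1 0] : Fin 4 → V) k) ≠ 1 := by
    intro k; fin_cases k
    exacts [(RR_ne hξ r10).1, (RR_ne hξ r10).2, (RR_ne hξ r10).2, (RR_ne hξ r10).1]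
  have hQ1j : ∀ k, ee ξ ((![RR a.1 b.1 0 1, RR a.1 b.1 0 1, RR a.1 b.1 0 (-1), RR a.1 b.1 0 (-1)] : Fin 4 → V) k) ≠ 1 := by
    intro k; fin_cases k
    exacts [(RR_ne hξ r01).1, (RR_ne hξ r01).1, (RR_ne hξ r01).2, (RR_ne hξ r01).2]
  obtain ⟨g1, e1⟩ : ∃ g, g = 1 / (ee ξ (RR a.1 b.1 1 0) - 1) := ⟨_, rfl⟩
  obtain ⟨g2, e2⟩ : ∃ g, g = 1 / (ee ξ (RR a.1 b.1 0 1) - 1) := ⟨_, rfl⟩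
  have hGi : ∀ k, (![g1, (-1 - g1), (-1 - g1), g1] : Fin 4 → ℂ) k
      = 1 / (ee ξ ((![RR a.1 b.1 1 0, RR a.1 b.1 (-1) 0, RR a.1 b.1 (-1) 0, RR a.1 b.1 1 0] : Fin 4 → V) k) - 1) := by
    intro k; fin_cases k
    exacts [e1, (e1 ▸ RR_gneg hξ r10), (e1 ▸ RR_gneg hξ r10), e1]
  have hGj : ∀ k, (![g2, g2, (-1 - g2), (-1 - g2)] : Fin 4 → ℂ) k
      = 1 / (ee ξ ((![RR a.1 b.1 0 1, RR a.1 b.1 0 1, RR a.1 b.1 0 (-1), RR a.1 b.1 0 (-1)] : Fin 4 → V) k) - 1) := by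
    intro k; fin_cases k
    exacts [e2, e2, (e2 ▸ RR_gneg hξ r01), (e2 ▸ RR_gneg hξ r01)]
  have Hi := rep_step (cz := cz) (D := D) τ ha ![1, 0, 3, 2] _ (fun k x => ee ξ ((![f0, f1, f2, f3] : Fin 4 → V → V) k x)) _
    (fun k => ee_ne _ _) hQ1i hGi (by
      intro k x; fin_cases k
      · show ee ξ (f1 x) = ee ξ (f0 (sAff (cz : ℝ) a x)); rw [hf1]
      · show ee ξ (f0 x) = ee ξ (f1 (sAff (cz : ℝ) a x)); rw [hf1]; beta_reduce; rw [sAff_invol _ _ ha0]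
      · show ee ξ (f3 x) = ee ξ (f2 (sAff (cz : ℝ) a x)); rw [hf3]
      · show ee ξ (f2 x) = ee ξ (f3 (sAff (cz : ℝ) a x)); rw [hf3]; beta_reduce; rw [sAff_invol _ _ ha0])
    (by
      intro k x n; fin_cases k
      · exact (congrArg (ee ξ) (L0.1 x n)).trans (by rw [ee_add, ee_zsmul, mul_comm]; rfl)
      · exact (congrArg (ee ξ) (L1.1 x n)).trans (by rw [ee_add, ee_zsmul, mul_comm]; rfl)
      · exact (congrArg (ee ξ) (L2.1 x n)).trans (by rw [ee_add, ee_zsmul, mul_comm]; rfl)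
      · exact (congrArg (ee ξ) (L3.1 x n)).trans (by rw [ee_add, ee_zsmul, mul_comm]; rfl))
    (by decide)
  have Hj := rep_step (cz := cz) (D := D) τ hb ![3, 2, 1, 0] _ (fun k x => ee ξ ((![f0, f1, f2, f3] : Fin 4 → V → V) k x)) _
    (fun k => ee_ne _ _) hQ1j hGj (by
      intro k x; fin_cases k
      · show ee ξ (f3 x) = ee ξ (f0 (sAff (cz : ℝ) b x))
        rw [hf0]; congr 1; rw [← hcl (sAff (cz : ℝ) b x), sAff_invol _ _ hb0]
      · show ee ξ (f2 x) = ee ξ (f1 (sAff (cz : ℝ) b x)); rw [hf2]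
      · show ee ξ (f1 x) = ee ξ (f2 (sAff (cz : ℝ) b x)); rw [hf2]; beta_reduce; rw [sAff_invol _ _ hb0]
      · show ee ξ (f0 x) = ee ξ (f3 (sAff (cz : ℝ) b x)); rw [hcl, hf0])
    (by
      intro k x n; fin_cases k
      · exact (congrArg (ee ξ) (L0.2 x n)).trans (by rw [ee_add, ee_zsmul, mul_comm]; rfl)
      · exact (congrArg (ee ξ) (L1.2 x n)).trans (by rw [ee_add, ee_zsmul, mul_comm]; rfl)
      · exact (congrArg (ee ξ) (L2.2 x n)).trans (by rw [ee_add, ee_zsmul, mul_comm]; rfl)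
      · exact (congrArg (ee ξ) (L3.2 x n)).trans (by rw [ee_add, ee_zsmul, mul_comm]; rfl))
    (by decide)
  have H0 : Rep D (fun k x => ee ξ ((![f0, f1, f2, f3] : Fin 4 → V → V) k x)) ![1, 0, 0, 0] (ee ξ) := by
    intro y hy
    rw [Finset.sum_eq_single 0]
    · show ee ξ y = 1 * ee ξ (f0 y)
      rw [one_mul, hf0]
    · intro k _ hk; fin_cases k
      · exact absurd rfl hk
      all_goals exact zero_mul _
    · intro h; exact absurd (Finset.mem_univ _) h
  have R1 := Hi _ _ (Hj _ _ H0)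
  have R2 := Hj _ _ (Hi _ _ H0)
  have B := braid2 (ee ξ a.1) (ee ξ b.1) (τ a) (τ a - (τ a)⁻¹) (τ b) (τ b - (τ b)⁻¹)
    (by have := sub_ne_zero.2 (RR_ne hξ r10).1; rw [ee_RR] at this; simpa using this)
    (by have := sub_ne_zero.2 (RR_ne hξ r01).1; rw [ee_RR] at this; simpa using this)
    g1 g2 (by rw [e1, ee_RR]; norm_cast; simp)
    (by rw [e2, ee_RR]; norm_cast; simp)
  rw [R1 x hx, R2 x hx]
  exact Finset.sum_congr rfl fun k _ => congrArg (· * _) (congrFun B k)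

lemma bop3 (τ : V × ℤ → ℂ) {a b : V × ℤ} (ha : D.IsAffRoot a) (hb : D.IsAffRoot b)
    (hp : ⟪b.1, coroot a.1⟫ = -((1 : ℤ) : ℝ)) (hq : ⟪a.1, coroot b.1⟫ = -((1 : ℤ) : ℝ))
    (hτ : τ b = τ a)
    {ξ : V} (hξ : Gen D ξ) {x : V} (hx : x ∈ D.weightLattice) :
    Iop (cz : ℝ) τ a (Iop (cz : ℝ) τ b (Iop (cz : ℝ) τ a (ee ξ))) x
      = Iop (cz : ℝ) τ b (Iop (cz : ℝ) τ a (Iop (cz : ℝ) τ b (ee ξ))) x := by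
  have ha0 := D.ne_zero _ ha
  have hb0 := D.ne_zero _ hb
  obtain ⟨f0, hf0⟩ : ∃ f : V → V, f = fun x => x := ⟨_, rfl⟩
  obtain ⟨f1, hf1⟩ : ∃ f : V → V, f = fun x => f0 (sAff (cz : ℝ) a x) := ⟨_, rfl⟩
  obtain ⟨f2, hf2⟩ : ∃ f : V → V, f = fun x => f1 (sAff (cz : ℝ) b x) := ⟨_, rfl⟩
  obtain ⟨f3, hf3⟩ : ∃ f : V → V, f = fun x => f2 (sAff (cz : ℝ) a x) := ⟨_, rfl⟩
  obtain ⟨f4, hf4⟩ : ∃ f : V → V, f = fun x => f3 (sAff (cz : ℝ) b x) := ⟨_, rfl⟩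
  obtain ⟨f5, hf5⟩ : ∃ f : V → V, f = fun x => f4 (sAff (cz : ℝ) a x) := ⟨_, rfl⟩
  have L0 : Lin2 a.1 b.1 f0 (RR a.1 b.1 1 0) (RR a.1 b.1 0 1) := by
    subst hf0; exact ⟨fun x n => by simp [RR], fun x n => by simp [RR]⟩
  have L1 : Lin2 a.1 b.1 f1 (RR a.1 b.1 (-1) 0) (RR a.1 b.1 1 1) := by
    subst hf1; exact Lin2.iR ha0 hp L0
  have L2 : Lin2 a.1 b.1 f2 (RR a.1 b.1 0 1) (RR a.1 b.1 (-1) (-1)) := by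
    subst hf2; exact Lin2.jR hb0 hq L1
  have L3 : Lin2 a.1 b.1 f3 (RR a.1 b.1 0 (-1)) (RR a.1 b.1 (-1) 0) := by
    subst hf3; exact Lin2.iR ha0 hp L2
  have L4 : Lin2 a.1 b.1 f4 (RR a.1 b.1 (-1) (-1)) (RR a.1 b.1 1 0) := by
    subst hf4; exact Lin2.jR hb0 hq L3
  have L5 : Lin2 a.1 b.1 f5 (RR a.1 b.1 1 1) (RR a.1 b.1 0 (-1)) := by
    subst hf5; exact Lin2.iR ha0 hp L4
  have Si := fun x u v => sAff_coord (cz : ℝ) ha0 hp x u v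
  have Sj := fun x u v => sAff_coord' (cz : ℝ) hb0 hq x u v
  have hcl : ∀ x, f5 (sAff (cz : ℝ) b x) = x := by
    intro x
    have key : f5 (sAff (cz : ℝ) b (x - (0 : ℝ) • a.1 - (0 : ℝ) • b.1)) = x := by
      rw [hf5, hf4, hf3, hf2, hf1, hf0]
      simp only [Si, Sj]
      push_cast
      module
    rwa [zero_smul, zero_smul, sub_zero, sub_zero] at key
  have r10 : RR a.1 b.1 1 0 ∈ D.R0 := by simpa [RR] using (show a.1 ∈ D.R0 from ha)
  have r01 : RR a.1 b.1 0 1 ∈ D.R0 := by simpa [RR] using (show b.1 ∈ D.R0 from hb)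
  have r11 : RR a.1 b.1 1 1 ∈ D.R0 := RR_refl_i ha hp r01
  have hQ1i : ∀ k, ee ξ ((![RR a.1 b.1 1 0, RR a.1 b.1 (-1) 0, RR a.1 b.1 0 1, RR a.1 b.1 0 (-1), RR a.1 b.1 (-1) (-1), RR a.1 b.1 1 1] : Fin 6 → V) k) ≠ 1 := by
    intro k; fin_cases k
    exacts [(RR_ne hξ r10).1, (RR_ne hξ r10).2, (RR_ne hξ r01).1, (RR_ne hξ r01).2, (RR_ne hξ r11).2, (RR_ne hξ r11).1]
  have hQ1j : ∀ k, ee ξ ((![RR a.1 b.1 0 1, RR a.1 b.1 1 1, RR a.1 b.1 (-1) (-1), RR a.1 b.1 (-1) 0, RR a.1 b.1 1 0, RR a.1 b.1 0 (-1)] : Fin 6 → V) k) ≠ 1 := by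
    intro k; fin_cases k
    exacts [(RR_ne hξ r01).1, (RR_ne hξ r11).1, (RR_ne hξ r11).2, (RR_ne hξ r10).2, (RR_ne hξ r10).1, (RR_ne hξ r01).2]
  obtain ⟨g1, e1⟩ : ∃ g, g = 1 / (ee ξ (RR a.1 b.1 1 0) - 1) := ⟨_, rfl⟩
  obtain ⟨g2, e2⟩ : ∃ g, g = 1 / (ee ξ (RR a.1 b.1 1 1) - 1) := ⟨_, rfl⟩
  obtain ⟨g3, e3⟩ : ∃ g, g = 1 / (ee ξ (RR a.1 b.1 0 1) - 1) := ⟨_, rfl⟩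
  have hGi : ∀ k, (![g1, (-1 - g1), g3, (-1 - g3), (-1 - g2), g2] : Fin 6 → ℂ) k
      = 1 / (ee ξ ((![RR a.1 b.1 1 0, RR a.1 b.1 (-1) 0, RR a.1 b.1 0 1, RR a.1 b.1 0 (-1), RR a.1 b.1 (-1) (-1), RR a.1 b.1 1 1] : Fin 6 → V) k) - 1) := by
    intro k; fin_cases k
    exacts [e1, (e1 ▸ RR_gneg hξ r10), e3, (e3 ▸ RR_gneg hξ r01), (e2 ▸ RR_gneg hξ r11), e2]
  have hGj : ∀ k, (![g3, g2, (-1 - g2), (-1 - g1), g1, (-1 - g3)] : Fin 6 → ℂ) k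
      = 1 / (ee ξ ((![RR a.1 b.1 0 1, RR a.1 b.1 1 1, RR a.1 b.1 (-1) (-1), RR a.1 b.1 (-1) 0, RR a.1 b.1 1 0, RR a.1 b.1 0 (-1)] : Fin 6 → V) k) - 1) := by
    intro k; fin_cases k
    exacts [e3, e2, (e2 ▸ RR_gneg hξ r11), (e1 ▸ RR_gneg hξ r10), e1, (e3 ▸ RR_gneg hξ r01)]
  have Hi := rep_step (cz := cz) (D := D) τ ha ![1, 0, 3, 2, 5, 4] _ (fun k x => ee ξ ((![f0, f1, f2, f3, f4, f5] : Fin 6 → V → V) k x)) _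
    (fun k => ee_ne _ _) hQ1i hGi (by
      intro k x; fin_cases k
      · show ee ξ (f1 x) = ee ξ (f0 (sAff (cz : ℝ) a x)); rw [hf1]
      · show ee ξ (f0 x) = ee ξ (f1 (sAff (cz : ℝ) a x)); rw [hf1]; beta_reduce; rw [sAff_invol _ _ ha0]
      · show ee ξ (f3 x) = ee ξ (f2 (sAff (cz : ℝ) a x)); rw [hf3]
      · show ee ξ (f2 x) = ee ξ (f3 (sAff (cz : ℝ) a x)); rw [hf3]; beta_reduce; rw [sAff_invol _ _ ha0]
      · show ee ξ (f5 x) = ee ξ (f4 (sAff (cz : ℝ) a x)); rw [hf5]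
      · show ee ξ (f4 x) = ee ξ (f5 (sAff (cz : ℝ) a x)); rw [hf5]; beta_reduce; rw [sAff_invol _ _ ha0])
    (by
      intro k x n; fin_cases k
      · exact (congrArg (ee ξ) (L0.1 x n)).trans (by rw [ee_add, ee_zsmul, mul_comm]; rfl)
      · exact (congrArg (ee ξ) (L1.1 x n)).trans (by rw [ee_add, ee_zsmul, mul_comm]; rfl)
      · exact (congrArg (ee ξ) (L2.1 x n)).trans (by rw [ee_add, ee_zsmul, mul_comm]; rfl)
      · exact (congrArg (ee ξ) (L3.1 x n)).trans (by rw [ee_add, ee_zsmul, mul_comm]; rfl)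
      · exact (congrArg (ee ξ) (L4.1 x n)).trans (by rw [ee_add, ee_zsmul, mul_comm]; rfl)
      · exact (congrArg (ee ξ) (L5.1 x n)).trans (by rw [ee_add, ee_zsmul, mul_comm]; rfl))
    (by decide)
  have Hj := rep_step (cz := cz) (D := D) τ hb ![5, 2, 1, 4, 3, 0] _ (fun k x => ee ξ ((![f0, f1, f2, f3, f4, f5] : Fin 6 → V → V) k x)) _
    (fun k => ee_ne _ _) hQ1j hGj (by
      intro k x; fin_cases k
      · show ee ξ (f5 x) = ee ξ (f0 (sAff (cz : ℝ) b x))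
        rw [hf0]; congr 1; rw [← hcl (sAff (cz : ℝ) b x), sAff_invol _ _ hb0]
      · show ee ξ (f2 x) = ee ξ (f1 (sAff (cz : ℝ) b x)); rw [hf2]
      · show ee ξ (f1 x) = ee ξ (f2 (sAff (cz : ℝ) b x)); rw [hf2]; beta_reduce; rw [sAff_invol _ _ hb0]
      · show ee ξ (f4 x) = ee ξ (f3 (sAff (cz : ℝ) b x)); rw [hf4]
      · show ee ξ (f3 x) = ee ξ (f4 (sAff (cz : ℝ) b x)); rw [hf4]; beta_reduce; rw [sAff_invol _ _ hb0]
      · show ee ξ (f0 x) = ee ξ (f5 (sAff (cz : ℝ) b x)); rw [hcl, hf0])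
    (by
      intro k x n; fin_cases k
      · exact (congrArg (ee ξ) (L0.2 x n)).trans (by rw [ee_add, ee_zsmul, mul_comm]; rfl)
      · exact (congrArg (ee ξ) (L1.2 x n)).trans (by rw [ee_add, ee_zsmul, mul_comm]; rfl)
      · exact (congrArg (ee ξ) (L2.2 x n)).trans (by rw [ee_add, ee_zsmul, mul_comm]; rfl)
      · exact (congrArg (ee ξ) (L3.2 x n)).trans (by rw [ee_add, ee_zsmul, mul_comm]; rfl)
      · exact (congrArg (ee ξ) (L4.2 x n)).trans (by rw [ee_add, ee_zsmul, mul_comm]; rfl)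
      · exact (congrArg (ee ξ) (L5.2 x n)).trans (by rw [ee_add, ee_zsmul, mul_comm]; rfl))
    (by decide)
  have H0 : Rep D (fun k x => ee ξ ((![f0, f1, f2, f3, f4, f5] : Fin 6 → V → V) k x)) ![1, 0, 0, 0, 0, 0] (ee ξ) := by
    intro y hy
    rw [Finset.sum_eq_single 0]
    · show ee ξ y = 1 * ee ξ (f0 y)
      rw [one_mul, hf0]
    · intro k _ hk; fin_cases k
      · exact absurd rfl hk
      all_goals exact zero_mul _
    · intro h; exact absurd (Finset.mem_univ _) h
  rw [hτ] at Hj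
  have R1 := Hi _ _ (Hj _ _ (Hi _ _ H0))
  have R2 := Hj _ _ (Hi _ _ (Hj _ _ H0))
  have B := braid3 (ee ξ a.1) (ee ξ b.1) (τ a) (τ a - (τ a)⁻¹)
    (by have := sub_ne_zero.2 (RR_ne hξ r10).1; rw [ee_RR] at this; simpa using this)
    (by have := sub_ne_zero.2 (RR_ne hξ r11).1; rw [ee_RR] at this; simpa using this)
    (by have := sub_ne_zero.2 (RR_ne hξ r01).1; rw [ee_RR] at this; simpa using this)
    g1 g2 g3 (by rw [e1, ee_RR]; norm_cast; simp)
    (by rw [e2, ee_RR]; norm_cast; simp)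
    (by rw [e3, ee_RR]; norm_cast; simp)
  rw [R1 x hx, R2 x hx]
  exact Finset.sum_congr rfl fun k _ => congrArg (· * _) (congrFun B k)

lemma bop4 (τ : V × ℤ → ℂ) {a b : V × ℤ} (ha : D.IsAffRoot a) (hb : D.IsAffRoot b)
    (hp : ⟪b.1, coroot a.1⟫ = -((1 : ℤ) : ℝ)) (hq : ⟪a.1, coroot b.1⟫ = -((2 : ℤ) : ℝ))
    {ξ : V} (hξ : Gen D ξ) {x : V} (hx : x ∈ D.weightLattice) :
    Iop (cz : ℝ) τ a (Iop (cz : ℝ) τ b (Iop (cz : ℝ) τ a (Iop (cz : ℝ) τ b (ee ξ)))) x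
      = Iop (cz : ℝ) τ b (Iop (cz : ℝ) τ a (Iop (cz : ℝ) τ b (Iop (cz : ℝ) τ a (ee ξ)))) x := by
  have ha0 := D.ne_zero _ ha
  have hb0 := D.ne_zero _ hb
  obtain ⟨f0, hf0⟩ : ∃ f : V → V, f = fun x => x := ⟨_, rfl⟩
  obtain ⟨f1, hf1⟩ : ∃ f : V → V, f = fun x => f0 (sAff (cz : ℝ) a x) := ⟨_, rfl⟩
  obtain ⟨f2, hf2⟩ : ∃ f : V → V, f = fun x => f1 (sAff (cz : ℝ) b x) := ⟨_, rfl⟩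
  obtain ⟨f3, hf3⟩ : ∃ f : V → V, f = fun x => f2 (sAff (cz : ℝ) a x) := ⟨_, rfl⟩
  obtain ⟨f4, hf4⟩ : ∃ f : V → V, f = fun x => f3 (sAff (cz : ℝ) b x) := ⟨_, rfl⟩
  obtain ⟨f5, hf5⟩ : ∃ f : V → V, f = fun x => f4 (sAff (cz : ℝ) a x) := ⟨_, rfl⟩
  obtain ⟨f6, hf6⟩ : ∃ f : V → V, f = fun x => f5 (sAff (cz : ℝ) b x) := ⟨_, rfl⟩
  obtain ⟨f7, hf7⟩ : ∃ f : V → V, f = fun x => f6 (sAff (cz : ℝ) a x) := ⟨_, rfl⟩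
  have L0 : Lin2 a.1 b.1 f0 (RR a.1 b.1 1 0) (RR a.1 b.1 0 1) := by
    subst hf0; exact ⟨fun x n => by simp [RR], fun x n => by simp [RR]⟩
  have L1 : Lin2 a.1 b.1 f1 (RR a.1 b.1 (-1) 0) (RR a.1 b.1 1 1) := by
    subst hf1; exact Lin2.iR ha0 hp L0
  have L2 : Lin2 a.1 b.1 f2 (RR a.1 b.1 1 2) (RR a.1 b.1 (-1) (-1)) := by
    subst hf2; exact Lin2.jR hb0 hq L1
  have L3 : Lin2 a.1 b.1 f3 (RR a.1 b.1 (-1) (-2)) (RR a.1 b.1 0 1) := by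
    subst hf3; exact Lin2.iR ha0 hp L2
  have L4 : Lin2 a.1 b.1 f4 (RR a.1 b.1 (-1) 0) (RR a.1 b.1 0 (-1)) := by
    subst hf4; exact Lin2.jR hb0 hq L3
  have L5 : Lin2 a.1 b.1 f5 (RR a.1 b.1 1 0) (RR a.1 b.1 (-1) (-1)) := by
    subst hf5; exact Lin2.iR ha0 hp L4
  have L6 : Lin2 a.1 b.1 f6 (RR a.1 b.1 (-1) (-2)) (RR a.1 b.1 1 1) := by
    subst hf6; exact Lin2.jR hb0 hq L5
  have L7 : Lin2 a.1 b.1 f7 (RR a.1 b.1 1 2) (RR a.1 b.1 0 (-1)) := by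
    subst hf7; exact Lin2.iR ha0 hp L6
  have Si := fun x u v => sAff_coord (cz : ℝ) ha0 hp x u v
  have Sj := fun x u v => sAff_coord' (cz : ℝ) hb0 hq x u v
  have hcl : ∀ x, f7 (sAff (cz : ℝ) b x) = x := by
    intro x
    have key : f7 (sAff (cz : ℝ) b (x - (0 : ℝ) • a.1 - (0 : ℝ) • b.1)) = x := by
      rw [hf7, hf6, hf5, hf4, hf3, hf2, hf1, hf0]
      simp only [Si, Sj]
      push_cast
      module
    rwa [zero_smul, zero_smul, sub_zero, sub_zero] at key
  have r10 : RR a.1 b.1 1 0 ∈ D.R0 := by simpa [RR] using (show a.1 ∈ D.R0 from ha)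
  have r01 : RR a.1 b.1 0 1 ∈ D.R0 := by simpa [RR] using (show b.1 ∈ D.R0 from hb)
  have r11 : RR a.1 b.1 1 1 ∈ D.R0 := RR_refl_i ha hp r01
  have r12 : RR a.1 b.1 1 2 ∈ D.R0 := RR_refl_j hb hq r10
  have hQ1i : ∀ k, ee ξ ((![RR a.1 b.1 1 0, RR a.1 b.1 (-1) 0, RR a.1 b.1 1 2, RR a.1 b.1 (-1) (-2), RR a.1 b.1 (-1) 0, RR a.1 b.1 1 0, RR a.1 b.1 (-1) (-2), RR a.1 b.1 1 2] : Fin 8 → V) k) ≠ 1 := by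
    intro k; fin_cases k
    exacts [(RR_ne hξ r10).1, (RR_ne hξ r10).2, (RR_ne hξ r12).1, (RR_ne hξ r12).2, (RR_ne hξ r10).2, (RR_ne hξ r10).1, (RR_ne hξ r12).2, (RR_ne hξ r12).1]
  have hQ1j : ∀ k, ee ξ ((![RR a.1 b.1 0 1, RR a.1 b.1 1 1, RR a.1 b.1 (-1) (-1), RR a.1 b.1 0 1, RR a.1 b.1 0 (-1), RR a.1 b.1 (-1) (-1), RR a.1 b.1 1 1, RR a.1 b.1 0 (-1)] : Fin 8 → V) k) ≠ 1 := by
    intro k; fin_cases k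
    exacts [(RR_ne hξ r01).1, (RR_ne hξ r11).1, (RR_ne hξ r11).2, (RR_ne hξ r01).1, (RR_ne hξ r01).2, (RR_ne hξ r11).2, (RR_ne hξ r11).1, (RR_ne hξ r01).2]
  obtain ⟨g1, e1⟩ : ∃ g, g = 1 / (ee ξ (RR a.1 b.1 1 0) - 1) := ⟨_, rfl⟩
  obtain ⟨g2, e2⟩ : ∃ g, g = 1 / (ee ξ (RR a.1 b.1 1 1) - 1) := ⟨_, rfl⟩
  obtain ⟨g3, e3⟩ : ∃ g, g = 1 / (ee ξ (RR a.1 b.1 1 2) - 1) := ⟨_, rfl⟩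
  obtain ⟨g4, e4⟩ : ∃ g, g = 1 / (ee ξ (RR a.1 b.1 0 1) - 1) := ⟨_, rfl⟩
  have hGi : ∀ k, (![g1, (-1 - g1), g3, (-1 - g3), (-1 - g1), g1, (-1 - g3), g3] : Fin 8 → ℂ) k
      = 1 / (ee ξ ((![RR a.1 b.1 1 0, RR a.1 b.1 (-1) 0, RR a.1 b.1 1 2, RR a.1 b.1 (-1) (-2), RR a.1 b.1 (-1) 0, RR a.1 b.1 1 0, RR a.1 b.1 (-1) (-2), RR a.1 b.1 1 2] : Fin 8 → V) k) - 1) := by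
    intro k; fin_cases k
    exacts [e1, (e1 ▸ RR_gneg hξ r10), e3, (e3 ▸ RR_gneg hξ r12), (e1 ▸ RR_gneg hξ r10), e1, (e3 ▸ RR_gneg hξ r12), e3]
  have hGj : ∀ k, (![g4, g2, (-1 - g2), g4, (-1 - g4), (-1 - g2), g2, (-1 - g4)] : Fin 8 → ℂ) k
      = 1 / (ee ξ ((![RR a.1 b.1 0 1, RR a.1 b.1 1 1, RR a.1 b.1 (-1) (-1), RR a.1 b.1 0 1, RR a.1 b.1 0 (-1), RR a.1 b.1 (-1) (-1), RR a.1 b.1 1 1, RR a.1 b.1 0 (-1)] : Fin 8 → V) k) - 1) := by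
    intro k; fin_cases k
    exacts [e4, e2, (e2 ▸ RR_gneg hξ r11), e4, (e4 ▸ RR_gneg hξ r01), (e2 ▸ RR_gneg hξ r11), e2, (e4 ▸ RR_gneg hξ r01)]
  have Hi := rep_step (cz := cz) (D := D) τ ha ![1, 0, 3, 2, 5, 4, 7, 6] _ (fun k x => ee ξ ((![f0, f1, f2, f3, f4, f5, f6, f7] : Fin 8 → V → V) k x)) _
    (fun k => ee_ne _ _) hQ1i hGi (by
      intro k x; fin_cases k
      · show ee ξ (f1 x) = ee ξ (f0 (sAff (cz : ℝ) a x)); rw [hf1]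
      · show ee ξ (f0 x) = ee ξ (f1 (sAff (cz : ℝ) a x)); rw [hf1]; beta_reduce; rw [sAff_invol _ _ ha0]
      · show ee ξ (f3 x) = ee ξ (f2 (sAff (cz : ℝ) a x)); rw [hf3]
      · show ee ξ (f2 x) = ee ξ (f3 (sAff (cz : ℝ) a x)); rw [hf3]; beta_reduce; rw [sAff_invol _ _ ha0]
      · show ee ξ (f5 x) = ee ξ (f4 (sAff (cz : ℝ) a x)); rw [hf5]
      · show ee ξ (f4 x) = ee ξ (f5 (sAff (cz : ℝ) a x)); rw [hf5]; beta_reduce; rw [sAff_invol _ _ ha0]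
      · show ee ξ (f7 x) = ee ξ (f6 (sAff (cz : ℝ) a x)); rw [hf7]
      · show ee ξ (f6 x) = ee ξ (f7 (sAff (cz : ℝ) a x)); rw [hf7]; beta_reduce; rw [sAff_invol _ _ ha0])
    (by
      intro k x n; fin_cases k
      · exact (congrArg (ee ξ) (L0.1 x n)).trans (by rw [ee_add, ee_zsmul, mul_comm]; rfl)
      · exact (congrArg (ee ξ) (L1.1 x n)).trans (by rw [ee_add, ee_zsmul, mul_comm]; rfl)
      · exact (congrArg (ee ξ) (L2.1 x n)).trans (by rw [ee_add, ee_zsmul, mul_comm]; rfl)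
      · exact (congrArg (ee ξ) (L3.1 x n)).trans (by rw [ee_add, ee_zsmul, mul_comm]; rfl)
      · exact (congrArg (ee ξ) (L4.1 x n)).trans (by rw [ee_add, ee_zsmul, mul_comm]; rfl)
      · exact (congrArg (ee ξ) (L5.1 x n)).trans (by rw [ee_add, ee_zsmul, mul_comm]; rfl)
      · exact (congrArg (ee ξ) (L6.1 x n)).trans (by rw [ee_add, ee_zsmul, mul_comm]; rfl)
      · exact (congrArg (ee ξ) (L7.1 x n)).trans (by rw [ee_add, ee_zsmul, mul_comm]; rfl))
    (by decide)
  have Hj := rep_step (cz := cz) (D := D) τ hb ![7, 2, 1, 4, 3, 6, 5, 0] _ (fun k x => ee ξ ((![f0, f1, f2, f3, f4, f5, f6, f7] : Fin 8 → V → V) k x)) _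
    (fun k => ee_ne _ _) hQ1j hGj (by
      intro k x; fin_cases k
      · show ee ξ (f7 x) = ee ξ (f0 (sAff (cz : ℝ) b x))
        rw [hf0]; congr 1; rw [← hcl (sAff (cz : ℝ) b x), sAff_invol _ _ hb0]
      · show ee ξ (f2 x) = ee ξ (f1 (sAff (cz : ℝ) b x)); rw [hf2]
      · show ee ξ (f1 x) = ee ξ (f2 (sAff (cz : ℝ) b x)); rw [hf2]; beta_reduce; rw [sAff_invol _ _ hb0]
      · show ee ξ (f4 x) = ee ξ (f3 (sAff (cz : ℝ) b x)); rw [hf4]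
      · show ee ξ (f3 x) = ee ξ (f4 (sAff (cz : ℝ) b x)); rw [hf4]; beta_reduce; rw [sAff_invol _ _ hb0]
      · show ee ξ (f6 x) = ee ξ (f5 (sAff (cz : ℝ) b x)); rw [hf6]
      · show ee ξ (f5 x) = ee ξ (f6 (sAff (cz : ℝ) b x)); rw [hf6]; beta_reduce; rw [sAff_invol _ _ hb0]
      · show ee ξ (f0 x) = ee ξ (f7 (sAff (cz : ℝ) b x)); rw [hcl, hf0])
    (by
      intro k x n; fin_cases k
      · exact (congrArg (ee ξ) (L0.2 x n)).trans (by rw [ee_add, ee_zsmul, mul_comm]; rfl)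
      · exact (congrArg (ee ξ) (L1.2 x n)).trans (by rw [ee_add, ee_zsmul, mul_comm]; rfl)
      · exact (congrArg (ee ξ) (L2.2 x n)).trans (by rw [ee_add, ee_zsmul, mul_comm]; rfl)
      · exact (congrArg (ee ξ) (L3.2 x n)).trans (by rw [ee_add, ee_zsmul, mul_comm]; rfl)
      · exact (congrArg (ee ξ) (L4.2 x n)).trans (by rw [ee_add, ee_zsmul, mul_comm]; rfl)
      · exact (congrArg (ee ξ) (L5.2 x n)).trans (by rw [ee_add, ee_zsmul, mul_comm]; rfl)
      · exact (congrArg (ee ξ) (L6.2 x n)).trans (by rw [ee_add, ee_zsmul, mul_comm]; rfl)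
      · exact (congrArg (ee ξ) (L7.2 x n)).trans (by rw [ee_add, ee_zsmul, mul_comm]; rfl))
    (by decide)
  have H0 : Rep D (fun k x => ee ξ ((![f0, f1, f2, f3, f4, f5, f6, f7] : Fin 8 → V → V) k x)) ![1, 0, 0, 0, 0, 0, 0, 0] (ee ξ) := by
    intro y hy
    rw [Finset.sum_eq_single 0]
    · show ee ξ y = 1 * ee ξ (f0 y)
      rw [one_mul, hf0]
    · intro k _ hk; fin_cases k
      · exact absurd rfl hk
      all_goals exact zero_mul _
    · intro h; exact absurd (Finset.mem_univ _) h
  have R1 := Hi _ _ (Hj _ _ (Hi _ _ (Hj _ _ H0)))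
  have R2 := Hj _ _ (Hi _ _ (Hj _ _ (Hi _ _ H0)))
  have B := braid4 (ee ξ a.1) (ee ξ b.1) (τ a) (τ a - (τ a)⁻¹) (τ b) (τ b - (τ b)⁻¹)
    (by have := sub_ne_zero.2 (RR_ne hξ r10).1; rw [ee_RR] at this; simpa using this)
    (by have := sub_ne_zero.2 (RR_ne hξ r11).1; rw [ee_RR] at this; simpa using this)
    (by have := sub_ne_zero.2 (RR_ne hξ r12).1; rw [ee_RR] at this; simpa using this)
    (by have := sub_ne_zero.2 (RR_ne hξ r01).1; rw [ee_RR] at this; simpa using this)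
    g1 g2 g3 g4 (by rw [e1, ee_RR]; norm_cast; simp)
    (by rw [e2, ee_RR]; norm_cast; simp)
    (by rw [e3, ee_RR]; norm_cast; simp)
    (by rw [e4, ee_RR]; norm_cast; simp)
  rw [R1 x hx, R2 x hx]
  exact Finset.sum_congr rfl fun k _ => congrArg (· * _) (congrFun B k)

lemma bop6 (τ : V × ℤ → ℂ) {a b : V × ℤ} (ha : D.IsAffRoot a) (hb : D.IsAffRoot b)
    (hp : ⟪b.1, coroot a.1⟫ = -((1 : ℤ) : ℝ)) (hq : ⟪a.1, coroot b.1⟫ = -((3 : ℤ) : ℝ))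
    {ξ : V} (hξ : Gen D ξ) {x : V} (hx : x ∈ D.weightLattice) :
    Iop (cz : ℝ) τ a (Iop (cz : ℝ) τ b (Iop (cz : ℝ) τ a (Iop (cz : ℝ) τ b (Iop (cz : ℝ) τ a (Iop (cz : ℝ) τ b (ee ξ)))))) x
      = Iop (cz : ℝ) τ b (Iop (cz : ℝ) τ a (Iop (cz : ℝ) τ b (Iop (cz : ℝ) τ a (Iop (cz : ℝ) τ b (Iop (cz : ℝ) τ a (ee ξ)))))) x := by
  have ha0 := D.ne_zero _ ha
  have hb0 := D.ne_zero _ hb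
  obtain ⟨f0, hf0⟩ : ∃ f : V → V, f = fun x => x := ⟨_, rfl⟩
  obtain ⟨f1, hf1⟩ : ∃ f : V → V, f = fun x => f0 (sAff (cz : ℝ) a x) := ⟨_, rfl⟩
  obtain ⟨f2, hf2⟩ : ∃ f : V → V, f = fun x => f1 (sAff (cz : ℝ) b x) := ⟨_, rfl⟩
  obtain ⟨f3, hf3⟩ : ∃ f : V → V, f = fun x => f2 (sAff (cz : ℝ) a x) := ⟨_, rfl⟩
  obtain ⟨f4, hf4⟩ : ∃ f : V → V, f = fun x => f3 (sAff (cz : ℝ) b x) := ⟨_, rfl⟩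
  obtain ⟨f5, hf5⟩ : ∃ f : V → V, f = fun x => f4 (sAff (cz : ℝ) a x) := ⟨_, rfl⟩
  obtain ⟨f6, hf6⟩ : ∃ f : V → V, f = fun x => f5 (sAff (cz : ℝ) b x) := ⟨_, rfl⟩
  obtain ⟨f7, hf7⟩ : ∃ f : V → V, f = fun x => f6 (sAff (cz : ℝ) a x) := ⟨_, rfl⟩
  obtain ⟨f8, hf8⟩ : ∃ f : V → V, f = fun x => f7 (sAff (cz : ℝ) b x) := ⟨_, rfl⟩
  obtain ⟨f9, hf9⟩ : ∃ f : V → V, f = fun x => f8 (sAff (cz : ℝ) a x) := ⟨_, rfl⟩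
  obtain ⟨f10, hf10⟩ : ∃ f : V → V, f = fun x => f9 (sAff (cz : ℝ) b x) := ⟨_, rfl⟩
  obtain ⟨f11, hf11⟩ : ∃ f : V → V, f = fun x => f10 (sAff (cz : ℝ) a x) := ⟨_, rfl⟩
  have L0 : Lin2 a.1 b.1 f0 (RR a.1 b.1 1 0) (RR a.1 b.1 0 1) := by
    subst hf0; exact ⟨fun x n => by simp [RR], fun x n => by simp [RR]⟩
  have L1 : Lin2 a.1 b.1 f1 (RR a.1 b.1 (-1) 0) (RR a.1 b.1 1 1) := by
    subst hf1; exact Lin2.iR ha0 hp L0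
  have L2 : Lin2 a.1 b.1 f2 (RR a.1 b.1 2 3) (RR a.1 b.1 (-1) (-1)) := by
    subst hf2; exact Lin2.jR hb0 hq L1
  have L3 : Lin2 a.1 b.1 f3 (RR a.1 b.1 (-2) (-3)) (RR a.1 b.1 1 2) := by
    subst hf3; exact Lin2.iR ha0 hp L2
  have L4 : Lin2 a.1 b.1 f4 (RR a.1 b.1 1 3) (RR a.1 b.1 (-1) (-2)) := by
    subst hf4; exact Lin2.jR hb0 hq L3
  have L5 : Lin2 a.1 b.1 f5 (RR a.1 b.1 (-1) (-3)) (RR a.1 b.1 0 1) := by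
    subst hf5; exact Lin2.iR ha0 hp L4
  have L6 : Lin2 a.1 b.1 f6 (RR a.1 b.1 (-1) 0) (RR a.1 b.1 0 (-1)) := by
    subst hf6; exact Lin2.jR hb0 hq L5
  have L7 : Lin2 a.1 b.1 f7 (RR a.1 b.1 1 0) (RR a.1 b.1 (-1) (-1)) := by
    subst hf7; exact Lin2.iR ha0 hp L6
  have L8 : Lin2 a.1 b.1 f8 (RR a.1 b.1 (-2) (-3)) (RR a.1 b.1 1 1) := by
    subst hf8; exact Lin2.jR hb0 hq L7
  have L9 : Lin2 a.1 b.1 f9 (RR a.1 b.1 2 3) (RR a.1 b.1 (-1) (-2)) := by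
    subst hf9; exact Lin2.iR ha0 hp L8
  have L10 : Lin2 a.1 b.1 f10 (RR a.1 b.1 (-1) (-3)) (RR a.1 b.1 1 2) := by
    subst hf10; exact Lin2.jR hb0 hq L9
  have L11 : Lin2 a.1 b.1 f11 (RR a.1 b.1 1 3) (RR a.1 b.1 0 (-1)) := by
    subst hf11; exact Lin2.iR ha0 hp L10
  have Si := fun x u v => sAff_coord (cz : ℝ) ha0 hp x u v
  have Sj := fun x u v => sAff_coord' (cz : ℝ) hb0 hq x u v
  have hcl : ∀ x, f11 (sAff (cz : ℝ) b x) = x := by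
    intro x
    have key : f11 (sAff (cz : ℝ) b (x - (0 : ℝ) • a.1 - (0 : ℝ) • b.1)) = x := by
      rw [hf11, hf10, hf9, hf8, hf7, hf6, hf5, hf4, hf3, hf2, hf1, hf0]
      simp only [Si, Sj]
      push_cast
      module
    rwa [zero_smul, zero_smul, sub_zero, sub_zero] at key
  have r10 : RR a.1 b.1 1 0 ∈ D.R0 := by simpa [RR] using (show a.1 ∈ D.R0 from ha)
  have r01 : RR a.1 b.1 0 1 ∈ D.R0 := by simpa [RR] using (show b.1 ∈ D.R0 from hb)
  have r11 : RR a.1 b.1 1 1 ∈ D.R0 := RR_refl_i ha hp r01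
  have r13 : RR a.1 b.1 1 3 ∈ D.R0 := RR_refl_j hb hq r10
  have r23 : RR a.1 b.1 2 3 ∈ D.R0 := RR_refl_i ha hp r13
  have r12 : RR a.1 b.1 1 2 ∈ D.R0 := RR_refl_j hb hq r11
  have hQ1i : ∀ k, ee ξ ((![RR a.1 b.1 1 0, RR a.1 b.1 (-1) 0, RR a.1 b.1 2 3, RR a.1 b.1 (-2) (-3), RR a.1 b.1 1 3, RR a.1 b.1 (-1) (-3), RR a.1 b.1 (-1) 0, RR a.1 b.1 1 0, RR a.1 b.1 (-2) (-3), RR a.1 b.1 2 3, RR a.1 b.1 (-1) (-3), RR a.1 b.1 1 3] : Fin 12 → V) k) ≠ 1 := by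
    intro k; fin_cases k
    exacts [(RR_ne hξ r10).1, (RR_ne hξ r10).2, (RR_ne hξ r23).1, (RR_ne hξ r23).2, (RR_ne hξ r13).1, (RR_ne hξ r13).2, (RR_ne hξ r10).2, (RR_ne hξ r10).1, (RR_ne hξ r23).2, (RR_ne hξ r23).1, (RR_ne hξ r13).2, (RR_ne hξ r13).1]
  have hQ1j : ∀ k, ee ξ ((![RR a.1 b.1 0 1, RR a.1 b.1 1 1, RR a.1 b.1 (-1) (-1), RR a.1 b.1 1 2, RR a.1 b.1 (-1) (-2), RR a.1 b.1 0 1, RR a.1 b.1 0 (-1), RR a.1 b.1 (-1) (-1), RR a.1 b.1 1 1, RR a.1 b.1 (-1) (-2), RR a.1 b.1 1 2, RR a.1 b.1 0 (-1)] : Fin 12 → V) k) ≠ 1 := by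
    intro k; fin_cases k
    exacts [(RR_ne hξ r01).1, (RR_ne hξ r11).1, (RR_ne hξ r11).2, (RR_ne hξ r12).1, (RR_ne hξ r12).2, (RR_ne hξ r01).1, (RR_ne hξ r01).2, (RR_ne hξ r11).2, (RR_ne hξ r11).1, (RR_ne hξ r12).2, (RR_ne hξ r12).1, (RR_ne hξ r01).2]
  obtain ⟨g1, e1⟩ : ∃ g, g = 1 / (ee ξ (RR a.1 b.1 1 0) - 1) := ⟨_, rfl⟩
  obtain ⟨g2, e2⟩ : ∃ g, g = 1 / (ee ξ (RR a.1 b.1 1 1) - 1) := ⟨_, rfl⟩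
  obtain ⟨g3, e3⟩ : ∃ g, g = 1 / (ee ξ (RR a.1 b.1 2 3) - 1) := ⟨_, rfl⟩
  obtain ⟨g4, e4⟩ : ∃ g, g = 1 / (ee ξ (RR a.1 b.1 1 2) - 1) := ⟨_, rfl⟩
  obtain ⟨g5, e5⟩ : ∃ g, g = 1 / (ee ξ (RR a.1 b.1 1 3) - 1) := ⟨_, rfl⟩
  obtain ⟨g6, e6⟩ : ∃ g, g = 1 / (ee ξ (RR a.1 b.1 0 1) - 1) := ⟨_, rfl⟩
  have hGi : ∀ k, (![g1, (-1 - g1), g3, (-1 - g3), g5, (-1 - g5), (-1 - g1), g1, (-1 - g3), g3, (-1 - g5), g5] : Fin 12 → ℂ) k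
      = 1 / (ee ξ ((![RR a.1 b.1 1 0, RR a.1 b.1 (-1) 0, RR a.1 b.1 2 3, RR a.1 b.1 (-2) (-3), RR a.1 b.1 1 3, RR a.1 b.1 (-1) (-3), RR a.1 b.1 (-1) 0, RR a.1 b.1 1 0, RR a.1 b.1 (-2) (-3), RR a.1 b.1 2 3, RR a.1 b.1 (-1) (-3), RR a.1 b.1 1 3] : Fin 12 → V) k) - 1) := by
    intro k; fin_cases k
    exacts [e1, (e1 ▸ RR_gneg hξ r10), e3, (e3 ▸ RR_gneg hξ r23), e5, (e5 ▸ RR_gneg hξ r13), (e1 ▸ RR_gneg hξ r10), e1, (e3 ▸ RR_gneg hξ r23), e3, (e5 ▸ RR_gneg hξ r13), e5]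
  have hGj : ∀ k, (![g6, g2, (-1 - g2), g4, (-1 - g4), g6, (-1 - g6), (-1 - g2), g2, (-1 - g4), g4, (-1 - g6)] : Fin 12 → ℂ) k
      = 1 / (ee ξ ((![RR a.1 b.1 0 1, RR a.1 b.1 1 1, RR a.1 b.1 (-1) (-1), RR a.1 b.1 1 2, RR a.1 b.1 (-1) (-2), RR a.1 b.1 0 1, RR a.1 b.1 0 (-1), RR a.1 b.1 (-1) (-1), RR a.1 b.1 1 1, RR a.1 b.1 (-1) (-2), RR a.1 b.1 1 2, RR a.1 b.1 0 (-1)] : Fin 12 → V) k) - 1) := by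
    intro k; fin_cases k
    exacts [e6, e2, (e2 ▸ RR_gneg hξ r11), e4, (e4 ▸ RR_gneg hξ r12), e6, (e6 ▸ RR_gneg hξ r01), (e2 ▸ RR_gneg hξ r11), e2, (e4 ▸ RR_gneg hξ r12), e4, (e6 ▸ RR_gneg hξ r01)]
  have Hi := rep_step (cz := cz) (D := D) τ ha ![1, 0, 3, 2, 5, 4, 7, 6, 9, 8, 11, 10] _ (fun k x => ee ξ ((![f0, f1, f2, f3, f4, f5, f6, f7, f8, f9, f10, f11] : Fin 12 → V → V) k x)) _
    (fun k => ee_ne _ _) hQ1i hGi (by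
      intro k x; fin_cases k
      · show ee ξ (f1 x) = ee ξ (f0 (sAff (cz : ℝ) a x)); rw [hf1]
      · show ee ξ (f0 x) = ee ξ (f1 (sAff (cz : ℝ) a x)); rw [hf1]; beta_reduce; rw [sAff_invol _ _ ha0]
      · show ee ξ (f3 x) = ee ξ (f2 (sAff (cz : ℝ) a x)); rw [hf3]
      · show ee ξ (f2 x) = ee ξ (f3 (sAff (cz : ℝ) a x)); rw [hf3]; beta_reduce; rw [sAff_invol _ _ ha0]
      · show ee ξ (f5 x) = ee ξ (f4 (sAff (cz : ℝ) a x)); rw [hf5]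
      · show ee ξ (f4 x) = ee ξ (f5 (sAff (cz : ℝ) a x)); rw [hf5]; beta_reduce; rw [sAff_invol _ _ ha0]
      · show ee ξ (f7 x) = ee ξ (f6 (sAff (cz : ℝ) a x)); rw [hf7]
      · show ee ξ (f6 x) = ee ξ (f7 (sAff (cz : ℝ) a x)); rw [hf7]; beta_reduce; rw [sAff_invol _ _ ha0]
      · show ee ξ (f9 x) = ee ξ (f8 (sAff (cz : ℝ) a x)); rw [hf9]
      · show ee ξ (f8 x) = ee ξ (f9 (sAff (cz : ℝ) a x)); rw [hf9]; beta_reduce; rw [sAff_invol _ _ ha0]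
      · show ee ξ (f11 x) = ee ξ (f10 (sAff (cz : ℝ) a x)); rw [hf11]
      · show ee ξ (f10 x) = ee ξ (f11 (sAff (cz : ℝ) a x)); rw [hf11]; beta_reduce; rw [sAff_invol _ _ ha0])
    (by
      intro k x n; fin_cases k
      · exact (congrArg (ee ξ) (L0.1 x n)).trans (by rw [ee_add, ee_zsmul, mul_comm]; rfl)
      · exact (congrArg (ee ξ) (L1.1 x n)).trans (by rw [ee_add, ee_zsmul, mul_comm]; rfl)
      · exact (congrArg (ee ξ) (L2.1 x n)).trans (by rw [ee_add, ee_zsmul, mul_comm]; rfl)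
      · exact (congrArg (ee ξ) (L3.1 x n)).trans (by rw [ee_add, ee_zsmul, mul_comm]; rfl)
      · exact (congrArg (ee ξ) (L4.1 x n)).trans (by rw [ee_add, ee_zsmul, mul_comm]; rfl)
      · exact (congrArg (ee ξ) (L5.1 x n)).trans (by rw [ee_add, ee_zsmul, mul_comm]; rfl)
      · exact (congrArg (ee ξ) (L6.1 x n)).trans (by rw [ee_add, ee_zsmul, mul_comm]; rfl)
      · exact (congrArg (ee ξ) (L7.1 x n)).trans (by rw [ee_add, ee_zsmul, mul_comm]; rfl)
      · exact (congrArg (ee ξ) (L8.1 x n)).trans (by rw [ee_add, ee_zsmul, mul_comm]; rfl)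
      · exact (congrArg (ee ξ) (L9.1 x n)).trans (by rw [ee_add, ee_zsmul, mul_comm]; rfl)
      · exact (congrArg (ee ξ) (L10.1 x n)).trans (by rw [ee_add, ee_zsmul, mul_comm]; rfl)
      · exact (congrArg (ee ξ) (L11.1 x n)).trans (by rw [ee_add, ee_zsmul, mul_comm]; rfl))
    (by decide)
  have Hj := rep_step (cz := cz) (D := D) τ hb ![11, 2, 1, 4, 3, 6, 5, 8, 7, 10, 9, 0] _ (fun k x => ee ξ ((![f0, f1, f2, f3, f4, f5, f6, f7, f8, f9, f10, f11] : Fin 12 → V → V) k x)) _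
    (fun k => ee_ne _ _) hQ1j hGj (by
      intro k x; fin_cases k
      · show ee ξ (f11 x) = ee ξ (f0 (sAff (cz : ℝ) b x))
        rw [hf0]; congr 1; rw [← hcl (sAff (cz : ℝ) b x), sAff_invol _ _ hb0]
      · show ee ξ (f2 x) = ee ξ (f1 (sAff (cz : ℝ) b x)); rw [hf2]
      · show ee ξ (f1 x) = ee ξ (f2 (sAff (cz : ℝ) b x)); rw [hf2]; beta_reduce; rw [sAff_invol _ _ hb0]
      · show ee ξ (f4 x) = ee ξ (f3 (sAff (cz : ℝ) b x)); rw [hf4]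
      · show ee ξ (f3 x) = ee ξ (f4 (sAff (cz : ℝ) b x)); rw [hf4]; beta_reduce; rw [sAff_invol _ _ hb0]
      · show ee ξ (f6 x) = ee ξ (f5 (sAff (cz : ℝ) b x)); rw [hf6]
      · show ee ξ (f5 x) = ee ξ (f6 (sAff (cz : ℝ) b x)); rw [hf6]; beta_reduce; rw [sAff_invol _ _ hb0]
      · show ee ξ (f8 x) = ee ξ (f7 (sAff (cz : ℝ) b x)); rw [hf8]
      · show ee ξ (f7 x) = ee ξ (f8 (sAff (cz : ℝ) b x)); rw [hf8]; beta_reduce; rw [sAff_invol _ _ hb0]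
      · show ee ξ (f10 x) = ee ξ (f9 (sAff (cz : ℝ) b x)); rw [hf10]
      · show ee ξ (f9 x) = ee ξ (f10 (sAff (cz : ℝ) b x)); rw [hf10]; beta_reduce; rw [sAff_invol _ _ hb0]
      · show ee ξ (f0 x) = ee ξ (f11 (sAff (cz : ℝ) b x)); rw [hcl, hf0])
    (by
      intro k x n; fin_cases k
      · exact (congrArg (ee ξ) (L0.2 x n)).trans (by rw [ee_add, ee_zsmul, mul_comm]; rfl)
      · exact (congrArg (ee ξ) (L1.2 x n)).trans (by rw [ee_add, ee_zsmul, mul_comm]; rfl)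
      · exact (congrArg (ee ξ) (L2.2 x n)).trans (by rw [ee_add, ee_zsmul, mul_comm]; rfl)
      · exact (congrArg (ee ξ) (L3.2 x n)).trans (by rw [ee_add, ee_zsmul, mul_comm]; rfl)
      · exact (congrArg (ee ξ) (L4.2 x n)).trans (by rw [ee_add, ee_zsmul, mul_comm]; rfl)
      · exact (congrArg (ee ξ) (L5.2 x n)).trans (by rw [ee_add, ee_zsmul, mul_comm]; rfl)
      · exact (congrArg (ee ξ) (L6.2 x n)).trans (by rw [ee_add, ee_zsmul, mul_comm]; rfl)
      · exact (congrArg (ee ξ) (L7.2 x n)).trans (by rw [ee_add, ee_zsmul, mul_comm]; rfl)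
      · exact (congrArg (ee ξ) (L8.2 x n)).trans (by rw [ee_add, ee_zsmul, mul_comm]; rfl)
      · exact (congrArg (ee ξ) (L9.2 x n)).trans (by rw [ee_add, ee_zsmul, mul_comm]; rfl)
      · exact (congrArg (ee ξ) (L10.2 x n)).trans (by rw [ee_add, ee_zsmul, mul_comm]; rfl)
      · exact (congrArg (ee ξ) (L11.2 x n)).trans (by rw [ee_add, ee_zsmul, mul_comm]; rfl))
    (by decide)
  have H0 : Rep D (fun k x => ee ξ ((![f0, f1, f2, f3, f4, f5, f6, f7, f8, f9, f10, f11] : Fin 12 → V → V) k x)) ![1, 0, 0, 0, 0, 0, 0, 0, 0, 0, 0, 0] (ee ξ) := by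
    intro y hy
    rw [Finset.sum_eq_single 0]
    · show ee ξ y = 1 * ee ξ (f0 y)
      rw [one_mul, hf0]
    · intro k _ hk; fin_cases k
      · exact absurd rfl hk
      all_goals exact zero_mul _
    · intro h; exact absurd (Finset.mem_univ _) h
  have R1 := Hi _ _ (Hj _ _ (Hi _ _ (Hj _ _ (Hi _ _ (Hj _ _ H0)))))
  have R2 := Hj _ _ (Hi _ _ (Hj _ _ (Hi _ _ (Hj _ _ (Hi _ _ H0)))))
  have B := braid6 (τ a) (τ a - (τ a)⁻¹) (τ b) (τ b - (τ b)⁻¹) g1 g2 g3 g4 g5 g6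
    (by
      have hm : ee ξ (RR a.1 b.1 1 1) = ee ξ (RR a.1 b.1 1 0) * ee ξ (RR a.1 b.1 0 1) := by
        rw [← ee_add]; congr 1; unfold RR; module
      have := (RR_ne hξ r11).1; rw [hm] at this
      rw [e2, e1, e6, hm]; exact grel (RR_ne hξ r10).1 (RR_ne hξ r01).1 this)
    (by
      have hm : ee ξ (RR a.1 b.1 2 3) = ee ξ (RR a.1 b.1 1 0) * ee ξ (RR a.1 b.1 1 3) := by
        rw [← ee_add]; congr 1; unfold RR; module
      have := (RR_ne hξ r23).1; rw [hm] at this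
      rw [e3, e1, e5, hm]; exact grel (RR_ne hξ r10).1 (RR_ne hξ r13).1 this)
    (by
      have hm : ee ξ (RR a.1 b.1 2 3) = ee ξ (RR a.1 b.1 1 1) * ee ξ (RR a.1 b.1 1 2) := by
        rw [← ee_add]; congr 1; unfold RR; module
      have := (RR_ne hξ r23).1; rw [hm] at this
      rw [e3, e2, e4, hm]; exact grel (RR_ne hξ r11).1 (RR_ne hξ r12).1 this)
    (by
      have hm : ee ξ (RR a.1 b.1 1 2) = ee ξ (RR a.1 b.1 1 1) * ee ξ (RR a.1 b.1 0 1) := by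
        rw [← ee_add]; congr 1; unfold RR; module
      have := (RR_ne hξ r12).1; rw [hm] at this
      rw [e4, e2, e6, hm]; exact grel (RR_ne hξ r11).1 (RR_ne hξ r01).1 this)
    (by
      have hm : ee ξ (RR a.1 b.1 1 3) = ee ξ (RR a.1 b.1 1 2) * ee ξ (RR a.1 b.1 0 1) := by
        rw [← ee_add]; congr 1; unfold RR; module
      have := (RR_ne hξ r13).1; rw [hm] at this
      rw [e5, e4, e6, hm]; exact grel (RR_ne hξ r12).1 (RR_ne hξ r01).1 this)
  rw [R1 x hx, R2 x hx]
  exact Finset.sum_congr rfl fun k _ => congrArg (· * _) (congrFun B k)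

end AW

namespace AW
open RootSystemData
variable {V : Type*} [NormedAddCommGroup V] [InnerProductSpace ℝ V]
variable {D : RootSystemData V} {cz : ℤ} {x0 : V} {τ : V × ℤ → ℂ}

lemma quad_rel {a : V × ℤ} (ha : D.IsAffRoot a) (h0 : τ a ≠ 0) (f : V → ℂ) {x : V}
    (hx : x ∈ D.weightLattice) :
    Iop (cz : ℝ) τ a (Iop (cz : ℝ) τ a f) x = f x + (τ a - (τ a)⁻¹) * Iop (cz : ℝ) τ a f x := by
  refine FF.eq_of D (φ := fun f => Iop (cz : ℝ) τ a (Iop (cz : ℝ) τ a f) x)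
    (ψ := fun f => f x + (τ a - (τ a)⁻¹) * Iop (cz : ℝ) τ a f x) ?_ ?_ ?_ f
  · exact FF.comp (fun y => FF_Iop _ _ _ y) (FF_Iop _ _ _ x)
  · exact FF.add (FF.ev x) (FF.smul _ (FF_Iop _ _ _ x))
  intro ξ hξ
  have ha0 := D.ne_zero _ ha
  set q := ee ξ a.1 with hqd
  have hq : q ≠ 0 := ee_ne _ _
  have hq1 : q ≠ 1 := ee_ne_one (hξ _ ha)
  have hqi : q⁻¹ ≠ 1 := by simpa using hq1
  set g := 1 / (q - 1) with hg
  have H := rep_step (cz := cz) (D := D) τ ha ![1, 0] ![g, -1 - g]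
    ![ee ξ, fun x => ee ξ (sAff (cz : ℝ) a x)] ![q, q⁻¹]
    (by intro k; fin_cases k; exacts [hq, inv_ne_zero hq])
    (by intro k; fin_cases k; exacts [hq1, hqi])
    (by intro k; fin_cases k; exacts [rfl, gneg hq hq1])
    (by
      intro k x; fin_cases k
      · rfl
      · show ee ξ x = ee ξ (sAff (cz : ℝ) a (sAff (cz : ℝ) a x))
        rw [sAff_invol _ _ ha0])
    (by
      intro k x n; fin_cases k
      · show ee ξ (x + n • a.1) = q ^ n * ee ξ x
        rw [ee_add, ee_zsmul, mul_comm]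
      · show ee ξ (sAff (cz : ℝ) a (x + n • a.1)) = q⁻¹ ^ n * ee ξ (sAff (cz : ℝ) a x)
        rw [sAff_add_zsmul, inner_coroot_self ha0]
        have : n • (a.1 - (2 : ℝ) • a.1) = n • (-a.1) := by
          rw [two_smul]; simp
        rw [this, ee_add, ee_zsmul, ee_neg, mul_comm])
    (by decide)
  have H0 : Rep D ![ee ξ, fun x => ee ξ (sAff (cz : ℝ) a x)] ![1, 0] (ee ξ) := by
    intro y hy; simp
  have h1 := H _ _ H0 x hx
  have h2 := H _ _ (H _ _ H0) x hx
  beta_reduce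
  rw [h2, h1]
  simp [Fin.sum_univ_two, Tv]
  field_simp
  ring

lemma wordOp_comm {orb : Finset V} (horb : ∀ ν ∈ orb, ν ∈ D.weightLattice)
    (hst : ∀ ν ∈ orb, ∀ α ∈ D.R0, refl α ν ∈ orb) {a : V × ℤ} (ha : D.IsAffRoot a)
    (f : V → ℂ) {x : V} (hx : x ∈ D.weightLattice) :
    Iop (cz : ℝ) τ a (fun x => ∑ ν ∈ orb, f (x - ν)) x
      = ∑ ν ∈ orb, Iop (cz : ℝ) τ a f (x - ν) := by
  refine FF.eq_of D (φ := fun f => Iop (cz : ℝ) τ a (fun x => ∑ ν ∈ orb, f (x - ν)) x)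
    (ψ := fun f => ∑ ν ∈ orb, Iop (cz : ℝ) τ a f (x - ν)) ?_ ?_ ?_ f
  · exact FF.comp (T := fun f x => ∑ ν ∈ orb, f (x - ν))
      (fun y => FF.sum _ _ fun ν _ => FF.ev _) (FF_Iop _ _ _ x)
  · exact FF.sum _ _ fun ν _ => FF_Iop _ _ _ _
  intro ξ hξ
  beta_reduce
  have ha0 := D.ne_zero _ ha
  have hexp : ∀ y ∈ D.weightLattice, Iop (cz : ℝ) τ a (ee ξ) y = _ := fun y hy =>
    Iop_exp (q := ee ξ a.1) (E := ee ξ) (cz := cz) τ ha (ee_ne _ _) (ee_ne_one (hξ _ ha)) hy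
      (fun x n => by rw [ee_add, ee_zsmul, mul_comm])
  have hM : ∀ y, ∑ ν ∈ orb, ee ξ (y - ν) = (∑ ν ∈ orb, ee ξ (-ν)) * ee ξ y := by
    intro y; rw [Finset.sum_mul]
    exact Finset.sum_congr rfl fun ν _ => by rw [sub_eq_add_neg, ee_add, mul_comm]
  have hMs : ∀ y, ∑ ν ∈ orb, ee ξ (sAff (cz : ℝ) a (y - ν))
      = (∑ ν ∈ orb, ee ξ (-ν)) * ee ξ (sAff (cz : ℝ) a y) := by
    intro y
    rw [← hM]
    have e : ∀ ν, sAff (cz : ℝ) a (y - ν) = sAff (cz : ℝ) a y - refl a.1 ν := by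
      intro ν
      have := sAff_add_zsmul (cz : ℝ) a y ν (-1)
      simp only [neg_smul, one_smul, ← sub_eq_add_neg] at this
      rw [this]; rfl
    simp only [e]
    refine Finset.sum_bij' (fun ν _ => refl a.1 ν) (fun ν _ => refl a.1 ν)
      (fun ν h => hst ν h _ ha) (fun ν h => hst ν h _ ha)
      (fun ν _ => refl_refl ha0 ν) (fun ν _ => refl_refl ha0 ν) (fun ν _ => rfl)
  rw [Finset.sum_congr rfl fun ν hν => hexp _ (P_sub hx (horb ν hν)), Finset.sum_sub_distrib,
    ← Finset.mul_sum, ← Finset.mul_sum, hM, hMs]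
  simp only [hM]
  have := (FF_Iop (cz : ℝ) τ a x).map_sum Finset.univ (fun _ : Fin 1 => ∑ ν ∈ orb, ee ξ (-ν))
    (fun _ => ee ξ)
  simp only [Finset.univ_unique, Finset.sum_singleton] at this
  rw [this, hexp x hx]
  ring

lemma wordOp_comm_word {orb : Finset V} (horb : ∀ ν ∈ orb, ν ∈ D.weightLattice)
    (hst : ∀ ν ∈ orb, ∀ α ∈ D.R0, refl α ν ∈ orb) (l : List (Fin (D.n + 1)))
    (f : V → ℂ) {x : V} (hx : x ∈ D.weightLattice) :
    D.wordOp (cz : ℝ) τ l (fun x => ∑ ν ∈ orb, f (x - ν)) x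
      = ∑ ν ∈ orb, D.wordOp (cz : ℝ) τ l f (x - ν) := by
  induction l generalizing x with
  | nil => rfl
  | cons j l ih =>
    simp only [wordOp_cons]
    rw [Iop_congr τ (aSimple_root D j) (fun y hy => ih hy) hx]
    exact wordOp_comm horb hst (aSimple_root D j) _ hx

lemma aSimple_inj {i j : Fin (D.n + 1)} (h : D.aSimple i = D.aSimple j) : i = j := by
  rcases Fin.eq_zero_or_eq_succ i with rfl | ⟨i, rfl⟩ <;>
  rcases Fin.eq_zero_or_eq_succ j with rfl | ⟨j, rfl⟩
  · rfl
  · rw [aSimple_zero, aSimple_succ, Prod.mk.injEq] at h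
    exact absurd h.2 (by norm_num)
  · rw [aSimple_zero, aSimple_succ, Prod.mk.injEq] at h
    exact absurd h.2 (by norm_num)
  · rw [aSimple_succ, aSimple_succ, Prod.mk.injEq] at h
    rw [(simple_li D).injective h.1]

lemma tau_srefl {c : ℝ} (hc : 0 < c) (hτ : D.IsMultiplicity c τ) {a b : V × ℤ}
    (ha : D.IsAffRoot a) (hb : D.IsAffRoot b) : τ (srefl b a) = τ a := by
  rw [← pull_sP hc hb ha]; exact tau_pull hτ (sP_mem hb) ha

lemma strip_cons (hc : (0 : ℝ) < cz) (hx : IsX0 D (cz : ℝ) x0) {w : Equiv.Perm V}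
    (hw : w ∈ D.WR (cz : ℝ)) {k : Fin (D.n + 1)} {l : List (Fin (D.n + 1))}
    (h : aval (cz : ℝ) (D.aSimple k) (w x0) < 0)
    (h' : D.len (cz : ℝ) ((ev D (cz : ℝ) l)⁻¹ * (sj D (cz : ℝ) k * w)) + l.length
      = D.len (cz : ℝ) (sj D (cz : ℝ) k * w)) :
    D.len (cz : ℝ) ((ev D (cz : ℝ) (k :: l))⁻¹ * w) + (k :: l).length = D.len (cz : ℝ) w := by
  have := len_desc hc hx hw h
  rw [ev_cons, mul_inv_rev, sj_inv, mul_assoc, List.length_cons]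
  omega

/-- conclusion of rank two analysis -/
def R2 (D : RootSystemData V) (cz : ℤ) (τ : V × ℤ → ℂ) (w : Equiv.Perm V)
    (i j : Fin (D.n + 1)) : Prop :=
  ∃ l1 l2, ev D (cz : ℝ) (i :: l1) = ev D (cz : ℝ) (j :: l2) ∧
    (∀ f x, x ∈ D.weightLattice →
      D.wordOp (cz : ℝ) τ (i :: l1) f x = D.wordOp (cz : ℝ) τ (j :: l2) f x) ∧
    l1.length = l2.length ∧
    D.len (cz : ℝ) ((ev D (cz : ℝ) (i :: l1))⁻¹ * w) + (i :: l1).length = D.len (cz : ℝ) w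

lemma R2.symm {w : Equiv.Perm V} {i j : Fin (D.n + 1)} (h : R2 D cz τ w i j) :
    R2 D cz τ w j i := by
  obtain ⟨l1, l2, h1, h2, h3, h4⟩ := h
  refine ⟨l2, l1, h1.symm, fun f x hx => (h2 f x hx).symm, h3.symm, ?_⟩
  rw [← h1, List.length_cons, ← h3]; exact h4

lemma R2_two (hc : (0 : ℝ) < cz) (hx : IsX0 D (cz : ℝ) x0) {w : Equiv.Perm V}
    (hw : w ∈ D.WR (cz : ℝ)) {i j : Fin (D.n + 1)}
    (hi : aval (cz : ℝ) (D.aSimple i) (w x0) < 0) (hj : aval (cz : ℝ) (D.aSimple j) (w x0) < 0)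
    (hp : ⟪(D.aSimple j).1, coroot (D.aSimple i).1⟫ = -((0 : ℤ) : ℝ))
    (hq : ⟪(D.aSimple i).1, coroot (D.aSimple j).1⟫ = -((0 : ℤ) : ℝ)) : R2 D cz τ w i j := by
  have ci := inner_coroot_self (aSimple_ne D i)
  have cj := inner_coroot_self (aSimple_ne D j)
  refine ⟨[j], [i], ?_, ?_, rfl, ?_⟩
  · ext x
    simp only [ev_cons, ev_nil, Equiv.Perm.mul_apply, Equiv.Perm.one_apply, sj_apply]
    have e : x = x - (0 : ℝ) • (D.aSimple i).1 - (0 : ℝ) • (D.aSimple j).1 := by simp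
    rw [e]
    simp only [sAff_coord (cz : ℝ) (aSimple_ne D i) hp, sAff_coord' (cz : ℝ) (aSimple_ne D j) hq]
    push_cast
    module
  · intro f x hx
    exact FF.eq_of D (FF_wordOp D _ τ [i, j] x) (FF_wordOp D _ τ [j, i] x) (fun ξ hξ =>
      bop2 τ (aSimple_root D i) (aSimple_root D j) hp hq hξ hx) f
  · have m1 := sj_mem (D := D) (c := (cz : ℝ)) i
    have m2 := sj_mem (D := D) (c := (cz : ℝ)) j
    have n1 := mul_mem m1 hw
    refine strip_cons hc hx hw hi (strip_cons hc hx n1 ?_ (by simp [ev_nil]))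
    simp only [Equiv.Perm.mul_apply, sj_apply, aval_sAff, hp, hq, ci, cj]
    push_cast; linarith

lemma R2_three (hc : (0 : ℝ) < cz) (hx : IsX0 D (cz : ℝ) x0) (hτ : D.IsMultiplicity (cz : ℝ) τ)
    {w : Equiv.Perm V} (hw : w ∈ D.WR (cz : ℝ)) {i j : Fin (D.n + 1)}
    (hi : aval (cz : ℝ) (D.aSimple i) (w x0) < 0) (hj : aval (cz : ℝ) (D.aSimple j) (w x0) < 0)
    (hp : ⟪(D.aSimple j).1, coroot (D.aSimple i).1⟫ = -((1 : ℤ) : ℝ))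
    (hq : ⟪(D.aSimple i).1, coroot (D.aSimple j).1⟫ = -((1 : ℤ) : ℝ)) : R2 D cz τ w i j := by
  have ci := inner_coroot_self (aSimple_ne D i)
  have cj := inner_coroot_self (aSimple_ne D j)
  have ht : τ (D.aSimple j) = τ (D.aSimple i) := by
    rw [← tau_srefl hc hτ (aSimple_root D j) (aSimple_root D i),
      ← tau_srefl hc hτ (aSimple_root D i) (aSimple_root D j)]
    congr 1
    apply aval_ext hc (srefl_mem D (aSimple_root D j) (aSimple_root D i))
      (srefl_mem D (aSimple_root D i) (aSimple_root D j))
    intro x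
    rw [aval_srefl D _ (aSimple_root D j) (aSimple_root D i),
      aval_srefl D _ (aSimple_root D i) (aSimple_root D j), aval_sAff, aval_sAff, hp, hq]
    push_cast; ring
  refine ⟨[j, i], [i, j], ?_, ?_, rfl, ?_⟩
  · ext x
    simp only [ev_cons, ev_nil, Equiv.Perm.mul_apply, Equiv.Perm.one_apply, sj_apply]
    have e : x = x - (0 : ℝ) • (D.aSimple i).1 - (0 : ℝ) • (D.aSimple j).1 := by simp
    rw [e]
    simp only [sAff_coord (cz : ℝ) (aSimple_ne D i) hp, sAff_coord' (cz : ℝ) (aSimple_ne D j) hq]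
    push_cast
    module
  · intro f x hx
    exact FF.eq_of D (FF_wordOp D _ τ [i, j, i] x) (FF_wordOp D _ τ [j, i, j] x) (fun ξ hξ =>
      bop3 τ (aSimple_root D i) (aSimple_root D j) hp hq ht hξ hx) f
  · have m1 := sj_mem (D := D) (c := (cz : ℝ)) i
    have m2 := sj_mem (D := D) (c := (cz : ℝ)) j
    have n1 := mul_mem m1 hw
    have n2 := mul_mem m2 n1
    refine strip_cons hc hx hw hi (strip_cons hc hx n1 ?_ (strip_cons hc hx n2 ?_
      (by simp [ev_nil])))
    all_goals
      simp only [Equiv.Perm.mul_apply, sj_apply, aval_sAff, hp, hq, ci, cj]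
      push_cast; linarith

lemma R2_four (hc : (0 : ℝ) < cz) (hx : IsX0 D (cz : ℝ) x0) {w : Equiv.Perm V}
    (hw : w ∈ D.WR (cz : ℝ)) {i j : Fin (D.n + 1)}
    (hi : aval (cz : ℝ) (D.aSimple i) (w x0) < 0) (hj : aval (cz : ℝ) (D.aSimple j) (w x0) < 0)
    (hp : ⟪(D.aSimple j).1, coroot (D.aSimple i).1⟫ = -((1 : ℤ) : ℝ))
    (hq : ⟪(D.aSimple i).1, coroot (D.aSimple j).1⟫ = -((2 : ℤ) : ℝ)) : R2 D cz τ w i j := by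
  have ci := inner_coroot_self (aSimple_ne D i)
  have cj := inner_coroot_self (aSimple_ne D j)
  refine ⟨[j, i, j], [i, j, i], ?_, ?_, rfl, ?_⟩
  · ext x
    simp only [ev_cons, ev_nil, Equiv.Perm.mul_apply, Equiv.Perm.one_apply, sj_apply]
    have e : x = x - (0 : ℝ) • (D.aSimple i).1 - (0 : ℝ) • (D.aSimple j).1 := by simp
    rw [e]
    simp only [sAff_coord (cz : ℝ) (aSimple_ne D i) hp, sAff_coord' (cz : ℝ) (aSimple_ne D j) hq]
    push_cast
    module
  · intro f x hx
    exact FF.eq_of D (FF_wordOp D _ τ [i, j, i, j] x) (FF_wordOp D _ τ [j, i, j, i] x)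
      (fun ξ hξ => bop4 τ (aSimple_root D i) (aSimple_root D j) hp hq hξ hx) f
  · have m1 := sj_mem (D := D) (c := (cz : ℝ)) i
    have m2 := sj_mem (D := D) (c := (cz : ℝ)) j
    have n1 := mul_mem m1 hw
    have n2 := mul_mem m2 n1
    have n3 := mul_mem m1 n2
    refine strip_cons hc hx hw hi (strip_cons hc hx n1 ?_ (strip_cons hc hx n2 ?_
      (strip_cons hc hx n3 ?_ (by simp [ev_nil]))))
    all_goals
      simp only [Equiv.Perm.mul_apply, sj_apply, aval_sAff, hp, hq, ci, cj]
      push_cast; linarith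

lemma R2_six (hc : (0 : ℝ) < cz) (hx : IsX0 D (cz : ℝ) x0) {w : Equiv.Perm V}
    (hw : w ∈ D.WR (cz : ℝ)) {i j : Fin (D.n + 1)}
    (hi : aval (cz : ℝ) (D.aSimple i) (w x0) < 0) (hj : aval (cz : ℝ) (D.aSimple j) (w x0) < 0)
    (hp : ⟪(D.aSimple j).1, coroot (D.aSimple i).1⟫ = -((1 : ℤ) : ℝ))
    (hq : ⟪(D.aSimple i).1, coroot (D.aSimple j).1⟫ = -((3 : ℤ) : ℝ)) : R2 D cz τ w i j := by
  have ci := inner_coroot_self (aSimple_ne D i)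
  have cj := inner_coroot_self (aSimple_ne D j)
  refine ⟨[j, i, j, i, j], [i, j, i, j, i], ?_, ?_, rfl, ?_⟩
  · ext x
    simp only [ev_cons, ev_nil, Equiv.Perm.mul_apply, Equiv.Perm.one_apply, sj_apply]
    have e : x = x - (0 : ℝ) • (D.aSimple i).1 - (0 : ℝ) • (D.aSimple j).1 := by simp
    rw [e]
    simp only [sAff_coord (cz : ℝ) (aSimple_ne D i) hp, sAff_coord' (cz : ℝ) (aSimple_ne D j) hq]
    push_cast
    module
  · intro f x hx
    exact FF.eq_of D (FF_wordOp D _ τ [i, j, i, j, i, j] x) (FF_wordOp D _ τ [j, i, j, i, j, i] x)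
      (fun ξ hξ => bop6 τ (aSimple_root D i) (aSimple_root D j) hp hq hξ hx) f
  · have m1 := sj_mem (D := D) (c := (cz : ℝ)) i
    have m2 := sj_mem (D := D) (c := (cz : ℝ)) j
    have n1 := mul_mem m1 hw
    have n2 := mul_mem m2 n1
    have n3 := mul_mem m1 n2
    have n4 := mul_mem m2 n3
    have n5 := mul_mem m1 n4
    refine strip_cons hc hx hw hi (strip_cons hc hx n1 ?_ (strip_cons hc hx n2 ?_
      (strip_cons hc hx n3 ?_ (strip_cons hc hx n4 ?_ (strip_cons hc hx n5 ?_
      (by simp [ev_nil]))))))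
    all_goals
      simp only [Equiv.Perm.mul_apply, sj_apply, aval_sAff, hp, hq, ci, cj]
      push_cast; linarith

lemma rank2 (hc : (0 : ℝ) < cz) (hx : IsX0 D (cz : ℝ) x0) (hτ : D.IsMultiplicity (cz : ℝ) τ)
    {w : Equiv.Perm V} (hw : w ∈ D.WR (cz : ℝ)) {i j : Fin (D.n + 1)} (hij : i ≠ j)
    (hi : aval (cz : ℝ) (D.aSimple i) (w x0) < 0) (hj : aval (cz : ℝ) (D.aSimple j) (w x0) < 0) :
    R2 D cz τ w i j := by
  have hne : D.aSimple i ≠ D.aSimple j := fun h => hij (aSimple_inj h)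
  have ha0 := aSimple_ne D i
  have hb0 := aSimple_ne D j
  obtain ⟨P, hP⟩ := D.crystallographic _ (aSimple_root D i) _ (aSimple_root D j)
  obtain ⟨Q, hQ⟩ := D.crystallographic _ (aSimple_root D j) _ (aSimple_root D i)
  have A0 := hx.pos (aSimple_pos D i)
  have B0 := hx.pos (aSimple_pos D j)
  have hPQ := inner_coroot_comm_pos ha0 hb0
  rw [hP, hQ] at hPQ
  have hPQ' : 0 < P ↔ 0 < Q := by exact_mod_cast hPQ
  have hPn : ¬ 0 < P := by
    intro h
    have hq : 0 < Q := hPQ'.1 h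
    have k1 := hx.pos (srefl_simple_pos D i (aSimple_pos D j) hne.symm)
    have k2 := hx.pos (srefl_simple_pos D j (aSimple_pos D i) hne)
    rw [aval_srefl D _ (aSimple_root D j) (aSimple_root D i), aval_sAff, hQ] at k1
    rw [aval_srefl D _ (aSimple_root D i) (aSimple_root D j), aval_sAff, hP] at k2
    have hP1 : (1 : ℝ) ≤ P := by exact_mod_cast h
    have hQ1 : (1 : ℝ) ≤ Q := by exact_mod_cast hq
    nlinarith
  obtain ⟨p, rfl⟩ : ∃ p, P = -p := ⟨-P, by ring⟩
  obtain ⟨q, rfl⟩ : ∃ q, Q = -q := ⟨-Q, by ring⟩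
  push_cast at hP hQ
  have hp0 : 0 ≤ p := by omega
  have hq0 : 0 ≤ q := by omega
  set α := (D.aSimple i).1 with hα
  set β := (D.aSimple j).1 with hβ
  have hN := inner_self_pos ha0
  have hM := inner_self_pos hb0
  have eP : 2 * ⟪β, α⟫ = -p * ⟪α, α⟫ := by
    have := hP; rw [inner_coroot] at this
    field_simp at this; linarith
  have eQ : 2 * ⟪β, α⟫ = -q * ⟪β, β⟫ := by
    have := hQ; rw [inner_coroot] at this
    rw [real_inner_comm β α] at this
    field_simp at this; linarith
  have hz : p = 0 ↔ q = 0 := by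
    constructor
    · rintro rfl
      have : (q : ℝ) * ⟪β, β⟫ = 0 := by push_cast at eP; linarith
      rcases mul_eq_zero.1 this with h | h
      · exact_mod_cast h
      · exact absurd h hM.ne'
    · rintro rfl
      have : (p : ℝ) * ⟪α, α⟫ = 0 := by push_cast at eQ; linarith
      rcases mul_eq_zero.1 this with h | h
      · exact_mod_cast h
      · exact absurd h hN.ne'
  have hsq : (q : ℝ) * ⟪(p : ℝ) • α + (2 : ℝ) • β, (p : ℝ) • α + (2 : ℝ) • β⟫
      = p * (4 - p * q) * ⟪α, α⟫ := by
    simp only [inner_add_left, inner_add_right, real_inner_smul_left, real_inner_smul_right]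
    rw [real_inner_comm β α]
    linear_combination (2 * p * q - 4) * eP + 4 * eQ
  have hpq : p * q < 4 ∨ p = 0 := by
    by_contra hcon
    push Not at hcon
    obtain ⟨h4, hp⟩ := hcon
    have hpp : 0 < p := by omega
    have hqp : 0 < q := by
      rcases hq0.lt_or_eq with h | h
      · exact h
      · exact absurd (hz.2 h.symm) hp
    have hppr : (0 : ℝ) < p := by exact_mod_cast hpp
    have hqpr : (0 : ℝ) < q := by exact_mod_cast hqp
    have h4r : (4 : ℝ) ≤ p * q := by exact_mod_cast h4
    have hge := real_inner_self_nonneg (x := (p : ℝ) • α + (2 : ℝ) • β)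
    have hle : (p : ℝ) * (4 - p * q) * ⟪α, α⟫ ≤ 0 := by
      have : (p : ℝ) * (4 - p * q) ≤ 0 := by nlinarith
      nlinarith
    have hzero : ⟪(p : ℝ) • α + (2 : ℝ) • β, (p : ℝ) • α + (2 : ℝ) • β⟫ = 0 := by
      have h1 : (q : ℝ) * ⟪(p : ℝ) • α + (2 : ℝ) • β, (p : ℝ) • α + (2 : ℝ) • β⟫ ≤ 0 := by
        rw [hsq]; exact hle
      nlinarith
    rw [inner_self_eq_zero] at hzero
    have hβα : β = (-(p : ℝ) / 2) • α := by
      have : (2 : ℝ) • β = -((p : ℝ) • α) := by rw [eq_neg_iff_add_eq_zero, add_comm]; exact hzero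
      have h3 : β = (1 / 2 : ℝ) • ((2 : ℝ) • β) := by rw [smul_smul]; norm_num
      rw [h3, this]; module
    have hmem : (-(p : ℝ) / 2) • α ∈ D.R0 := by rw [← hβα]; exact aSimple_root D j
    have hβα' : β = -α := by
      rcases D.reduced α (aSimple_root D i) _ hmem with h | h
      · linarith
      · rw [hβα, h]; simp
    have hsum : ∀ x, aval (cz : ℝ) (D.aSimple i) x + aval (cz : ℝ) (D.aSimple j) x
        = ((D.aSimple i).2 + (D.aSimple j).2) * cz := by
      intro x
      unfold aval
      rw [← hβ, ← hα, hβα', coroot_neg, inner_neg_right]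
      ring
    have e1 := hsum x0
    have e2 := hsum (w x0)
    linarith
  have hp' : ⟪β, coroot α⟫ = -((p : ℤ) : ℝ) := by rw [hP]
  have hq' : ⟪α, coroot β⟫ = -((q : ℤ) : ℝ) := by rw [hQ]
  have hcases : (p = 0 ∧ q = 0) ∨ (p = 1 ∧ q = 1) ∨ (p = 1 ∧ q = 2) ∨ (p = 2 ∧ q = 1) ∨
      (p = 1 ∧ q = 3) ∨ (p = 3 ∧ q = 1) := by
    rcases hpq with h | h
    · by_cases hp1 : p = 0
      · exact Or.inl ⟨hp1, hz.1 hp1⟩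
      · have hq1 : q ≠ 0 := fun h => hp1 (hz.2 h)
        have h1 : p < 4 := by nlinarith [show 1 ≤ q by omega, show 1 ≤ p by omega]
        have h2 : q < 4 := by nlinarith [show 1 ≤ q by omega, show 1 ≤ p by omega]
        interval_cases p <;> interval_cases q <;> simp_all
    · exact Or.inl ⟨h, hz.1 h⟩
  rcases hcases with ⟨rfl, rfl⟩ | ⟨rfl, rfl⟩ | ⟨rfl, rfl⟩ | ⟨rfl, rfl⟩ | ⟨rfl, rfl⟩ | ⟨rfl, rfl⟩
  · exact R2_two hc hx hw hi hj hp' hq'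
  · exact R2_three hc hx hτ hw hi hj hp' hq'
  · exact R2_four hc hx hw hi hj hp' hq'
  · exact (R2_four hc hx hw hj hi hq' hp').symm
  · exact R2_six hc hx hw hi hj hp' hq'
  · exact (R2_six hc hx hw hj hi hq' hp').symm

/-- Matsumoto: operators of reduced words only depend on the group element. -/
lemma matsumoto (hc : (0 : ℝ) < cz) (hx : IsX0 D (cz : ℝ) x0) (hτ : D.IsMultiplicity (cz : ℝ) τ) :
    ∀ (n : ℕ) (l l' : List (Fin (D.n + 1))), l.length = n → Red D (cz : ℝ) l → Red D (cz : ℝ) l' →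
      ev D (cz : ℝ) l = ev D (cz : ℝ) l' → ∀ f x, x ∈ D.weightLattice →
      D.wordOp (cz : ℝ) τ l f x = D.wordOp (cz : ℝ) τ l' f x := by
  intro n
  induction n with
  | zero =>
    intro l l' hl h1 h2 he f x hxP
    have e2 : l'.length = 0 := by
      have a1 : l.length = D.len (cz : ℝ) (ev D (cz : ℝ) l) := h1
      have a2 : l'.length = D.len (cz : ℝ) (ev D (cz : ℝ) l') := h2
      rw [a2, ← he, ← a1, hl]
    rw [List.length_eq_zero_iff.1 hl, List.length_eq_zero_iff.1 e2]
  | succ n ih =>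
    intro l l' hl h1 h2 he f x hxP
    have a1 : l.length = D.len (cz : ℝ) (ev D (cz : ℝ) l) := h1
    have a2 : l'.length = D.len (cz : ℝ) (ev D (cz : ℝ) l') := h2
    have hl' : l'.length = n + 1 := by rw [a2, ← he, ← a1, hl]
    obtain ⟨i, L1, rfl⟩ := List.exists_cons_of_length_eq_add_one hl
    obtain ⟨j, L2, rfl⟩ := List.exists_cons_of_length_eq_add_one hl'
    have r1 := (red_cons hc hx).1 h1
    have r2 := (red_cons hc hx).1 h2
    by_cases hij : i = j
    · subst hij
      have : ev D (cz : ℝ) L1 = ev D (cz : ℝ) L2 := by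
        rw [ev_cons, ev_cons] at he; exact mul_left_cancel he
      rw [wordOp_cons, wordOp_cons]
      refine Iop_congr τ (aSimple_root D i) (fun y hy => ?_) hxP
      exact ih L1 L2 (by simpa using hl) r1.1 r2.1 this f y hy
    · set w := ev D (cz : ℝ) (i :: L1) with hwd
      have hw : w ∈ D.WR (cz : ℝ) := ev_mem _
      have di : aval (cz : ℝ) (D.aSimple i) (w x0) < 0 := by
        rw [hwd, ev_cons, Equiv.Perm.mul_apply, aval_sj]; linarith [r1.2]
      have dj : aval (cz : ℝ) (D.aSimple j) (w x0) < 0 := by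
        rw [he, ev_cons, Equiv.Perm.mul_apply, aval_sj]; linarith [r2.2]
      obtain ⟨l1, l2, b1, b2, b3, b4⟩ := rank2 hc hx hτ hw hij di dj
      have hw'' : (ev D (cz : ℝ) (i :: l1))⁻¹ * w ∈ D.WR (cz : ℝ) :=
        mul_mem (inv_mem (ev_mem _)) hw
      obtain ⟨m, hm, hml⟩ := exists_reduced hc hx hw''
      have E1 : ev D (cz : ℝ) ((i :: l1) ++ m) = w := by
        rw [ev_append, hm, mul_inv_cancel_left]
      have E2 : ev D (cz : ℝ) ((j :: l2) ++ m) = w := by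
        rw [ev_append, hm, ← b1, mul_inv_cancel_left]
      have R1 : Red D (cz : ℝ) ((i :: l1) ++ m) := by
        show List.length _ = D.len _ _
        rw [E1, ← b4, List.length_append, hml]; ring
      have R2' : Red D (cz : ℝ) ((j :: l2) ++ m) := by
        show List.length _ = D.len _ _
        rw [E2, ← b4, List.length_append, hml, List.length_cons, List.length_cons, b3]; ring
      rw [List.cons_append] at E1 E2 R1 R2'
      have q1 := (red_cons hc hx).1 R1
      have q2 := (red_cons hc hx).1 R2'
      have s1 : ∀ y, y ∈ D.weightLattice → D.wordOp (cz : ℝ) τ (i :: L1) f y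
          = D.wordOp (cz : ℝ) τ (i :: (l1 ++ m)) f y := by
        intro y hy
        rw [wordOp_cons, wordOp_cons]
        refine Iop_congr τ (aSimple_root D i) (fun z hz => ?_) hy
        refine ih L1 (l1 ++ m) (by simpa using hl) r1.1 q1.1 ?_ f z hz
        rw [hwd, ev_cons, ev_cons] at E1; exact (mul_left_cancel E1).symm
      have s2 : ∀ y, y ∈ D.weightLattice → D.wordOp (cz : ℝ) τ (j :: L2) f y
          = D.wordOp (cz : ℝ) τ (j :: (l2 ++ m)) f y := by
        intro y hy
        rw [wordOp_cons, wordOp_cons]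
        refine Iop_congr τ (aSimple_root D j) (fun z hz => ?_) hy
        refine ih L2 (l2 ++ m) (by simpa using hl') r2.1 q2.1 ?_ f z hz
        rw [he, ev_cons, ev_cons] at E2; exact (mul_left_cancel E2).symm
      rw [s1 x hxP, s2 x hxP, ← List.cons_append, ← List.cons_append, wordOp_append,
        wordOp_append]
      exact b2 _ x hxP

end AW

namespace AW
open RootSystemData
variable {V : Type*} [NormedAddCommGroup V] [InnerProductSpace ℝ V]
variable {D : RootSystemData V} {cz : ℤ} {x0 : V} {τ : V × ℤ → ℂ}

/-- Induction on positive roots through simple reflections. -/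
lemma pos_ind {p : V → Prop} (hs : ∀ j, p (D.simpleRoot j))
    (hstep : ∀ α ∈ D.pos, ∀ j, refl (D.simpleRoot j) α ∈ D.pos →
      p (refl (D.simpleRoot j) α) → p α) : ∀ α ∈ D.pos, p α := by
  obtain ⟨h, h1, h2⟩ := exists_height D
  by_contra hcon
  push Not at hcon
  obtain ⟨α0, hα0, hbad⟩ := hcon
  obtain ⟨α, hα, hmin⟩ := Finset.exists_min_image (D.pos.filter (fun α => ¬ p α))
    (fun α => ⟪h, α⟫) ⟨α0, by simp [hα0, hbad]⟩
  rw [Finset.mem_filter] at hα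
  have hαR := pos_mem D hα.1
  obtain ⟨k, hk⟩ := D.pos_natCombo α hα.1
  have : ∃ j, 0 < ⟪α, D.simpleRoot j⟫ := by
    by_contra hno
    push Not at hno
    have hpos := inner_self_pos (D.ne_zero _ hαR)
    have : ⟪α, α⟫ = ∑ j, (k j : ℝ) * ⟪α, D.simpleRoot j⟫ := by
      conv_lhs => rw [hk]
      rw [inner_sum, ← hk]
      simp [inner_smul_right]
    have h3 : ∑ j, (k j : ℝ) * ⟪α, D.simpleRoot j⟫ ≤ 0 :=
      Finset.sum_nonpos fun j _ => mul_nonpos_of_nonneg_of_nonpos (by positivity) (hno j)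
    linarith
  obtain ⟨j, hj⟩ := this
  have hne : α ≠ D.simpleRoot j := by
    intro e; exact hα.2 (e ▸ hs j)
  have hr := refl_simple_pos D j hα.1 hne
  have hnp : ¬ p (refl (D.simpleRoot j) α) := fun hp => hα.2 (hstep α hα.1 j hr hp)
  have hm := hmin _ (Finset.mem_filter.2 ⟨hr, hnp⟩)
  unfold refl at hm
  rw [inner_sub_right, inner_smul_right, h1] at hm
  have := (inner_coroot_pos (simple_ne D j)).2 hj
  linarith

lemma exists_fund (j : Fin D.n) : ∃ ω ∈ D.weightLattice, ⟪ω, coroot (D.simpleRoot j)⟫ = 1 := by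
  obtain ⟨ω, hω⟩ := exists_inner D (fun i => if i = j then ⟪D.simpleRoot i, D.simpleRoot i⟫ / 2 else 0)
  have hsim : ∀ i, ⟪ω, coroot (D.simpleRoot i)⟫ = ((if i = j then 1 else 0 : ℤ) : ℝ) := by
    intro i
    rw [inner_coroot, hω]
    have := inner_self_pos (simple_ne D i)
    split_ifs <;> field_simp <;> simp
  have hpos : ∀ α ∈ D.pos, ∃ k : ℤ, ⟪ω, coroot α⟫ = k := by
    apply pos_ind
    · intro i; exact ⟨_, hsim i⟩
    · rintro α hα i - ⟨k, hk⟩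
      rw [coroot_refl' _ (simple_ne D i), inner_sub_right, inner_smul_right, hsim i] at hk
      obtain ⟨m, hm⟩ := D.crystallographic α (pos_mem D hα) _ (simple_mem D i)
      rw [hm] at hk
      exact ⟨k + m * (if i = j then 1 else 0 : ℤ), by push_cast; push_cast at hk; linarith⟩
  refine ⟨ω, fun α hα => ?_, by rw [hsim]; simp⟩
  rcases D.pos_or_neg α hα with h | h
  · exact hpos α h
  · obtain ⟨k, hk⟩ := hpos _ h
    rw [coroot_neg, inner_neg_right] at hk
    exact ⟨-k, by push_cast; linarith⟩

lemma tau_neg (hc : (0 : ℝ) < cz) (hτ : D.IsMultiplicity (cz : ℝ) τ) {a : V × ℤ}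
    (ha : D.IsAffRoot a) : τ (-a) = τ a := by
  rw [← tau_srefl hc hτ ha ha]
  congr 1
  unfold srefl
  rw [refl_self (root_ne ha), inner_coroot_self (root_ne ha)]
  ext <;> simp; ring

lemma tau_refl (hc : (0 : ℝ) < cz) (hτ : D.IsMultiplicity (cz : ℝ) τ) {α β : V} (r : ℤ)
    (hα : α ∈ D.R0) (hβ : β ∈ D.R0) : τ (refl β α, r) = τ (α, r) := by
  rw [← tau_srefl hc hτ (a := (α, r)) (b := (β, 0)) hα hβ]
  simp [srefl]

lemma tau_shift (hc : (0 : ℝ) < cz) (hτ : D.IsMultiplicity (cz : ℝ) τ) {α : V}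
    (hα : α ∈ D.R0) : ∀ r : ℤ, τ (α, r) = τ (α, 0) := by
  have hpos : ∀ α ∈ D.pos, ∀ r : ℤ, τ (α, r) = τ (α, 0) := by
    apply pos_ind
    · intro j r
      obtain ⟨ω, hω, h1⟩ := exists_fund (D := D) j
      have hm : Equiv.addRight ((cz : ℝ) • ((-r) • ω)) ∈ D.Wext (cz : ℝ) := by
        apply Subgroup.subset_closure
        right
        exact ⟨_, P_zsmul hω _, fun x => rfl⟩
      refine (hτ.2 _ hm (D.simpleRoot j, 0) (D.simpleRoot j, r) (simple_mem D j) (simple_mem D j) ?_).symm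
      intro x
      have : (Equiv.addRight ((cz : ℝ) • ((-r) • ω)))⁻¹ x = x - (cz : ℝ) • ((-r) • ω) := by
        rw [Equiv.Perm.inv_eq_iff_eq]; simp
      rw [this, aval_sub]
      unfold aval
      rw [← Int.cast_smul_eq_zsmul ℝ, inner_smul_left, inner_smul_left]
      simp only [h1]
      simp; ring
    · intro α hα j hp h r
      have hs := simple_mem D j
      rw [← tau_refl hc hτ r (pos_mem D hα) hs, ← tau_refl hc hτ 0 (pos_mem D hα) hs]
      exact h r
  intro r
  rcases D.pos_or_neg α hα with h | h
  · exact hpos α h r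
  · rw [← tau_neg hc hτ (a := (α, r)) hα, ← tau_neg hc hτ (a := (α, 0)) hα]
    simpa using hpos _ h (-r)

lemma tau_negv (hc : (0 : ℝ) < cz) (hτ : D.IsMultiplicity (cz : ℝ) τ) {α : V}
    (hα : α ∈ D.R0) : τ (-α, 0) = τ (α, 0) := by
  rw [← tau_neg hc hτ (a := (α, 0)) hα]; simp

/-- linear isometry preserving the roots -/
structure LI (D : RootSystemData V) (g : V → V) : Prop where
  add : ∀ x y, g (x + y) = g x + g y
  smul : ∀ (t : ℝ) x, g (t • x) = t • g x
  inner : ∀ x y, ⟪g x, g y⟫ = ⟪x, y⟫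
  root : ∀ α ∈ D.R0, g α ∈ D.R0

lemma LI.refl {β : V} (hβ : β ∈ D.R0) : LI D (refl β) where
  add x y := by
    have := refl_sub β x (-y)
    rw [refl_neg] at this; simpa using this
  smul := refl_smul β
  inner := inner_refl β (D.ne_zero _ hβ)
  root α hα := refl_mem D hβ hα

lemma W0_ind {p : Equiv.Perm V → Prop} (h1 : p 1)
    (hs : ∀ β ∈ D.R0, ∀ e g : Equiv.Perm V, (∀ x, e x = refl β x) → g ∈ D.W0 → p g → p (e * g)) :
    ∀ g ∈ D.W0, p g := by
  intro g hg
  have hinv : ∀ e ∈ D.W0Gens, e⁻¹ = e := by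
    rintro e ⟨β, hβ, he⟩
    ext x
    rw [Equiv.Perm.inv_eq_iff_eq]
    have h2 : ∀ x, e x = refl β x := he
    rw [h2, h2, refl_refl (D.ne_zero _ hβ)]
  refine Subgroup.closure_induction_left (p := fun g _ => p g) h1 ?_ ?_ hg
  · rintro e ⟨β, hβ, he⟩ y hy hp
    exact hs β hβ e y he hy hp
  · rintro e he y hy hp
    rw [hinv e he]
    obtain ⟨β, hβ, he⟩ := he
    exact hs β hβ e y he hy hp

lemma W0_LI {g : Equiv.Perm V} (hg : g ∈ D.W0) : LI D g := by
  refine W0_ind (p := fun g => LI D g)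
    ⟨fun _ _ => rfl, fun _ _ => rfl, fun _ _ => rfl, fun _ h => h⟩ ?_ g hg
  intro β hβ e g he hg ih
  have L := LI.refl hβ
  refine ⟨fun x y => ?_, fun t x => ?_, fun x y => ?_, fun α hα => ?_⟩ <;>
    simp only [Equiv.Perm.mul_apply, he]
  · rw [ih.add, L.add]
  · rw [ih.smul, L.smul]
  · rw [L.inner, ih.inner]
  · exact L.root _ (ih.root _ hα)

lemma LI.coroot {g : V → V} (h : LI D g) (α : V) : coroot (g α) = g (coroot α) := by
  unfold _root_.coroot; rw [h.inner, h.smul]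

lemma tau_W0 (hc : (0 : ℝ) < cz) (hτ : D.IsMultiplicity (cz : ℝ) τ) {g : Equiv.Perm V}
    (hg : g ∈ D.W0) : ∀ α ∈ D.R0, τ (g α, 0) = τ (α, 0) := by
  refine W0_ind (p := fun g => ∀ α ∈ D.R0, τ (g α, 0) = τ (α, 0)) (fun _ _ => rfl) ?_ g hg
  intro β hβ e g he hg ih α hα
  rw [Equiv.Perm.mul_apply, he, tau_refl hc hτ 0 ((W0_LI hg).root _ hα) hβ, ih α hα]

lemma LI.P {g : Equiv.Perm V} (hg : g ∈ D.W0) {x : V} (hx : x ∈ D.weightLattice) :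
    g x ∈ D.weightLattice := by
  intro α hα
  have h := W0_LI hg
  have h' := W0_LI (inv_mem hg)
  have e : α = g (g⁻¹ α) := (p_apply_inv g α).symm
  rw [e, h.coroot, h.inner]
  exact hx _ (h'.root _ hα)

lemma linPart_pull {w : Equiv.Perm V} (hw : w ∈ D.WR (cz : ℝ)) {a : V × ℤ} (ha : D.IsAffRoot a) :
    linPart w (pull D (cz : ℝ) w a).1 = a.1 := by
  obtain ⟨⟨g, hg, hgl⟩, hadd⟩ := linPart_spec hw
  have L := W0_LI hg
  have hb := pull_root hw ha
  set b := pull D (cz : ℝ) w a with hbd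
  rw [hgl]
  apply coroot_inj (D.ne_zero _ (L.root _ hb)) (root_ne ha)
  have key : ∀ y, ⟪y, coroot b.1⟫ = ⟪g y, coroot a.1⟫ := by
    intro y
    have e1 := aval_pull hw ha (0 + y)
    have e2 := aval_pull hw ha (0 : V)
    rw [hadd, aval_add, aval_add, e2, hgl] at e1
    linarith
  apply ext_inner_left ℝ
  intro v
  have : v = g (g⁻¹ v) := (p_apply_inv g v).symm
  rw [this, L.coroot, L.inner, key]

lemma lin_w {w : Equiv.Perm V} (hw : w ∈ D.WR (cz : ℝ)) (x : V) (t : ℝ) (y : V) :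
    w (x + t • y) = w x + t • linPart w y := by
  obtain ⟨⟨g, hg, hgl⟩, hadd⟩ := linPart_spec hw
  rw [hadd, hgl, (W0_LI hg).smul, ← hgl]

lemma WR_P {w : Equiv.Perm V} (hw : w ∈ D.WR (cz : ℝ)) :
    ∀ x ∈ D.weightLattice, w x ∈ D.weightLattice := by
  refine WR_ind (p := fun w => ∀ x ∈ D.weightLattice, w x ∈ D.weightLattice)
    (fun _ h => h) ?_ w hw
  intro a w ha hw ih x hx
  rw [Equiv.Perm.mul_apply, sP_apply _ _ (root_ne ha)]
  exact P_sAff ha (ih x hx)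

end AW

namespace AW
open RootSystemData
variable {V : Type*} [NormedAddCommGroup V] [InnerProductSpace ℝ V]
variable {D : RootSystemData V} {cz : ℤ} {x0 : V} {τ : V × ℤ → ℂ}

/-- a chosen reduced word -/
def rword (D : RootSystemData V) (c : ℝ) (w : Equiv.Perm V) : List (Fin (D.n + 1)) :=
  if h : ∃ l, ev D c l = w ∧ l.length = D.len c w then h.choose else []

/-- the operator attached to a group element -/
def Op (D : RootSystemData V) (cz : ℤ) (τ : V × ℤ → ℂ) (w : Equiv.Perm V) (f : V → ℂ) : V → ℂ :=
  D.wordOp (cz : ℝ) τ (rword D (cz : ℝ) w) f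

lemma rword_spec (hc : (0 : ℝ) < cz) (hx : IsX0 D (cz : ℝ) x0) {w : Equiv.Perm V}
    (hw : w ∈ D.WR (cz : ℝ)) :
    ev D (cz : ℝ) (rword D (cz : ℝ) w) = w ∧ Red D (cz : ℝ) (rword D (cz : ℝ) w) := by
  have h := exists_reduced hc hx hw
  have e : rword D (cz : ℝ) w = h.choose := by unfold rword; rw [dif_pos h]
  rw [e]
  refine ⟨h.choose_spec.1, ?_⟩
  show List.length _ = D.len _ _
  rw [h.choose_spec.1, h.choose_spec.2]

lemma Op_word (hc : (0 : ℝ) < cz) (hx : IsX0 D (cz : ℝ) x0) (hτ : D.IsMultiplicity (cz : ℝ) τ)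
    {l : List (Fin (D.n + 1))} (hl : Red D (cz : ℝ) l) (f : V → ℂ) {x : V}
    (hxP : x ∈ D.weightLattice) :
    D.wordOp (cz : ℝ) τ l f x = Op D cz τ (ev D (cz : ℝ) l) f x := by
  obtain ⟨h1, h2⟩ := rword_spec hc hx (ev_mem (D := D) (c := (cz : ℝ)) l)
  exact matsumoto hc hx hτ _ l _ rfl hl h2 h1.symm f x hxP

lemma Op_one (hc : (0 : ℝ) < cz) (hx : IsX0 D (cz : ℝ) x0) (f : V → ℂ) : Op D cz τ 1 f = f := by
  obtain ⟨h1, h2⟩ := rword_spec hc hx (one_mem (D.WR (cz : ℝ)))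
  have h3 : (rword D (cz : ℝ) 1).length = D.len (cz : ℝ) (ev D (cz : ℝ) (rword D (cz : ℝ) 1)) := h2
  rw [h1, len_one hx] at h3
  unfold Op
  rw [List.length_eq_zero_iff.1 h3, wordOp_nil]

lemma Op_mul (hc : (0 : ℝ) < cz) (hx : IsX0 D (cz : ℝ) x0) (hτ : D.IsMultiplicity (cz : ℝ) τ)
    {v w : Equiv.Perm V} (hv : v ∈ D.WR (cz : ℝ)) (hw : w ∈ D.WR (cz : ℝ))
    (h : Addi D (cz : ℝ) v w) (f : V → ℂ) {x : V} (hxP : x ∈ D.weightLattice) :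
    Op D cz τ (v * w) f x = Op D cz τ v (Op D cz τ w f) x := by
  obtain ⟨h1, h2⟩ := rword_spec hc hx hv
  obtain ⟨h3, h4⟩ := rword_spec hc hx hw
  have e : ev D (cz : ℝ) (rword D (cz : ℝ) v ++ rword D (cz : ℝ) w) = v * w := by
    rw [ev_append, h1, h3]
  have hR : Red D (cz : ℝ) (rword D (cz : ℝ) v ++ rword D (cz : ℝ) w) := by
    show List.length _ = D.len _ _
    have a1 : List.length _ = D.len _ _ := h2
    have a2 : List.length _ = D.len _ _ := h4
    rw [h1] at a1
    rw [h3] at a2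
    rw [e, len_mul hc hx hv hw h, List.length_append, a1, a2]
  have := Op_word hc hx hτ hR f hxP
  rw [e, wordOp_append] at this
  rw [← this]; rfl

lemma Op_sj (hc : (0 : ℝ) < cz) (hx : IsX0 D (cz : ℝ) x0) (hτ : D.IsMultiplicity (cz : ℝ) τ)
    (j : Fin (D.n + 1)) (f : V → ℂ) {x : V} (hxP : x ∈ D.weightLattice) :
    Op D cz τ (sj D (cz : ℝ) j) f x = Iop (cz : ℝ) τ (D.aSimple j) f x := by
  have e : ev D (cz : ℝ) [j] = sj D (cz : ℝ) j := by rw [ev_cons, ev_nil, mul_one]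
  have hR : Red D (cz : ℝ) [j] := by
    show List.length _ = D.len _ _
    rw [e, len_sj hx]; rfl
  have := Op_word hc hx hτ hR f hxP
  rw [e] at this
  rw [← this]; rfl

lemma Op_asc (hc : (0 : ℝ) < cz) (hx : IsX0 D (cz : ℝ) x0) (hτ : D.IsMultiplicity (cz : ℝ) τ)
    {w : Equiv.Perm V} (hw : w ∈ D.WR (cz : ℝ)) {j : Fin (D.n + 1)}
    (h : 0 < aval (cz : ℝ) (D.aSimple j) (w x0)) (f : V → ℂ) {x : V} (hxP : x ∈ D.weightLattice) :
    Op D cz τ (sj D (cz : ℝ) j * w) f x = Iop (cz : ℝ) τ (D.aSimple j) (Op D cz τ w f) x := by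
  rw [Op_mul hc hx hτ (sj_mem j) hw (addi_sj hx hw h) f hxP, Op_sj hc hx hτ j _ hxP]

lemma Op_congr {w : Equiv.Perm V} {f g : V → ℂ} (h : ∀ x ∈ D.weightLattice, f x = g x) {x : V}
    (hx : x ∈ D.weightLattice) : Op D cz τ w f x = Op D cz τ w g x :=
  wordOp_congr τ _ h hx

lemma Iop_zero {a : V × ℤ} {f : V → ℂ} {x : V} (h : aval (cz : ℝ) a x = 0) :
    Iop (cz : ℝ) τ a f x = τ a * f x := by
  unfold Iop Jop sAff; rw [h]; simp

lemma Iop_m1 {a : V × ℤ} {f : V → ℂ} {y : V} (h0 : a.1 ≠ 0) (h : aval (cz : ℝ) a y = -1) :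
    Iop (cz : ℝ) τ a f (sAff (cz : ℝ) a y) = (τ a)⁻¹ * f y := by
  unfold Iop
  have e : aval (cz : ℝ) a (sAff (cz : ℝ) a y) = 1 := by
    rw [aval_sAff, inner_coroot_self h0, h]; norm_num
  rw [sAff_invol _ _ h0 y]
  unfold Jop
  rw [e]
  have e2 : sAff (cz : ℝ) a y = y + a.1 := by unfold sAff; rw [h]; module
  simp [e2]; ring

lemma Iop_m2 {a : V × ℤ} {f : V → ℂ} {y : V} (h0 : a.1 ≠ 0) (h : aval (cz : ℝ) a y = -2) :
    Iop (cz : ℝ) τ a f (sAff (cz : ℝ) a y) = (τ a)⁻¹ * f y - (τ a - (τ a)⁻¹) * f (y + a.1) := by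
  unfold Iop
  have e : aval (cz : ℝ) a (sAff (cz : ℝ) a y) = 2 := by
    rw [aval_sAff, inner_coroot_self h0, h]; norm_num
  rw [sAff_invol _ _ h0 y]
  unfold Jop
  rw [e]
  have e2 : sAff (cz : ℝ) a y = y + a.1 + a.1 := by unfold sAff; rw [h]; module
  have e3 : Finset.Icc (1 : ℤ) ⌊(2 : ℝ)⌋ = {1, 2} := by
    rw [show ⌊(2 : ℝ)⌋ = 2 by norm_num]; rfl
  have e4 : y + a.1 + a.1 - (2 : ℤ) • a.1 = y := by
    rw [two_zsmul]; abel
  rw [e2, e3, Finset.sum_pair (by norm_num), e4]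
  simp; ring

lemma Op_vanish (hc : (0 : ℝ) < cz) (hx : IsX0 D (cz : ℝ) x0) (hτ : D.IsMultiplicity (cz : ℝ) τ)
    (g : V → ℂ) {x : V} (hxP : x ∈ D.weightLattice) : ∀ w ∈ D.WR (cz : ℝ),
    (∀ a ∈ D.RW (cz : ℝ) w, aval (cz : ℝ) a x = 0) →
    Op D cz τ w g x = D.tauw (cz : ℝ) τ w * g x := by
  refine wr_induction hc hx ?_ ?_
  · intro _; rw [Op_one hc hx, tauw_one hx, one_mul]
  · intro j w hw hasc ih hall
    rw [RW_asc hc hx hw hasc] at hall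
    have h1 : ∀ a ∈ D.RW (cz : ℝ) w, aval (cz : ℝ) a x = 0 := fun a ha => hall a (Or.inl ha)
    have h2 := hall _ (Or.inr rfl)
    rw [aval_pull hw (aSimple_root D j), fix_of_vanish hc hx hw h1] at h2
    rw [Op_asc hc hx hτ hw hasc g hxP, Iop_zero h2, ih h1, tauw_asc hc hx hτ hw hasc, mul_assoc]

lemma Op_m1 (hc : (0 : ℝ) < cz) (hx : IsX0 D (cz : ℝ) x0) (hτ : D.IsMultiplicity (cz : ℝ) τ)
    (g : V → ℂ) {y : V} (hyP : y ∈ D.weightLattice) : ∀ w ∈ D.WR (cz : ℝ),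
    (∀ a ∈ D.RW (cz : ℝ) w, aval (cz : ℝ) a y = -1) →
    Op D cz τ w g (w y) = (D.tauw (cz : ℝ) τ w)⁻¹ * g y := by
  refine wr_induction hc hx ?_ ?_
  · intro _; rw [Op_one hc hx, tauw_one hx]; simp
  · intro j w hw hasc ih hall
    rw [RW_asc hc hx hw hasc] at hall
    have h2 := hall _ (Or.inr rfl)
    rw [aval_pull hw (aSimple_root D j)] at h2
    have hP := WR_P (mul_mem (sj_mem j) hw) y hyP
    rw [Op_asc hc hx hτ hw hasc g hP, Equiv.Perm.mul_apply, sj_apply, Iop_m1 (aSimple_ne D j) h2,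
      ih (fun a ha => hall a (Or.inl ha)), tauw_asc hc hx hτ hw hasc, mul_inv, mul_assoc]

lemma not_mem_RW_pull (hx : IsX0 D (cz : ℝ) x0) {w : Equiv.Perm V} (hw : w ∈ D.WR (cz : ℝ))
    (j : Fin (D.n + 1)) : pull D (cz : ℝ) w (D.aSimple j) ∉ D.RW (cz : ℝ) w := by
  intro h
  have h1 := ((mem_RW hx hw).1 h).2.2
  rw [aval_pull hw (aSimple_root D j), p_apply_inv] at h1
  linarith [hx.pos (aSimple_pos D j)]

lemma Op_m2 (hc : (0 : ℝ) < cz) (hx : IsX0 D (cz : ℝ) x0) (hτ : D.IsMultiplicity (cz : ℝ) τ)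
    (g : V → ℂ) {x : V} (hxP : x ∈ D.weightLattice) {b : V × ℤ} (hb : D.IsAffRoot b)
    (hby : aval (cz : ℝ) b (x - b.1) = -2) :
    ∀ w ∈ D.WR (cz : ℝ), (∀ a ∈ D.RW (cz : ℝ) w, aval (cz : ℝ) a x = 0) →
    (∀ a ∈ D.RW (cz : ℝ) w, aval (cz : ℝ) a (x - b.1) = -1 ∨ a = b) → b ∈ D.RW (cz : ℝ) w →
    ∃ u ∈ D.WR (cz : ℝ), (∀ a ∈ D.RW (cz : ℝ) u, a ∈ D.RW (cz : ℝ) w ∧ a ≠ b) ∧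
      (∃ j, pull D (cz : ℝ) u (D.aSimple j) = b) ∧
      Op D cz τ w g (w (x - b.1)) = (D.tauw (cz : ℝ) τ w)⁻¹ * g (x - b.1)
        - (D.tauw (cz : ℝ) τ w)⁻¹ * ((τ b - (τ b)⁻¹) * τ b * D.tauw (cz : ℝ) τ u ^ 2) * g x := by
  have hyP : x - b.1 ∈ D.weightLattice := P_sub hxP (P_root hb)
  refine wr_induction hc hx ?_ ?_
  · intro _ _ hmem; rw [RW_one hx] at hmem; exact absurd hmem (Set.notMem_empty _)
  · intro j w hw hasc ih hvan hall hmem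
    rw [RW_asc hc hx hw hasc] at hvan hall hmem
    have hv1 : ∀ a ∈ D.RW (cz : ℝ) w, aval (cz : ℝ) a x = 0 := fun a ha => hvan a (Or.inl ha)
    have ha1 := fun a (ha : a ∈ D.RW (cz : ℝ) w) => hall a (Or.inl ha)
    have hfix := fix_of_vanish hc hx hw hv1
    have hP := WR_P (mul_mem (sj_mem j) hw) _ hyP
    have hroot := aSimple_root D j
    have hbj : τ (pull D (cz : ℝ) w (D.aSimple j)) = τ (D.aSimple j) := tau_pull hτ hw hroot
    have hwne := tauw_ne hx hτ hw
    have hjne := hτ.1 _ hroot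
    by_cases hbp : b = pull D (cz : ℝ) w (D.aSimple j)
    · have hbw : b ∉ D.RW (cz : ℝ) w := by rw [hbp]; exact not_mem_RW_pull hx hw j
      have hne : ∀ a ∈ D.RW (cz : ℝ) w, a ≠ b := fun a ha e => hbw (e ▸ ha)
      refine ⟨w, hw, fun a ha => ⟨by rw [RW_asc hc hx hw hasc]; exact Or.inl ha, hne a ha⟩,
        ⟨j, hbp.symm⟩, ?_⟩
      have hm1 := Op_m1 hc hx hτ g hyP w hw (fun a ha => (ha1 a ha).resolve_right (hne a ha))
      have h2 : aval (cz : ℝ) (D.aSimple j) (w (x - b.1)) = -2 := by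
        rw [← aval_pull hw hroot, ← hbp, hby]
      have h3 : w (x - b.1) + (D.aSimple j).1 = x := by
        rw [w_sub hw, hfix]
        nth_rewrite 1 [hbp]
        rw [linPart_pull hw hroot]; abel
      rw [Op_asc hc hx hτ hw hasc g hP, Equiv.Perm.mul_apply, sj_apply,
        Iop_m2 (aSimple_ne D j) h2, h3, hm1, Op_vanish hc hx hτ g hxP w hw hv1,
        tauw_asc hc hx hτ hw hasc, hbp, hbj]
      field_simp
    · have hbw : b ∈ D.RW (cz : ℝ) w := hmem.resolve_right hbp
      obtain ⟨u, hu, hu1, hu2, hu3⟩ := ih hv1 ha1 hbw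
      refine ⟨u, hu, fun a ha => ⟨by rw [RW_asc hc hx hw hasc]; exact Or.inl (hu1 a ha).1,
        (hu1 a ha).2⟩, hu2, ?_⟩
      have h2 := (hall _ (Or.inr rfl)).resolve_right (Ne.symm hbp)
      rw [aval_pull hw hroot] at h2
      rw [Op_asc hc hx hτ hw hasc g hP, Equiv.Perm.mul_apply, sj_apply,
        Iop_m1 (aSimple_ne D j) h2, hu3, tauw_asc hc hx hτ hw hasc, mul_inv]
      ring

/-- cutting a reduced decomposition at an inversion -/
lemma cut (hc : (0 : ℝ) < cz) (hx : IsX0 D (cz : ℝ) x0) {b : V × ℤ} :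
    ∀ w ∈ D.WR (cz : ℝ), b ∈ D.RW (cz : ℝ) w →
    ∃ v ∈ D.WR (cz : ℝ), ∃ u ∈ D.WR (cz : ℝ), ∃ j, w = v * (sj D (cz : ℝ) j * u) ∧
      (∀ a ∈ D.RW (cz : ℝ) u, a ∈ D.RW (cz : ℝ) w ∧ a ≠ b) ∧ pull D (cz : ℝ) u (D.aSimple j) = b ∧
      0 < aval (cz : ℝ) (D.aSimple j) (u x0) ∧
      D.len (cz : ℝ) (sj D (cz : ℝ) j * u) ≤ D.len (cz : ℝ) w := by
  refine wr_induction hc hx ?_ ?_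
  · intro h; rw [RW_one hx] at h; exact absurd h (Set.notMem_empty _)
  · intro j w hw hasc ih hmem
    rw [RW_asc hc hx hw hasc] at hmem
    by_cases hbw : b ∈ D.RW (cz : ℝ) w
    · obtain ⟨v, hv, u, hu, i, e, h1, h2, h3, h4⟩ := ih hbw
      refine ⟨sj D (cz : ℝ) j * v, mul_mem (sj_mem j) hv, u, hu, i, by rw [e, mul_assoc], ?_, h2, h3, ?_⟩
      · intro a ha
        rw [RW_asc hc hx hw hasc]
        exact ⟨Or.inl (h1 a ha).1, (h1 a ha).2⟩
      · rw [len_asc hc hx hw hasc]; omega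
    · have hbp := hmem.resolve_left hbw
      refine ⟨1, one_mem _, w, hw, j, by rw [one_mul], ?_, hbp.symm, hasc, le_rfl⟩
      intro a ha
      rw [RW_asc hc hx hw hasc]
      exact ⟨Or.inl ha, fun e => hbw (e ▸ ha)⟩

lemma Op_alcove (hc : (0 : ℝ) < cz) (hx : IsX0 D (cz : ℝ) x0) (hτ : D.IsMultiplicity (cz : ℝ) τ)
    {wmin : V → Equiv.Perm V} (hwmin : D.IsWmin (cz : ℝ) wmin) (f : V → ℂ) {x : V}
    (hxP : x ∈ D.weightLattice) {w : Equiv.Perm V} (hw : w ∈ D.WR (cz : ℝ))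
    (hA : w x ∈ D.alcove (cz : ℝ)) :
    Op D cz τ w f (w x) = D.tauw (cz : ℝ) τ w *
      ((D.tauw (cz : ℝ) τ (wmin x))⁻¹ * Op D cz τ (wmin x) f (wmin x x)) := by
  obtain ⟨h1, h2, h3⟩ := wmin_factor hc hx hwmin hw hA
  have hm := (hwmin x).1
  have hv : w * (wmin x)⁻¹ ∈ D.WR (cz : ℝ) := mul_mem hw (inv_mem hm)
  have e : w = (w * (wmin x)⁻¹) * wmin x := by group
  have hP := WR_P hm x hxP
  have t := tauw_mul hc hx hτ hv hm h2
  have o := Op_mul hc hx hτ hv hm h2 f hP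
  rw [← e] at t o
  rw [h1, o, Op_vanish hc hx hτ _ hP _ hv h3, t]
  have := tauw_ne hx hτ hm
  field_simp

end AW

namespace AW
open RootSystemData
variable {V : Type*} [NormedAddCommGroup V] [InnerProductSpace ℝ V]
variable {D : RootSystemData V} {cz : ℤ} {x0 : V} {τ : V × ℤ → ℂ}

lemma pos_iff (hx : IsX0 D (cz : ℝ) x0) {a : V × ℤ} (ha : D.IsAffRoot a) :
    D.IsAffPos a ↔ 0 < aval (cz : ℝ) a x0 := (hx a ha).1

lemma sig_val {a b : V × ℤ} (ha : D.IsAffRoot a) (hb : D.IsAffRoot b)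
    (h1 : ⟪b.1, coroot a.1⟫ = 1) (x : V) :
    aval (cz : ℝ) (-srefl b a) x = aval (cz : ℝ) b x - aval (cz : ℝ) a x := by
  rw [aval_neg, aval_srefl D _ ha hb, aval_sAff, h1]; ring

lemma sig_pair {a b : V × ℤ} (hb : D.IsAffRoot b)
    (h1 : ⟪b.1, coroot a.1⟫ = 1) : ⟪b.1, coroot (srefl b a).1⟫ = -1 := by
  show ⟪b.1, coroot (refl b.1 a.1)⟫ = -1
  rw [coroot_refl' _ (root_ne hb), inner_sub_right, inner_smul_right, inner_coroot_self (root_ne hb), h1]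
  norm_num

lemma sig_pair' {a b : V × ℤ} (hb : D.IsAffRoot b)
    (h1 : ⟪b.1, coroot a.1⟫ = 1) : ⟪b.1, coroot (-srefl b a).1⟫ = 1 := by
  rw [Prod.fst_neg, coroot_neg, inner_neg_right, sig_pair hb h1]; norm_num

lemma sig_sig (hc : (0 : ℝ) < cz) {a b : V × ℤ} (ha : D.IsAffRoot a) (hb : D.IsAffRoot b)
    (h1 : ⟪b.1, coroot a.1⟫ = 1) : -srefl b (-srefl b a) = a := by
  have h2 : D.IsAffRoot (-srefl b a) := neg_root (srefl_mem D ha hb)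
  refine aval_ext hc (neg_root (srefl_mem D h2 hb)) ha (fun x => ?_)
  rw [sig_val h2 hb (sig_pair' hb h1), sig_val ha hb h1]; ring

lemma tauu_sq (hc : (0 : ℝ) < cz) (hx : IsX0 D (cz : ℝ) x0) (hτ : D.IsMultiplicity (cz : ℝ) τ)
    {u : Equiv.Perm V} (hu : u ∈ D.WR (cz : ℝ)) {b : V × ℤ} (hb : D.IsAffRoot b)
    {j : Fin (D.n + 1)} (hj : pull D (cz : ℝ) u (D.aSimple j) = b)
    (hall : ∀ a ∈ D.RW (cz : ℝ) u, ⟪b.1, coroot a.1⟫ = 1) (S : Finset (V × ℤ))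
    (hS : ∀ a, a ∈ S ↔ D.IsAffPos a ∧ ⟪b.1, coroot a.1⟫ = 1 ∧ D.IsAffPos (-srefl b a)) :
    D.tauw (cz : ℝ) τ u ^ 2 = ∏ a ∈ S, τ a := by
  have hroot := aSimple_root D j
  have hfin := RW_finite hc hx hu
  set U := hfin.toFinset with hU
  have hmU : ∀ a, a ∈ U ↔ D.IsAffRoot a ∧ 0 < aval (cz : ℝ) a x0 ∧ aval (cz : ℝ) a (u⁻¹ x0) < 0 := by
    intro a; rw [hU, Set.Finite.mem_toFinset, mem_RW hx hu]
  have hallU : ∀ a ∈ U, ⟪b.1, coroot a.1⟫ = 1 := fun a ha => hall a (hfin.mem_toFinset.1 ha)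
  have hby : 0 < aval (cz : ℝ) b (u⁻¹ x0) := by
    rw [← hj, aval_pull hu hroot, p_apply_inv]; exact hx.pos (aSimple_pos D j)
  have hsx : ∀ a ∈ U, 0 < aval (cz : ℝ) (-srefl b a) x0 := by
    intro a ha
    obtain ⟨h1, h2, h3⟩ := (hmU a).1 ha
    have hr := srefl_mem D h1 hb
    by_contra hcon
    have hne := hx.ne hr
    have hv := sig_val (cz := cz) h1 hb (hallU a ha) (u⁻¹ x0)
    rw [aval_neg] at hv hcon
    have : srefl b a ∈ U := (hmU _).2 ⟨hr, lt_of_le_of_ne (by linarith) hne.symm, by linarith⟩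
    have e := hallU _ this
    rw [sig_pair hb (hallU a ha)] at e
    norm_num at e
  have hSU : S = U ∪ U.image (fun a => -srefl b a) := by
    ext a
    rw [hS, Finset.mem_union, Finset.mem_image]
    constructor
    · rintro ⟨hp, h1, hq⟩
      have ha : D.IsAffRoot a := hp.1
      have hr := neg_root (srefl_mem D ha hb)
      have hax := hx.pos hp
      have hqx := hx.pos hq
      by_cases h : aval (cz : ℝ) a (u⁻¹ x0) < 0
      · exact Or.inl ((hmU a).2 ⟨ha, hax, h⟩)
      · right
        refine ⟨-srefl b a, (hmU _).2 ⟨hr, hqx, ?_⟩, sig_sig hc ha hb h1⟩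
        have hane := aval_w_ne hx (inv_mem hu) ha
        have hapos : 0 < aval (cz : ℝ) a (u⁻¹ x0) := lt_of_le_of_ne (not_lt.1 h) hane.symm
        by_contra hcon
        have hu' := inv_mem hu
        set a' := pull D (cz : ℝ) u⁻¹ a with ha'
        have hra' : D.IsAffRoot a' := pull_root hu' ha
        have hpa' : D.IsAffPos a' := (pos_iff hx hra').2 (by rw [ha', aval_pull hu' ha]; exact hapos)
        have hne : a' ≠ D.aSimple j := by
          intro e
          have : a = b := by
            rw [← hj, ← e, ha', pull_pull_inv hc hu ha]
          rw [this, inner_coroot_self (root_ne hb)] at h1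
          norm_num at h1
        have h5 := hx.pos (srefl_simple_pos D j hpa' hne)
        rw [aval_srefl D _ hra' hroot, ha', aval_pull hu' ha] at h5
        have h6 : u (sAff (cz : ℝ) b (u⁻¹ x0)) = sAff (cz : ℝ) (D.aSimple j) x0 := by
          unfold sAff
          rw [sub_eq_add_neg, ← neg_smul, lin_w hu, p_apply_inv]
          rw [show linPart u b.1 = (D.aSimple j).1 by rw [← hj, linPart_pull hu hroot]]
          rw [show aval (cz : ℝ) b (u⁻¹ x0) = aval (cz : ℝ) (D.aSimple j) x0 by
            rw [← hj, aval_pull hu hroot, p_apply_inv]]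
          module
        rw [← h6, p_inv_apply, aval_sAff, h1] at h5
        rw [sig_val ha hb h1] at hcon
        linarith
    · rintro (h | ⟨a0, h0, rfl⟩)
      · obtain ⟨h1, h2, h3⟩ := (hmU a).1 h
        exact ⟨(pos_iff hx h1).2 h2, hallU a h,
          (pos_iff hx (neg_root (srefl_mem D h1 hb))).2 (hsx a h)⟩
      · obtain ⟨h1, h2, h3⟩ := (hmU a0).1 h0
        refine ⟨(pos_iff hx (neg_root (srefl_mem D h1 hb))).2 (hsx a0 h0), sig_pair' hb (hallU a0 h0), ?_⟩
        rw [sig_sig hc h1 hb (hallU a0 h0)]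
        exact (pos_iff hx h1).2 h2
  have hdisj : Disjoint U (U.image (fun a => -srefl b a)) := by
    rw [Finset.disjoint_left]
    intro a ha h
    obtain ⟨a0, h0, rfl⟩ := Finset.mem_image.1 h
    obtain ⟨h1, h2, h3⟩ := (hmU a0).1 h0
    have := ((hmU _).1 ha).2.2
    rw [sig_val h1 hb (hallU a0 h0)] at this
    linarith
  have hU1 : D.tauw (cz : ℝ) τ u = ∏ a ∈ U, τ a := by
    unfold RootSystemData.tauw
    rw [finprod_mem_eq_finite_toFinset_prod _ hfin]
  rw [hSU, Finset.prod_union hdisj, Finset.prod_image, sq, hU1]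
  · congr 1
    refine Finset.prod_congr rfl (fun a ha => ?_)
    have h1 := ((hmU a).1 ha).1
    rw [tau_neg hc hτ (srefl_mem D h1 hb), tau_srefl hc hτ h1 hb]
  · intro a ha a2 ha2 h
    have := congrArg (fun z => -srefl b z) h
    simp only at this
    rwa [sig_sig hc ((hmU a).1 ha).1 hb (hallU a ha), sig_sig hc ((hmU a2).1 ha2).1 hb (hallU a2 ha2)] at this

/-- The weights to which the fundamental identity applies. -/
structure Good (D : RootSystemData V) (ν : V) : Prop where
  P : ν ∈ D.weightLattice
  ne : ν ≠ 0
  pair : ∀ α ∈ D.R0, |⟪ν, coroot α⟫| ≤ 1 ∨ α = ν ∨ α = -ν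
  orb : ν ∈ D.R0 → ∃ g ∈ D.W0, g D.hshort = ν

lemma Good.map {ν : V} (h : Good D ν) {g : Equiv.Perm V} (hg : g ∈ D.W0) : Good D (g ν) := by
  have L := W0_LI hg
  have L' := W0_LI (inv_mem hg)
  have hneg : ∀ x, g (-x) = -g x := fun x => by
    have := L.smul (-1) x; simpa using this
  refine ⟨LI.P hg h.P, ?_, ?_, ?_⟩
  · intro e
    apply h.ne
    have h0 : g 0 = 0 := by have := L.smul 0 0; simpa using this
    exact g.injective (e.trans h0.symm)
  · intro α hα
    have e : α = g (g⁻¹ α) := (p_apply_inv g α).symm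
    rw [e, L.coroot, L.inner]
    rcases h.pair _ (L'.root _ hα) with h1 | h1 | h1
    · exact Or.inl h1
    · right; left; rw [h1]
    · right; right; rw [h1, hneg]
  · intro hr
    have := L'.root _ hr
    rw [p_inv_apply] at this
    obtain ⟨g', hg', e⟩ := h.orb this
    exact ⟨g * g', mul_mem hg hg', by rw [Equiv.Perm.mul_apply, e]⟩

lemma good_hshort : Good D D.hshort := by
  refine ⟨P_root (hshort_mem0 D), hshort_ne D, fun α hα => ?_, fun _ => ⟨1, one_mem _, rfl⟩⟩
  by_cases h1 : α = D.hshort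
  · exact Or.inr (Or.inl h1)
  by_cases h2 : α = -D.hshort
  · exact Or.inr (Or.inr h2)
  exact Or.inl (short_pair D hα (hshort_mem0 D) (D.hshort_short α hα) h1 h2)

/-- integer pairing trichotomy -/
lemma Good.cases {η : V} (h : Good D η) {α : V} (hα : α ∈ D.R0) :
    (α = η ∧ ⟪η, coroot α⟫ = 2) ∨ (α = -η ∧ ⟪η, coroot α⟫ = -2) ∨
    ⟪η, coroot α⟫ = 1 ∨ ⟪η, coroot α⟫ = 0 ∨ ⟪η, coroot α⟫ = -1 := by
  rcases h.pair α hα with h1 | rfl | rfl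
  · right; right
    obtain ⟨k, hk⟩ := h.P α hα
    rw [hk] at h1 ⊢
    have h2 : |k| ≤ 1 := by exact_mod_cast h1
    have h3 := abs_le.1 h2
    obtain rfl | rfl | rfl : k = 1 ∨ k = 0 ∨ k = -1 := by omega
    · left; norm_num
    · right; left; norm_num
    · right; right; norm_num
  · left; exact ⟨rfl, inner_coroot_self h.ne⟩
  · right; left
    refine ⟨rfl, ?_⟩
    rw [coroot_neg, inner_neg_right, inner_coroot_self h.ne]

/-- products over positive roots with given pairing -/
def PP (D : RootSystemData V) (τ : V × ℤ → ℂ) (η : V) (k : ℝ) : ℂ :=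
  ∏ α ∈ D.pos.filter (fun α => ⟪η, coroot α⟫ = k), τ (α, 0)

lemma PP_ne (hτ : D.IsMultiplicity (cz : ℝ) τ) (η : V) (k : ℝ) : PP D τ η k ≠ 0 := by
  unfold PP
  rw [Finset.prod_ne_zero_iff]
  intro α hα
  exact hτ.1 _ (show α ∈ D.R0 from pos_mem D (Finset.mem_filter.1 hα).1)

lemma etau_eq (hτ : D.IsMultiplicity (cz : ℝ) τ) {η : V} (h : Good D η) :
    D.etau τ η = (if η ∈ D.pos then τ (η, 0) ^ 2 else 1) *
      (if -η ∈ D.pos then (τ (-η, 0) ^ 2)⁻¹ else 1) * PP D τ η 1 * (PP D τ η (-1))⁻¹ := by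
  unfold RootSystemData.etau PP
  rw [Finset.prod_filter, Finset.prod_filter, ← Finset.prod_inv_distrib,
    ← Finset.prod_ite_eq D.pos η (fun α => τ (α, 0) ^ 2),
    ← Finset.prod_ite_eq D.pos (-η) (fun α => (τ (α, 0) ^ 2)⁻¹),
    ← Finset.prod_mul_distrib, ← Finset.prod_mul_distrib, ← Finset.prod_mul_distrib]
  refine Finset.prod_congr rfl (fun α hα => ?_)
  have hαR := pos_mem D hα
  have h2 : (2 : ℝ) ≠ 1 := by norm_num
  have hη : η ≠ -η := by
    intro e
    have : (2 : ℝ) • η = 0 := by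
      rw [two_smul]; nth_rewrite 1 [e]; simp
    rcases smul_eq_zero.1 this with h' | h'
    · norm_num at h'
    · exact h.ne h'
  have hz : ∀ x : ℂ, x ^ ((-2 : ℤ)) = (x ^ 2)⁻¹ := fun x => by
    rw [zpow_neg]; rfl
  rcases h.cases hαR with ⟨e, hp⟩ | ⟨e, hp⟩ | hp | hp | hp
  · rw [hp, if_pos e.symm, if_neg (by rw [e]; exact hη.symm), if_neg (by norm_num), if_neg (by norm_num)]
    rw [show ⌊(2 : ℝ)⌋ = 2 by norm_num]
    simp
  · rw [hp, if_neg (by rw [e]; exact hη), if_pos e.symm, if_neg (by norm_num), if_neg (by norm_num)]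
    rw [show ⌊(-2 : ℝ)⌋ = -2 by norm_num, hz]
    simp
  all_goals
    have n1 : η ≠ α := by
      rintro rfl; rw [inner_coroot_self h.ne] at hp; norm_num at hp
    have n2 : -η ≠ α := by
      rintro rfl; rw [coroot_neg, inner_neg_right, inner_coroot_self h.ne] at hp; norm_num at hp
    rw [hp, if_neg n1, if_neg n2]
    norm_num

/-- product over all roots with pairing one -/
def MM (D : RootSystemData V) (τ : V × ℤ → ℂ) (η : V) : ℂ :=
  ∏ α ∈ D.R0.filter (fun α => ⟪η, coroot α⟫ = 1), τ (α, 0)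

lemma MM_W0 (hc : (0 : ℝ) < cz) (hτ : D.IsMultiplicity (cz : ℝ) τ) {g : Equiv.Perm V}
    (hg : g ∈ D.W0) (η : V) : MM D τ (g η) = MM D τ η := by
  have L := W0_LI hg
  have L' := W0_LI (inv_mem hg)
  unfold MM
  symm
  refine Finset.prod_bij (fun α _ => g α) ?_ ?_ ?_ ?_
  · intro α hα
    rw [Finset.mem_filter] at hα ⊢
    exact ⟨L.root _ hα.1, by rw [L.coroot, L.inner]; exact hα.2⟩
  · intro a _ b _ h; exact g.injective h
  · intro α hα
    rw [Finset.mem_filter] at hα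
    refine ⟨g⁻¹ α, ?_, p_apply_inv g α⟩
    rw [Finset.mem_filter]
    refine ⟨L'.root _ hα.1, ?_⟩
    rw [← L.inner, ← L.coroot, p_apply_inv]; exact hα.2
  · intro α hα
    exact (tau_W0 hc hτ hg α (Finset.mem_filter.1 hα).1).symm

lemma MM_eq (hc : (0 : ℝ) < cz) (hτ : D.IsMultiplicity (cz : ℝ) τ) (η : V) :
    MM D τ η = PP D τ η 1 * PP D τ η (-1) := by
  unfold MM PP
  rw [← Finset.prod_filter_mul_prod_filter_not (D.R0.filter (fun α => ⟪η, coroot α⟫ = 1))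
    (fun α => α ∈ D.pos)]
  congr 1
  · refine Finset.prod_congr ?_ (fun _ _ => rfl)
    ext α
    simp only [Finset.mem_filter]
    exact ⟨fun h => ⟨h.2, h.1.2⟩, fun h => ⟨⟨pos_mem D h.1, h.2⟩, h.1⟩⟩
  · refine Finset.prod_bij (fun α _ => -α) ?_ ?_ ?_ ?_
    · intro α hα
      simp only [Finset.mem_filter] at hα ⊢
      refine ⟨(D.pos_or_neg α hα.1.1).resolve_left hα.2, ?_⟩
      rw [coroot_neg, inner_neg_right, hα.1.2]
    · intro a _ b _ h; exact neg_injective h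
    · intro α hα
      simp only [Finset.mem_filter] at hα
      refine ⟨-α, ?_, neg_neg α⟩
      simp only [Finset.mem_filter]
      refine ⟨⟨neg_mem D (pos_mem D hα.1), ?_⟩, D.pos_not_both α hα.1⟩
      rw [coroot_neg, inner_neg_right, hα.2]; norm_num
    · intro α hα
      exact (tau_negv hc hτ (Finset.mem_filter.1 (Finset.mem_filter.1 hα).1).1).symm

lemma PP_hshort_neg : PP D τ D.hshort (-1) = 1 := by
  unfold PP
  apply Finset.prod_eq_one
  intro α hα
  exfalso
  rw [Finset.mem_filter] at hα
  have := (inner_coroot_nonneg (D.ne_zero _ (pos_mem D hα.1))).2 (hshort_dom D hα.1)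
  rw [hα.2] at this
  norm_num at this

lemma tau_zero_eq (hc : (0 : ℝ) < cz) (hτ : D.IsMultiplicity (cz : ℝ) τ) {g : Equiv.Perm V}
    (hg : g ∈ D.W0) (r : ℤ) : τ (g D.hshort, r) = D.tauZero τ := by
  unfold RootSystemData.tauZero
  rw [tau_shift hc hτ ((W0_LI hg).root _ (hshort_mem0 D)), tau_shift hc hτ (neg_mem D (hshort_mem0 D)),
    tau_negv hc hτ (hshort_mem0 D), tau_W0 hc hτ hg _ (hshort_mem0 D)]

end AW

namespace AW
open RootSystemData
variable {V : Type*} [NormedAddCommGroup V] [InnerProductSpace ℝ V]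
variable {D : RootSystemData V} {cz : ℤ} {x0 : V} {τ : V × ℤ → ℂ}

lemma pair_refl {η : V} (hη : η ∈ D.R0) (α : V) : ⟪η, coroot (refl η α)⟫ = -⟪η, coroot α⟫ := by
  rw [coroot_refl' _ (D.ne_zero _ hη), inner_sub_right, inner_smul_right,
    inner_coroot_self (D.ne_zero _ hη)]
  ring

lemma pair_nrefl {η : V} (hη : η ∈ D.R0) (α : V) : ⟪η, coroot (-refl η α)⟫ = ⟪η, coroot α⟫ := by
  rw [coroot_neg, inner_neg_right, pair_refl hη, neg_neg]

lemma nrefl_nrefl {η : V} (hη : η ∈ D.R0) (α : V) : -refl η (-refl η α) = α := by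
  rw [refl_neg, refl_refl (D.ne_zero _ hη), neg_neg]

/-- a positive root pairing negatively with the positive root `η` stays positive. -/
lemma refl_pos_of_neg {η α : V} (hη : η ∈ D.pos) (hα : α ∈ D.pos) (h : ⟪η, coroot α⟫ < 0) :
    refl η α ∈ D.pos := by
  have hηR := pos_mem D hη
  have hαR := pos_mem D hα
  obtain ⟨x, -, hx⟩ := exists_height D
  rcases D.pos_or_neg _ (refl_mem D hηR hαR) with h1 | h1
  · exact h1
  · exfalso
    have h2 := hx _ h1
    have h3 : ⟪α, coroot η⟫ ≤ 0 := by
      by_contra hcon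
      have := (inner_coroot_comm_pos (x := α) (α := η) (D.ne_zero _ hηR) (D.ne_zero _ hαR)).1 (not_le.1 hcon)
      linarith
    unfold refl at h2
    rw [inner_neg_right, inner_sub_right, inner_smul_right] at h2
    have h4 := hx _ hη
    have h5 := hx _ hα
    nlinarith

lemma K0 (hc : (0 : ℝ) < cz) (hτ : D.IsMultiplicity (cz : ℝ) τ) {η : V} (hG : Good D η)
    (hη : η ∈ D.pos) : ∃ S : Finset (V × ℤ),
    (∀ a, a ∈ S ↔ D.IsAffPos a ∧ ⟪((η, 0) : V × ℤ).1, coroot a.1⟫ = 1 ∧ D.IsAffPos (-srefl (η, 0) a)) ∧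
    D.etau τ η = τ (η, 0) ^ 2 * ∏ a ∈ S, τ a := by
  have hηR := pos_mem D hη
  refine ⟨(D.pos.filter (fun α => ⟪η, coroot α⟫ = 1 ∧ -refl η α ∈ D.pos)).image (fun α => (α, 0)), ?_, ?_⟩
  · rintro ⟨α, k⟩
    simp only [Finset.mem_image, Finset.mem_filter, IsAffPos, srefl, Prod.fst_neg, Prod.snd_neg,
      Prod.mk.injEq]
    constructor
    · rintro ⟨β, ⟨h1, h2, h3⟩, rfl, rfl⟩
      exact ⟨⟨pos_mem D h1, Or.inr ⟨rfl, h1⟩⟩, h2, pos_mem D h3, Or.inr ⟨by simp, h3⟩⟩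
    · rintro ⟨⟨h1, h2⟩, h3, h4, h5⟩
      simp only [mul_zero, sub_zero] at h5
      have hk : k = 0 := by
        rcases h2 with h2 | h2 <;> rcases h5 with h5 | h5 <;> omega
      subst hk
      refine ⟨α, ⟨?_, h3, ?_⟩, rfl, rfl⟩
      · rcases h2 with h2 | h2
        · omega
        · exact h2.2
      · rcases h5 with h5 | h5
        · omega
        · exact h5.2
  · rw [etau_eq hτ hG, if_pos hη, if_neg (D.pos_not_both _ hη), mul_one, mul_assoc]
    congr 1
    rw [Finset.prod_image (by intro a _ b _ h; exact (Prod.mk.inj h).1)]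
    rw [mul_inv_eq_iff_eq_mul₀ (PP_ne hτ _ _)]
    unfold PP
    rw [← Finset.prod_filter_mul_prod_filter_not (D.pos.filter (fun α => ⟪η, coroot α⟫ = 1))
      (fun α => -refl η α ∈ D.pos), Finset.filter_filter]
    congr 1
    refine Finset.prod_bij (fun α _ => refl η α) ?_ ?_ ?_ ?_
    · intro α hα
      simp only [Finset.mem_filter] at hα ⊢
      refine ⟨(D.pos_or_neg _ (refl_mem D hηR (pos_mem D hα.1.1))).resolve_right hα.2, ?_⟩
      rw [pair_refl hηR, hα.1.2]
    · intro a _ b _ h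
      have := congrArg (refl η) h
      simpa only [refl_refl (D.ne_zero _ hηR)] using this
    · intro α hα
      simp only [Finset.mem_filter] at hα
      refine ⟨refl η α, ?_, refl_refl (D.ne_zero _ hηR) α⟩
      simp only [Finset.mem_filter]
      refine ⟨⟨refl_pos_of_neg hη hα.1 (by rw [hα.2]; norm_num), ?_⟩, ?_⟩
      · rw [pair_refl hηR, hα.2]; norm_num
      · rw [refl_refl (D.ne_zero _ hηR)]; exact D.pos_not_both _ hα.1
    · intro α hα
      exact (tau_refl hc hτ 0 (pos_mem D (Finset.mem_filter.1 (Finset.mem_filter.1 hα).1).1) hηR).symm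

lemma K1 (hc : (0 : ℝ) < cz) (hτ : D.IsMultiplicity (cz : ℝ) τ) {η : V} (hG : Good D η)
    (hη : -η ∈ D.pos) : ∃ S : Finset (V × ℤ),
    (∀ a, a ∈ S ↔ D.IsAffPos a ∧ ⟪((η, 1) : V × ℤ).1, coroot a.1⟫ = 1 ∧ D.IsAffPos (-srefl (η, 1) a)) ∧
    D.etau τ η * D.hvee τ = D.tauZero τ ^ 2 * ∏ a ∈ S, τ a := by
  have hηR : η ∈ D.R0 := by have := neg_mem D (pos_mem D hη); rwa [neg_neg] at this
  have hηn : η ∉ D.pos := by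
    intro h; have := D.pos_not_both _ hη; rw [neg_neg] at this; exact this h
  set F1 := (D.pos.filter (fun α => ⟪η, coroot α⟫ = 1)).image (fun α => (α, (0 : ℤ))) with hF1
  set F2 := (D.R0.filter (fun α => ⟪η, coroot α⟫ = 1 ∧ -refl η α ∈ D.pos)).image
    (fun α => (α, (1 : ℤ))) with hF2
  refine ⟨F1 ∪ F2, ?_, ?_⟩
  · rintro ⟨α, k⟩
    simp only [hF1, hF2, Finset.mem_union, Finset.mem_image, Finset.mem_filter, IsAffPos, srefl,
      Prod.fst_neg, Prod.snd_neg, Prod.mk.injEq]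
    constructor
    · rintro (⟨β, ⟨h1, h2⟩, rfl, rfl⟩ | ⟨β, ⟨h1, h2, h3⟩, rfl, rfl⟩)
      · refine ⟨⟨pos_mem D h1, Or.inr ⟨rfl, h1⟩⟩, h2,
          neg_mem D (refl_mem D hηR (pos_mem D h1)), Or.inl ?_⟩
        rw [h2]; norm_num
      · refine ⟨⟨h1, Or.inl le_rfl⟩, h2, pos_mem D h3, Or.inr ⟨?_, h3⟩⟩
        rw [h2]; norm_num
    · rintro ⟨⟨h1, h2⟩, h3, h4, h5⟩
      rw [h3] at h5
      simp only [Int.floor_one, mul_one] at h5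
      rcases h2 with h2 | ⟨h2, h2'⟩
      · right
        rcases h5 with h5 | ⟨h5, h5'⟩
        · omega
        · exact ⟨α, ⟨h1, h3, h5'⟩, rfl, by omega⟩
      · left
        exact ⟨α, ⟨h2', h3⟩, rfl, h2.symm⟩
  · have hdisj : Disjoint F1 F2 := by
      rw [Finset.disjoint_left]
      intro a h1 h2
      simp only [hF1, hF2, Finset.mem_image] at h1 h2
      obtain ⟨_, _, rfl⟩ := h1
      obtain ⟨_, _, h⟩ := h2
      have := congrArg Prod.snd h
      norm_num at this
    have e1 : ∏ a ∈ F1, τ a = PP D τ η 1 := by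
      rw [hF1, Finset.prod_image (by intro a _ b _ h; exact (Prod.mk.inj h).1)]; rfl
    have e2 : ∏ a ∈ F2, τ a = PP D τ η 1 := by
      rw [hF2, Finset.prod_image (by intro a _ b _ h; exact (Prod.mk.inj h).1)]
      unfold PP
      refine Finset.prod_bij (fun α _ => -refl η α) ?_ ?_ ?_ ?_
      · intro α hα
        simp only [Finset.mem_filter] at hα ⊢
        exact ⟨hα.2.2, by rw [pair_nrefl hηR, hα.2.1]⟩
      · intro a _ b _ h
        have := congrArg (fun z => -refl η z) h
        simpa only [nrefl_nrefl hηR] using this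
      · intro α hα
        simp only [Finset.mem_filter] at hα
        refine ⟨-refl η α, ?_, nrefl_nrefl hηR α⟩
        simp only [Finset.mem_filter]
        refine ⟨neg_mem D (refl_mem D hηR (pos_mem D hα.1)), by rw [pair_nrefl hηR, hα.2], ?_⟩
        rw [nrefl_nrefl hηR]; exact hα.1
      · intro α hα
        simp only [Finset.mem_filter] at hα
        rw [tau_negv hc hτ (refl_mem D hηR hα.1), tau_refl hc hτ 0 hα.1 hηR, tau_shift hc hτ hα.1]
    obtain ⟨g, hg, hgη⟩ := hG.orb hηR
    have t1 : τ (-η, 0) = D.tauZero τ := by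
      rw [tau_negv hc hτ hηR, ← hgη, tau_zero_eq hc hτ hg]
    have t2 : τ (D.hshort, 0) = D.tauZero τ := by
      have := tau_zero_eq hc hτ (D.W0.one_mem) 0
      simpa using this
    have hmm : PP D τ η 1 * PP D τ η (-1) = PP D τ D.hshort 1 := by
      rw [← MM_eq hc hτ, ← hgη, MM_W0 hc hτ hg, MM_eq hc hτ, PP_hshort_neg, mul_one]
    have hne : D.tauZero τ ≠ 0 := by
      rw [← t2]; exact hτ.1 _ (hshort_mem0 D)
    rw [Finset.prod_union hdisj, e1, e2, etau_eq hτ hG, if_neg hηn, if_pos hη, hvee,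
      etau_eq hτ good_hshort, if_pos D.hshort_mem, if_neg (D.pos_not_both _ D.hshort_mem),
      PP_hshort_neg, t1, t2, ← hmm]
    have := PP_ne hτ η (-1)
    field_simp

end AW

namespace AW
open RootSystemData
variable {V : Type*} [NormedAddCommGroup V] [InnerProductSpace ℝ V]
variable {D : RootSystemData V} {cz : ℤ} {x0 : V} {τ : V × ℤ → ℂ}

lemma good_lin {w : Equiv.Perm V} (hw : w ∈ D.WR (cz : ℝ)) {ν : V} (hG : Good D ν) :
    Good D (linPart w ν) := by
  obtain ⟨⟨g, hg, h⟩, -⟩ := linPart_spec hw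
  rw [h]; exact hG.map hg

lemma linPart_inj {w : Equiv.Perm V} {x y : V} (h : linPart w x = linPart w y) : x = y := by
  unfold linPart at h
  exact w.injective (sub_left_injective h)

/-- Values of the roots in `R(w_μ)` for `μ = L - η`, `L` in the alcove. -/
lemma rw_class (hc : (0 : ℝ) < cz) (hx : IsX0 D (cz : ℝ) x0) {wmin : V → Equiv.Perm V}
    (hwmin : D.IsWmin (cz : ℝ) wmin) {L η : V} (hLP : L ∈ D.weightLattice)
    (hLA : L ∈ D.alcove (cz : ℝ)) (hG : Good D η) {b : V × ℤ}
    (hb : b ∈ D.RW (cz : ℝ) (wmin (L - η))) :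
    (⟪η, coroot b.1⟫ = 1 ∧ aval (cz : ℝ) b L = 0 ∧ aval (cz : ℝ) b (L - η) = -1) ∨
    (b.1 = η ∧ aval (cz : ℝ) b L = 0 ∧ aval (cz : ℝ) b (L - η) = -2) ∨
    (b.1 = η ∧ aval (cz : ℝ) b L = 1 ∧ aval (cz : ℝ) b (L - η) = -1) := by
  rw [RW_wmin hc hx hwmin] at hb
  obtain ⟨hp, hv⟩ := hb
  have h0 := hLA b hp
  have hroot : D.IsAffRoot b := hp.1
  obtain ⟨k, hk⟩ := aval_int (cz := cz) hroot hLP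
  rw [aval_sub] at hv ⊢
  rw [hk] at hv h0 ⊢
  have hk0 : 0 ≤ k := by exact_mod_cast h0
  rcases hG.cases hp.1 with ⟨e, h⟩ | ⟨e, h⟩ | h | h | h <;> rw [h] at hv ⊢
  · have : k < 2 := by
      have : (k : ℝ) < 2 := by linarith
      exact_mod_cast this
    right
    have : k = 0 ∨ k = 1 := by omega
    rcases this with rfl | rfl
    · left; refine ⟨e, ?_, ?_⟩ <;> norm_num
    · right; refine ⟨e, ?_, ?_⟩ <;> norm_num
  · exfalso; linarith
  · have : k < 1 := by
      have : (k : ℝ) < 1 := by linarith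
      exact_mod_cast this
    have : k = 0 := by omega
    subst this
    left; refine ⟨rfl, ?_, ?_⟩ <;> norm_num
  · exfalso; linarith
  · exfalso; linarith

lemma inv_RW_pos (hc : (0 : ℝ) < cz) (hx : IsX0 D (cz : ℝ) x0) {wmin : V → Equiv.Perm V}
    (hwmin : D.IsWmin (cz : ℝ) wmin) {lam : V} {b : V × ℤ}
    (hb : b ∈ D.RW (cz : ℝ) (wmin lam)⁻¹) :
    0 < aval (cz : ℝ) b (wmin lam lam) ∧ aval (cz : ℝ) b (wmin lam x0) < 0 := by
  have hw := (hwmin lam).1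
  obtain ⟨h1, h2, h3⟩ := (mem_RW hx (inv_mem hw)).1 hb
  rw [inv_inv] at h3
  refine ⟨?_, h3⟩
  have hr := pull_root hw h1
  have : -pull D (cz : ℝ) (wmin lam) b ∈ D.RW (cz : ℝ) (wmin lam) := by
    refine (mem_RW hx hw).2 ⟨neg_root hr, ?_, ?_⟩
    · rw [aval_neg, aval_pull hw h1]; linarith
    · rw [aval_neg, aval_pull hw h1, p_apply_inv]; linarith
  rw [RW_wmin hc hx hwmin] at this
  have := this.2
  rw [aval_neg, aval_pull hw h1] at this
  linarith

lemma snd_eq (hc : (0 : ℝ) < cz) {a b : V × ℤ} {L : V} (h1 : a.1 = b.1)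
    (h2 : aval (cz : ℝ) a L = aval (cz : ℝ) b L) : a = b := by
  refine Prod.ext h1 ?_
  unfold aval at h2
  rw [h1] at h2
  have h3 : (a.2 : ℝ) * cz = b.2 * cz := by linarith
  have := mul_right_cancel₀ (ne_of_gt hc) h3
  exact_mod_cast this

theorem main_id (hc1 : 1 < cz) (hc : (0 : ℝ) < cz) (hx : IsX0 D (cz : ℝ) x0)
    (hτ : D.IsMultiplicity (cz : ℝ) τ) {wmin : V → Equiv.Perm V}
    (hwmin : D.IsWmin (cz : ℝ) wmin) (f : V → ℂ) {lam ν : V} (hlam : lam ∈ D.weightLattice)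
    (hG : Good D ν) :
    (D.tauw (cz : ℝ) τ (wmin lam))⁻¹ * Op D cz τ (wmin lam) f (wmin lam (lam - ν))
      = D.acoef (cz : ℝ) τ wmin lam ν * ((D.tauw (cz : ℝ) τ (wmin (lam - ν)))⁻¹ *
            Op D cz τ (wmin (lam - ν)) f (wmin (lam - ν) (lam - ν)))
        + D.bcoef (cz : ℝ) τ wmin lam ν * (1 - (D.tauZero τ)⁻¹ ^ 2) *
          ((D.tauw (cz : ℝ) τ (wmin lam))⁻¹ * Op D cz τ (wmin lam) f (wmin lam lam)) := by
  obtain ⟨hw, hLA, -⟩ := hwmin lam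
  have hνP := P_sub hlam hG.P
  have hG' := good_lin hw hG
  have hμ := w_sub hw lam ν
  unfold acoef bcoef
  generalize hwdef : wmin lam = w at *
  set L := w lam with hL
  set η := linPart w ν with hη
  rw [hμ]
  have hLP : L ∈ D.weightLattice := WR_P hw _ hlam
  have hμP : L - η ∈ D.weightLattice := P_sub hLP hG'.P
  obtain ⟨hm, hmA, hmin⟩ := hwmin (L - η)
  have hcl : ∀ b ∈ D.RW (cz : ℝ) (wmin (L - η)), _ := fun b hb =>
    rw_class hc hx hwmin hLP hLA hG' hb
  have hRWm := RW_wmin hc hx hwmin (L - η)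
  have hinv : ∀ b ∈ D.RW (cz : ℝ) w⁻¹, 0 < aval (cz : ℝ) b L ∧ aval (cz : ℝ) b (w x0) < 0 := by
    intro b hb
    have := inv_RW_pos hc hx hwmin (lam := lam) (b := b) (by rw [hwdef]; exact hb)
    rwa [hwdef] at this
  have hmwa : (wmin (L - η) * w) (lam - ν) = wmin (L - η) (L - η) := by
    rw [Equiv.Perm.mul_apply, hμ]
  have hmw := mul_mem hm hw
  have hF4 : wmin (L - η) (L - η) = wmin (lam - ν) (lam - ν) := by
    rw [← hmwa]
    exact (wmin_factor hc hx hwmin hmw (by rw [hmwa]; exact hmA)).1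
  have hOpmw := Op_alcove hc hx hτ hwmin f hνP hmw (by rw [hmwa]; exact hmA)
  rw [hmwa] at hOpmw
  have htw := tauw_ne hx hτ hw
  have htm := tauw_ne hx hτ hm
  have hmP : wmin (L - η) (L - η) ∈ D.weightLattice := WR_P hm _ hμP
  have hbη : ∀ b : V × ℤ, D.IsAffRoot b → b.1 = η → τ b = D.tauZero τ := by
    intro b hb hb1
    obtain ⟨g, hg, hgη⟩ := hG'.orb (by rw [← hb1]; exact hb)
    have := tau_zero_eq hc hτ hg b.2
    rw [hgη, ← hb1] at this
    exact this
  have ht0 : D.tauZero τ ≠ 0 := hτ.1 _ (neg_mem D (hshort_mem0 D))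
  generalize hmdef : wmin (L - η) = m at *
  generalize hJ : (D.tauw (cz : ℝ) τ (wmin (lam - ν)))⁻¹ *
            Op D cz τ (wmin (lam - ν)) f (wmin (lam - ν) (lam - ν)) = Jν at *
  set g := Op D cz τ w f with hg
  by_cases heq : wmin (lam - ν) (lam - ν) = L
  · rw [if_pos heq]
    have hmL : m (L - η) = L := hF4.trans heq
    obtain ⟨b, hbm, hb1, hbL, hbμ⟩ : ∃ b ∈ D.RW (cz : ℝ) m, b.1 = η ∧
        aval (cz : ℝ) b L = 1 ∧ aval (cz : ℝ) b (L - η) = -1 := by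
      by_contra hcon
      push Not at hcon
      have : m L = L := by
        refine fix_of_vanish hc hx hm (fun a ha => ?_)
        rcases hcl a ha with h | h | h
        · exact h.2.1
        · exact h.2.1
        · exact absurd h.2.2 (hcon a ha h.1 h.2.1)
      have h2 := m.injective (hmL.trans this.symm)
      exact hG'.ne (by simpa using h2)
    have hbp : D.IsAffPos b := by rw [hRWm] at hbm; exact hbm.1
    have hbr : D.IsAffRoot b := hbp.1
    have hall : ∀ a ∈ D.RW (cz : ℝ) m, aval (cz : ℝ) a (L - η) = -1 ∧
        (a ≠ b → aval (cz : ℝ) a L = 0) := by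
      intro a ha
      rcases hcl a ha with h | h | h
      · exact ⟨h.2.2, fun _ => h.2.1⟩
      · exfalso
        have h1 := h.2.1
        have h2 := hbL
        unfold aval at h1 h2
        rw [h.1] at h1
        rw [hb1] at h2
        have : ((b.2 - a.2) * cz : ℝ) = 1 := by linarith
        have : (b.2 - a.2) * cz = 1 := by exact_mod_cast this
        have := Int.eq_one_or_neg_one_of_mul_eq_one' this
        omega
      · exact ⟨h.2.2, fun hne => absurd (snd_eq hc (h.1.trans hb1.symm) (h.2.1.trans hbL.symm)) hne⟩
    have hm1 := Op_m1 hc hx hτ g hμP m hm (fun a ha => (hall a ha).1)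
    -- the root `w⁻¹ b`
    set p := pull D (cz : ℝ) w b with hp
    have hpr : D.IsAffRoot p := pull_root hw hbr
    have hp1 : p.1 = ν := linPart_inj (by rw [hp, linPart_pull hw hbr, hb1])
    have hpx : (ν, ⌊(1 - ⟪lam, coroot ν⟫) / (cz : ℝ)⌋) = p := by
      refine Prod.ext hp1.symm ?_
      have h1 : aval (cz : ℝ) p lam = 1 := by rw [hp, aval_pull hw hbr]; exact hbL
      unfold aval at h1
      rw [hp1] at h1
      have : (1 - ⟪lam, coroot ν⟫) / (cz : ℝ) = (p.2 : ℝ) := by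
        rw [div_eq_iff (ne_of_gt hc)]; linarith
      simp only [this, Int.floor_intCast]
    rw [hpx]
    have hneg : D.IsAffNeg p ↔ aval (cz : ℝ) b (w x0) < 0 := by
      rw [(hx p hpr).2, hp, aval_pull hw hbr]
    by_cases hn : aval (cz : ℝ) b (w x0) < 0
    · rw [if_pos (hneg.2 hn)]
      obtain ⟨v, hv, u, hu, j, hmv, hua, huj, hjx, hlen⟩ := cut hc hx m hm hbm
      have hjr := aSimple_root D j
      have hu0 : ∀ a ∈ D.RW (cz : ℝ) u, aval (cz : ℝ) a L = 0 := fun a ha =>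
        (hall a (hua a ha).1).2 (hua a ha).2
      have huL : u L = L := fix_of_vanish hc hx hu hu0
      have hjL : aval (cz : ℝ) (D.aSimple j) L = 1 := by
        have := aval_pull hu hjr L
        rw [huj, huL, hbL] at this; exact this.symm
      have hsu : (sj D (cz : ℝ) j * u) (L - η) = L := by
        have h1 : linPart u η = (D.aSimple j).1 := by
          rw [← hb1, ← huj, linPart_pull hu hjr]
        rw [Equiv.Perm.mul_apply, w_sub hu, huL, h1, sj_apply]
        unfold sAff
        rw [aval_sub, hjL, inner_coroot_self (aSimple_ne D j)]
        module
      have hmsu : m = sj D (cz : ℝ) j * u := by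
        rcases hmin _ (mul_mem (sj_mem j) hu) (by rw [hsu]; exact hLA) with h | h
        · omega
        · exact h.symm
      have hAd : Addi D (cz : ℝ) u w := by
        intro a ha ha'
        have := (hinv a ha').1
        rw [hu0 a ha] at this
        exact lt_irrefl _ this
      have huw := mul_mem hu hw
      have hneg2 : aval (cz : ℝ) (D.aSimple j) ((u * w) x0) < 0 := by
        have := aval_pull hu hjr (w x0)
        rw [huj] at this
        rw [Equiv.Perm.mul_apply, ← this]; exact hn
      have hmw' : m * w = sj D (cz : ℝ) j * (u * w) := by rw [hmsu, mul_assoc]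
      have hpos2 : 0 < aval (cz : ℝ) (D.aSimple j) ((m * w) x0) := by
        rw [hmw', Equiv.Perm.mul_apply, aval_sj]; linarith
      have hback : sj D (cz : ℝ) j * (m * w) = u * w := by rw [hmw', sj_cancel]
      have e1 : ∀ y ∈ D.weightLattice, Op D cz τ u g y =
          Iop (cz : ℝ) τ (D.aSimple j) (Op D cz τ (m * w) f) y := by
        intro y hy
        rw [← Op_mul hc hx hτ hu hw hAd f hy, ← hback, Op_asc hc hx hτ hmw hpos2 f hy]
      have e2 : Op D cz τ m g L = Op D cz τ (m * w) f L +
          (τ (D.aSimple j) - (τ (D.aSimple j))⁻¹) * Op D cz τ (u * w) f L := by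
        conv_lhs => rw [hmsu]
        rw [Op_asc hc hx hτ hu hjx g hLP, Iop_congr τ hjr e1 hLP,
          quad_rel hjr (hτ.1 _ hjr) _ hLP, ← hback, Op_asc hc hx hτ hmw hpos2 f hLP]
      have e3 : Op D cz τ (u * w) f L = D.tauw (cz : ℝ) τ u * D.tauw (cz : ℝ) τ w *
          ((D.tauw (cz : ℝ) τ w)⁻¹ * g L) := by
        have hLe : (u * w) lam = L := by rw [Equiv.Perm.mul_apply]; exact huL
        have := Op_alcove hc hx hτ hwmin f hlam huw (by rw [hLe]; exact hLA)
        rw [hLe, hwdef] at this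
        rw [this, tauw_mul hc hx hτ hu hw hAd]
      have hτj : τ (D.aSimple j) = D.tauZero τ := by
        rw [← hbη b hbr hb1, ← huj, tau_pull hτ hu hjr]
      have htm2 : D.tauw (cz : ℝ) τ m = D.tauZero τ * D.tauw (cz : ℝ) τ u := by
        rw [hmsu, tauw_asc hc hx hτ hu hjx, hτj]
      rw [hmL] at hm1 hOpmw
      rw [hm1, hOpmw, e3, hτj] at e2
      have e4 : g (L - η) = D.tauw (cz : ℝ) τ m * (D.tauw (cz : ℝ) τ (m * w) * Jν +
          (D.tauZero τ - (D.tauZero τ)⁻¹) * (D.tauw (cz : ℝ) τ u * D.tauw (cz : ℝ) τ w *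
          ((D.tauw (cz : ℝ) τ w)⁻¹ * g L))) := by
        rw [← e2, mul_inv_cancel_left₀ htm]
      rw [e4, htm2]
      field_simp
    · rw [if_neg (fun h => hn (hneg.1 h))]
      have hAd : Addi D (cz : ℝ) m w := by
        intro a ha ha'
        obtain ⟨h1, h2⟩ := hinv a ha'
        by_cases hab : a = b
        · rw [hab] at h2; exact hn h2
        · rw [(hall a ha).2 hab] at h1; exact lt_irrefl _ h1
      rw [Op_mul hc hx hτ hm hw hAd f hmP, hm1] at hOpmw
      have e4 : g (L - η) = D.tauw (cz : ℝ) τ m * (D.tauw (cz : ℝ) τ (m * w) * Jν) := by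
        rw [← hOpmw, mul_inv_cancel_left₀ htm]
      rw [e4]; ring
  · rw [if_neg heq]
    have hcl2 : ∀ b ∈ D.RW (cz : ℝ) m, aval (cz : ℝ) b L = 0 ∧
        ((⟪η, coroot b.1⟫ = 1 ∧ aval (cz : ℝ) b (L - η) = -1) ∨
          (b.1 = η ∧ aval (cz : ℝ) b (L - η) = -2)) := by
      intro b hb
      rcases hcl b hb with h | h | h
      · exact ⟨h.2.1, Or.inl ⟨h.1, h.2.2⟩⟩
      · exact ⟨h.2.1, Or.inr ⟨h.1, h.2.2⟩⟩
      · exfalso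
        have hbr : D.IsAffRoot b := ((mem_RW hx hm).1 hb).1
        have h1 : (m * sP (cz : ℝ) b) L = m (L - η) := by
          rw [Equiv.Perm.mul_apply, sP_apply _ _ (root_ne hbr)]
          unfold sAff
          rw [h.2.1, h.1, one_smul]
        have := alcove_unique hc hx (mul_mem hm (sP_mem hbr)) hLA (by rw [h1]; exact hmA)
        rw [h1, hF4] at this
        exact heq this
    have hAd : Addi D (cz : ℝ) m w := by
      intro a ha ha'
      have := (hinv a ha').1
      rw [(hcl2 a ha).1] at this
      exact lt_irrefl _ this
    rw [Op_mul hc hx hτ hm hw hAd f hmP] at hOpmw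
    unfold ccoef theta
    rw [hmdef]
    by_cases hex : ∃ b ∈ D.RW (cz : ℝ) m, b.1 = η ∧ aval (cz : ℝ) b (L - η) = -2
    · obtain ⟨b, hbm, hb1, hb2⟩ := hex
      have hbL := (hcl2 b hbm).1
      have hbp : D.IsAffPos b := by rw [hRWm] at hbm; exact hbm.1
      have hbr : D.IsAffRoot b := hbp.1
      have hset : {a : V × ℤ | a ∈ D.RW (cz : ℝ) m ∧ aval (cz : ℝ) a (L - η) = -2} = {b} := by
        ext a
        simp only [Set.mem_setOf_eq, Set.mem_singleton_iff]
        constructor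
        · rintro ⟨h1, h2⟩
          obtain ⟨h3, h4 | h4⟩ := hcl2 a h1
          · rw [h4.2] at h2; norm_num at h2
          · exact snd_eq hc (h4.1.trans hb1.symm) (h3.trans hbL.symm)
        · rintro rfl; exact ⟨hbm, hb2⟩
      rw [hset, Set.ncard_singleton, Nat.cast_one, one_mul]
      obtain ⟨u, hu, hua, ⟨j, hj⟩, hop⟩ := Op_m2 hc hx hτ g hLP hbr (by rw [hb1]; exact hb2) m hm
        (fun a ha => (hcl2 a ha).1) (fun a ha => by
          rw [hb1]
          obtain ⟨h3, h4 | h4⟩ := hcl2 a ha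
          · exact Or.inl h4.2
          · exact Or.inr (snd_eq hc (h4.1.trans hb1.symm) (h3.trans hbL.symm))) hbm
      have hall : ∀ a ∈ D.RW (cz : ℝ) u, ⟪b.1, coroot a.1⟫ = 1 := by
        intro a ha
        rw [hb1]
        obtain ⟨h3, h4 | h4⟩ := hcl2 a (hua a ha).1
        · exact h4.1
        · exact absurd (snd_eq hc (h4.1.trans hb1.symm) (h3.trans hbL.symm)) (hua a ha).2
      have hηR : η ∈ D.R0 := by rw [← hb1]; exact hbr
      have hτb := hbη b hbr hb1
      have hK : D.etau τ η * D.hvee τ ^ (-sgnZ ⟪L, coroot η⟫) =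
          D.tauZero τ ^ 2 * D.tauw (cz : ℝ) τ u ^ 2 := by
        have hbv := hbL
        unfold aval at hbv
        rw [hb1] at hbv
        obtain ⟨β, r⟩ := b
        simp only at hb1 hbv
        subst hb1
        have hr : r = 0 ∨ r = 1 := by
          have h3 := hLA (η, 1) ⟨hηR, Or.inl le_rfl⟩
          unfold aval at h3
          simp only at h3
          have h4 : (0 : ℝ) ≤ (1 - r) * cz := by push_cast at h3; linarith
          have h5 : (0 : ℝ) ≤ 1 - r := nonneg_of_mul_nonneg_left h4 hc
          have h6 : r ≤ 1 := by
            have : (r : ℝ) ≤ 1 := by linarith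
            exact_mod_cast this
          rcases hbp.2 with h | h
          · simp only at h; omega
          · exact Or.inl h.1
        rcases hr with rfl | rfl
        · have hpos : η ∈ D.pos := by
            rcases hbp.2 with h | h
            · norm_num at h
            · exact h.2
          obtain ⟨S, hS, hK⟩ := K0 hc hτ hG' hpos
          have h0 : ⟪L, coroot η⟫ = 0 := by simpa using hbv
          rw [tauu_sq hc hx hτ hu hbr hj hall S hS, h0, hK, hτb]
          simp [sgnZ]
        · have hval : ⟪L, coroot η⟫ = -(cz : ℝ) := by push_cast at hbv; linarith
          have hpos : -η ∈ D.pos := by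
            rcases D.pos_or_neg η hηR with h | h
            · exfalso
              have := hLA (η, 0) ⟨hηR, Or.inr ⟨rfl, h⟩⟩
              unfold aval at this
              simp only [Int.cast_zero, zero_mul, add_zero] at this
              linarith
            · exact h
          obtain ⟨S, hS, hK⟩ := K1 hc hτ hG' hpos
          rw [tauu_sq hc hx hτ hu hbr hj hall S hS, ← hK, hval]
          have : sgnZ (-(cz : ℝ)) = -1 := by
            unfold sgnZ
            rw [if_neg (by linarith), if_pos (by linarith)]
          rw [this]; simp
      rw [hK]
      rw [hb1] at hop
      rw [hop, hτb] at hOpmw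
      have e4 : g (L - η) = D.tauw (cz : ℝ) τ m * (D.tauw (cz : ℝ) τ (m * w) * Jν) +
          ((D.tauZero τ - (D.tauZero τ)⁻¹) * D.tauZero τ * D.tauw (cz : ℝ) τ u ^ 2) * g L := by
        rw [← hOpmw]
        field_simp
        ring
      rw [e4]
      field_simp
    · have hset : {a : V × ℤ | a ∈ D.RW (cz : ℝ) m ∧ aval (cz : ℝ) a (L - η) = -2} = ∅ := by
        ext a
        simp only [Set.mem_setOf_eq, Set.mem_empty_iff_false, iff_false]
        rintro ⟨h1, h2⟩
        obtain ⟨h3, h4 | h4⟩ := hcl2 a h1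
        · rw [h4.2] at h2; norm_num at h2
        · exact hex ⟨a, h1, h4.1, h4.2⟩
      rw [hset, Set.ncard_empty]
      have hm1 := Op_m1 hc hx hτ g hμP m hm (fun a ha => by
        obtain ⟨h3, h4 | h4⟩ := hcl2 a ha
        · exact h4.2
        · exact absurd ⟨a, ha, h4⟩ hex)
      rw [hm1] at hOpmw
      have e4 : g (L - η) = D.tauw (cz : ℝ) τ m * (D.tauw (cz : ℝ) τ (m * w) * Jν) := by
        rw [← hOpmw, mul_inv_cancel_left₀ htm]
      rw [e4]
      push_cast
      ring

end AW

namespace AW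
open RootSystemData
variable {V : Type*} [NormedAddCommGroup V] [InnerProductSpace ℝ V]
variable {D : RootSystemData V} {cz : ℤ} {x0 : V} {τ : V × ℤ → ℂ}

lemma ev_apply (c : ℝ) (l : List (Fin (D.n + 1))) (x : V) :
    ev D c l x = ((l.map fun j => sAff c (D.aSimple j)).foldr (· ∘ ·) id) x := by
  induction l with
  | nil => rfl
  | cons j l ih =>
    rw [ev_cons, Equiv.Perm.mul_apply, ih, sj_apply]
    rfl

lemma red_of_reducedWord {c : ℝ} {w : Equiv.Perm V} {l : List (Fin (D.n + 1))}
    (h : D.IsReducedWord c w l) : ev D c l = w ∧ Red D c l := by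
  have h1 : ev D c l = w := by
    ext x; rw [ev_apply, h.2 x]
  exact ⟨h1, by unfold Red; rw [h1]; exact h.1⟩

lemma good_Ptheta {ν : V} (h : ν ∈ D.Ptheta) (h0 : ν ≠ 0) : Good D ν where
  P := h.1
  ne := h0
  pair := fun α hα => by
    by_cases e : α = ν
    · exact Or.inr (Or.inl e)
    · exact Or.inl (h.2 α hα e)
  orb := fun hν => by
    exfalso
    have hne : -ν ≠ ν := by
      intro e
      have h1 : ⟪-ν, ν⟫ = ⟪ν, ν⟫ := by rw [e]
      have h2 := inner_self_pos h0
      rw [inner_neg_left] at h1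
      linarith
    have := h.2 (-ν) (neg_mem D hν) hne
    rw [coroot_neg, inner_neg_right, inner_coroot_self h0] at this
    norm_num at this

lemma good_minuscule {ω : V} (h : D.IsMinuscule ω) : Good D ω := by
  obtain ⟨h1, h2, h3, h4⟩ := h
  have hp : ∀ α ∈ D.R0, |⟪ω, coroot α⟫| ≤ 1 := by
    intro α hα
    rcases D.pos_or_neg α hα with h | h
    · exact abs_le.2 ⟨by linarith [h2 α h], h4 α h⟩
    · have a1 := h2 _ h
      have a2 := h4 _ h
      rw [coroot_neg, inner_neg_right] at a1 a2
      exact abs_le.2 ⟨by linarith, by linarith⟩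
  refine ⟨h1, h3, fun α hα => Or.inl (hp α hα), fun hω => ?_⟩
  have := hp ω hω
  rw [inner_coroot_self h3] at this
  norm_num at this

end AW

open RootSystemData in
/-- the fundamental intertwining identity
`τ_{w_λ}⁻¹ (I_{w_λ}f)(w_λ(λ-ν)) = a_{λ,ν} (𝒥f)(λ-ν) + b_{λ,ν}(1-τ₀⁻²)(𝒥f)(λ)` for
`λ ∈ P`, `ν ∈ P_ϑ⋆`; consequently, for each (quasi-)minuscule `ω ∈ P⁺`, the discrete
Laplacian `L_ω` satisfies `L_ω ∘ 𝒥 = 𝒥 ∘ (∑_{ν ∈ W₀ω} t_ν)` on functions `P → ℂ`. -/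
theorem statement7 {V : Type*} [NormedAddCommGroup V] [InnerProductSpace ℝ V]
    (D : RootSystemData V) (cz : ℤ) (hc : 1 < cz)
    (τ : V × ℤ → ℂ) (hτ : D.IsMultiplicity (cz : ℝ) τ)
    (wmin : V → Equiv.Perm V) (hwmin : D.IsWmin (cz : ℝ) wmin)
    (Iw : Equiv.Perm V → (V → ℂ) → V → ℂ)
    (hIw : ∀ x : V, ∃ l : List (Fin (D.n + 1)),
      D.IsReducedWord (cz : ℝ) (wmin x) l ∧ Iw (wmin x) = D.wordOp (cz : ℝ) τ l) :
    -- the fundamental identity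
    (∀ f : V → ℂ, ∀ lam ∈ D.weightLattice, ∀ ν ∈ D.Ptheta, ν ≠ 0 →
      (D.tauw (cz : ℝ) τ (wmin lam))⁻¹ * Iw (wmin lam) f ((wmin lam) (lam - ν))
        = D.acoef (cz : ℝ) τ wmin lam ν * D.Jcal (cz : ℝ) τ wmin Iw f (lam - ν)
          + D.bcoef (cz : ℝ) τ wmin lam ν * (1 - (D.tauZero τ)⁻¹ ^ 2)
              * D.Jcal (cz : ℝ) τ wmin Iw f lam) ∧
    -- the intertwining relation L_ω ∘ 𝒥 = 𝒥 ∘ m_ω(t)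
    (∀ ω : V, D.IsMinuscule ω ∨ D.IsQuasiMinuscule ω →
      ∀ orb : Finset V, (∀ ν : V, ν ∈ orb ↔ ∃ w ∈ D.W0, w ω = ν) →
      ∀ f : V → ℂ, ∀ lam ∈ D.weightLattice,
        ∑ ν ∈ orb,
            (D.acoef (cz : ℝ) τ wmin lam ν * D.Jcal (cz : ℝ) τ wmin Iw f (lam - ν)
              + D.bcoef (cz : ℝ) τ wmin lam ν * (1 - (D.tauZero τ)⁻¹ ^ 2)
                  * D.Jcal (cz : ℝ) τ wmin Iw f lam)
          = D.Jcal (cz : ℝ) τ wmin Iw (fun x => ∑ ν ∈ orb, f (x - ν)) lam) := by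
  have hc0 : (0 : ℝ) < cz := by
    have : 0 < cz := by omega
    exact_mod_cast this
  obtain ⟨x0, hx⟩ := AW.exists_x0 D hc0
  have hI : ∀ x f, ∀ y ∈ D.weightLattice, Iw (wmin x) f y = AW.Op D cz τ (wmin x) f y := by
    intro x f y hy
    obtain ⟨l, hl, e⟩ := hIw x
    obtain ⟨h1, h2⟩ := AW.red_of_reducedWord hl
    rw [e, AW.Op_word hc0 hx hτ h2 f hy, h1]
  have hwP : ∀ x, ∀ y ∈ D.weightLattice, wmin x y ∈ D.weightLattice := fun x y hy =>
    AW.WR_P (hwmin x).1 y hy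
  have hmain : ∀ f : V → ℂ, ∀ lam ∈ D.weightLattice, ∀ ν : V, AW.Good D ν →
      (D.tauw (cz : ℝ) τ (wmin lam))⁻¹ * Iw (wmin lam) f ((wmin lam) (lam - ν))
        = D.acoef (cz : ℝ) τ wmin lam ν * D.Jcal (cz : ℝ) τ wmin Iw f (lam - ν)
          + D.bcoef (cz : ℝ) τ wmin lam ν * (1 - (D.tauZero τ)⁻¹ ^ 2)
              * D.Jcal (cz : ℝ) τ wmin Iw f lam := by
    intro f lam hlam ν hG
    have hP := AW.P_sub hlam hG.P
    unfold Jcal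
    rw [hI _ _ _ (hwP _ _ hP), hI _ _ _ (hwP _ _ hP), hI _ _ _ (hwP _ _ hlam)]
    exact AW.main_id hc hc0 hx hτ hwmin f hlam hG
  refine ⟨fun f lam hlam ν hν h0 => hmain f lam hlam ν (AW.good_Ptheta hν h0), ?_⟩
  intro ω hω orb horb f lam hlam
  have hGω : AW.Good D ω := by
    rcases hω with h | h
    · exact AW.good_minuscule h
    · rw [show ω = D.hshort from h]; exact AW.good_hshort
  have hGorb : ∀ ν ∈ orb, AW.Good D ν := by
    intro ν hν
    obtain ⟨g, hg, rfl⟩ := (horb ν).1 hν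
    exact hGω.map hg
  have hstable : ∀ g ∈ D.W0, ∀ ν ∈ orb, g ν ∈ orb := by
    intro g hg ν hν
    obtain ⟨g', hg', rfl⟩ := (horb ν).1 hν
    exact (horb _).2 ⟨g * g', mul_mem hg hg', rfl⟩
  have hst : ∀ ν ∈ orb, ∀ α ∈ D.R0, AW.refl α ν ∈ orb := by
    intro ν hν α hα
    have hinv : Function.Involutive (AW.refl α) := AW.refl_refl (D.ne_zero _ hα)
    have := hstable hinv.toPerm (Subgroup.subset_closure ⟨α, hα, fun x => rfl⟩) ν hν
    exact this
  rw [← Finset.sum_congr rfl (fun ν hν => hmain f lam hlam ν (hGorb ν hν))]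
  unfold Jcal
  rw [← Finset.mul_sum]
  congr 1
  obtain ⟨l, hl, e⟩ := hIw lam
  rw [e, AW.wordOp_comm_word (fun ν hν => (hGorb ν hν).P) hst l f (hwP _ _ hlam)]
  have hw := (hwmin lam).1
  obtain ⟨⟨g, hg, hlin⟩, -⟩ := AW.linPart_spec hw
  refine Finset.sum_bij (fun ν _ => g ν) (fun ν hν => hstable g hg ν hν)
    (fun a _ b _ h => g.injective h) (fun ν hν => ⟨g⁻¹ ν, hstable _ (inv_mem hg) ν hν, by simp⟩) ?_
  intro ν hν
  rw [AW.w_sub hw, hlin]
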